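/- arXiv:math/0605616 — 10 statements merged into one kernel-verified Lean document; each statement's English description precedes it below -/
import Mathlib

section
/- If X is an N × n matrix with entries in {1, −1} and n ≥ 2 that is an orthogonal array of strength two, then its double D(X) is an orthogonal array of strength two (a 2N × 2n array). -/
-- X (with rows indexed by R and columns by C) is an orthogonal array of strength t:
-- for every injective choice of t columns and every sign pattern s ∈ {1,-1}^t,
-- 2^t * (number of rows matching s on those columns) = number of rows.
def isOA {R C : Type*} [Fintype R] (t : ℕ) (X : R → C → ℝ) : Prop :=
  ∀ c : Fin t → C, Function.Injective c →
    ∀ s : Fin t → ℝ, (∀ i, s i = 1 ∨ s i = -1) →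
      2 ^ t * (Finset.univ.filter fun r => ∀ i, X r (c i) = s i).card = Fintype.card R

theorem isOA_two_iff {R C : Type*} [Fintype R] (X : R → C → ℝ) :
    isOA 2 X ↔ ∀ j k, j ≠ k → ∀ a b : ℝ, (a = 1 ∨ a = -1) → (b = 1 ∨ b = -1) →
      4 * (Finset.univ.filter fun r => X r j = a ∧ X r k = b).card = Fintype.card R := by
  constructor
  · intro h j k hjk a b ha hb
    have := h ![j, k] (by simpa [Function.Injective, Fin.forall_fin_two, hjk] using hjk.symm)
      ![a, b] (by simp [Fin.forall_fin_two, ha, hb])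
    simpa [Fin.forall_fin_two] using this
  · intro h c hc s hs
    have := h (c 0) (c 1) (hc.ne (by decide)) (s 0) (s 1) (hs 0) (hs 1)
    simpa [Fin.forall_fin_two] using this

/-- An array of strength two with at least two columns is balanced in every column. -/
theorem isOA.two_mul_card_column {R C : Type*} [Fintype R] [Nontrivial C] {X : R → C → ℝ}
    (hent : ∀ i j, X i j = 1 ∨ X i j = -1) (hX : isOA 2 X) (j : C) {a : ℝ}
    (ha : a = 1 ∨ a = -1) :
    2 * (Finset.univ.filter fun r => X r j = a).card = Fintype.card R := by
  rw [isOA_two_iff] at hX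
  obtain ⟨k, hk⟩ := exists_ne j
  have hpos := hX j k hk.symm a 1 ha (Or.inl rfl)
  have hneg := hX j k hk.symm a (-1) ha (Or.inr rfl)
  have hsplit := Finset.card_filter_add_card_filter_not
    (s := Finset.univ.filter fun r => X r j = a) (fun r => X r k = 1)
  have hnot : ∀ r, ¬ X r k = 1 ↔ X r k = -1 := fun r => by
    rcases hent r k with h | h <;> norm_num [h]
  simp only [Finset.filter_filter, hnot] at hsplit
  omega

theorem card_filter_sum_type {α β : Type*} [Fintype α] [Fintype β] {p : α ⊕ β → Prop}
    {f : α → Prop} {g : β → Prop} [DecidablePred p] [DecidablePred f] [DecidablePred g]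
    (hf : ∀ a, p (Sum.inl a) ↔ f a) (hg : ∀ b, p (Sum.inr b) ↔ g b) :
    (Finset.univ.filter p).card = (Finset.univ.filter f).card + (Finset.univ.filter g).card := by
  simp only [Finset.card_filter, Fintype.sum_sum_type, hf, hg]

-- If X is an N × n matrix with entries in {1, -1}, n ≥ 2, which is an orthogonal array of
-- strength two, then its double D(X) = [[X, X], [X, -X]] is an orthogonal array of strength two.
theorem double_isOA_two (N n : ℕ) (hn : 2 ≤ n) (X : Matrix (Fin N) (Fin n) ℝ)
    (hent : ∀ i j, X i j = 1 ∨ X i j = -1)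
    (hOA : isOA 2 X) :
    isOA 2 (Matrix.fromBlocks X X X (-X)) := by
  have : Nontrivial (Fin n) := Fin.nontrivial_iff_two_le.mpr hn
  have hcol := fun j a ha => hOA.two_mul_card_column hent j (a := a) ha
  replace hOA := (isOA_two_iff _).1 hOA
  refine (isOA_two_iff _).2 ?_
  have hneg : ∀ a : ℝ, (a = 1 ∨ a = -1) → (-a = 1 ∨ -a = -1) := by
    rintro a (rfl | rfl) <;> simp
  have hsame : ∀ j, ∀ a b : ℝ, (a = 1 ∨ a = -1) → (b = 1 ∨ b = -1) →
      4 * ((Finset.univ.filter fun r => X r j = a ∧ X r j = b).card +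
        (Finset.univ.filter fun r => X r j = a ∧ X r j = -b).card) = N + N := by
    intro j a b ha hb
    have hsplit := Finset.card_filter_add_card_filter_not
      (s := Finset.univ.filter fun r => X r j = a) (fun r => X r j = b)
    have hnot : ∀ r, ¬ X r j = b ↔ X r j = -b := fun r => by
      rcases hent r j with h | h <;> rcases hb with rfl | rfl <;> norm_num [h]
    simp only [Finset.filter_filter, hnot] at hsplit
    have := hcol j a ha
    simp only [Fintype.card_fin] at this
    omega
  simp only [Fintype.card_fin] at hOA
  intro j k hjk a b ha hb
  rw [Fintype.card_sum, Fintype.card_fin]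
  rcases j with j | j <;> rcases k with k | k
  · rw [card_filter_sum_type (f := fun r => X r j = a ∧ X r k = b)
      (g := fun r => X r j = a ∧ X r k = b) (by simp) (by simp)]
    have h := hOA j k (by simpa using hjk) a b ha hb
    omega
  · rw [card_filter_sum_type (f := fun r => X r j = a ∧ X r k = b)
      (g := fun r => X r j = a ∧ X r k = -b) (by simp) (by simp [neg_eq_iff_eq_neg])]
    rcases eq_or_ne j k with rfl | h
    · exact hsame j a b ha hb
    · have h₁ := hOA j k h a b ha hb
      have h₂ := hOA j k h a (-b) ha (hneg b hb)
      omega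
  · rw [card_filter_sum_type (f := fun r => X r k = b ∧ X r j = a)
      (g := fun r => X r k = b ∧ X r j = -a) (by simp [and_comm])
      (by simp [neg_eq_iff_eq_neg, and_comm])]
    rcases eq_or_ne k j with rfl | h
    · exact hsame k b a hb ha
    · have h₁ := hOA k j h b a hb ha
      have h₂ := hOA k j h b (-a) hb (hneg a ha)
      omega
  · rw [card_filter_sum_type (f := fun r => X r j = a ∧ X r k = b)
      (g := fun r => X r j = -a ∧ X r k = -b) (by simp) (by simp [neg_eq_iff_eq_neg])]
    have h : j ≠ k := by simpa using hjk
    have h₁ := hOA j k h a b ha hb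
    have h₂ := hOA j k h (-a) (-b) (hneg a ha) (hneg b hb)
    omega
end

section
/- If X is an N × n matrix with entries in {1, −1} and n ≥ 3 that is an orthogonal array of strength three, then its double D(X) is an orthogonal array of strength three (a 2N × 2n array). -/
/-- Rows matching a sign pattern on two columns of an array of strength three. -/
lemma isOA.four_mul_card_pair {R C : Type*} [Fintype R] [Fintype C] {X : R → C → ℝ}
    (hC : 3 ≤ Fintype.card C) (hent : ∀ i j, X i j = 1 ∨ X i j = -1) (hOA : isOA 3 X)
    {a b : C} (hab : a ≠ b) {s t : ℝ} (hs : s = 1 ∨ s = -1) (ht : t = 1 ∨ t = -1) :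
    4 * (Finset.univ.filter fun r => X r a = s ∧ X r b = t).card = Fintype.card R := by
  classical
  obtain ⟨z, hz⟩ : ∃ z, z ∉ ({a, b} : Finset C) := by
    by_contra! h
    have h₁ := Finset.card_le_card (fun x _ => h x : (Finset.univ : Finset C) ⊆ {a, b})
    have h₂ := Finset.card_le_two (a := a) (b := b)
    rw [Finset.card_univ] at h₁
    omega
  simp only [Finset.mem_insert, Finset.mem_singleton, not_or] at hz
  have hinj : Function.Injective ![a, b, z] := by
    intro i j
    fin_cases i <;> fin_cases j <;> simp [hab, hab.symm, hz.1, hz.2, Ne.symm hz.1, Ne.symm hz.2]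
  have key : ∀ u : ℝ, (u = 1 ∨ u = -1) →
      8 * (Finset.univ.filter fun r => (X r a = s ∧ X r b = t) ∧ X r z = u).card =
        Fintype.card R := by
    intro u hu
    have := hOA ![a, b, z] hinj ![s, t, u] (by simp [Fin.forall_fin_succ, hs, ht, hu])
    norm_num [Fin.forall_fin_succ] at this
    simpa only [and_assoc] using this
  have hsplit : (Finset.univ.filter fun r => X r a = s ∧ X r b = t).card =
      (Finset.univ.filter fun r => (X r a = s ∧ X r b = t) ∧ X r z = 1).card +
      (Finset.univ.filter fun r => (X r a = s ∧ X r b = t) ∧ X r z = -1).card := by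
    rw [← Finset.card_filter_add_card_filter_not (fun r => X r z = 1), Finset.filter_filter,
      Finset.filter_filter]
    congr 2
    ext r
    have : ¬ X r z = 1 ↔ X r z = -1 := by
      rcases hent r z with h | h <;> norm_num [h]
    simp [this]
  have h₁ := key 1 (Or.inl rfl)
  have h₂ := key (-1) (Or.inr rfl)
  omega

/-- The rows of the double matching a sign pattern, counted in its upper and lower halves. -/
lemma card_double_filter {R C : Type*} [Fintype R] {t : ℕ} (X : Matrix R C ℝ)
    (c : Fin t → C ⊕ C) (s : Fin t → ℝ) :
    (Finset.univ.filter fun r => ∀ i, Matrix.fromBlocks X X X (-X) r (c i) = s i).card =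
      (Finset.univ.filter fun r => ∀ i, X r ((c i).elim id id) = s i).card +
      (Finset.univ.filter fun r => ∀ i, X r ((c i).elim id id) =
        (c i).elim (fun _ => s i) (fun _ => -s i)).card := by
  simp only [Finset.card_filter, Fintype.sum_sum_type]
  congr 1
  · refine Finset.sum_congr rfl fun r _ => if_congr (forall_congr' fun i => ?_) rfl rfl
    cases c i <;> simp
  · refine Finset.sum_congr rfl fun r _ => if_congr (forall_congr' fun i => ?_) rfl rfl
    cases c i <;> simp [neg_eq_iff_eq_neg]

-- If X is an N × n matrix with entries in {1, -1}, n ≥ 3, which is an orthogonal array of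
-- strength three, then its double D(X) = [[X, X], [X, -X]] is an orthogonal array of strength three.
theorem double_isOA_three (N n : ℕ) (hn : 3 ≤ n) (X : Matrix (Fin N) (Fin n) ℝ)
    (hent : ∀ i j, X i j = 1 ∨ X i j = -1)
    (hOA : isOA 3 X) :
    isOA 3 (Matrix.fromBlocks X X X (-X)) := by
  intro c hc s hs
  refine (congrArg (2 ^ 3 * ·) (card_double_filter X c s)).trans ?_
  rw [Fintype.card_sum]
  by_cases hd : Function.Injective fun i => (c i).elim id id
  · have h₁ := hOA _ hd s hs
    have h₂ := hOA _ hd (fun i => (c i).elim (fun _ => s i) (fun _ => -s i)) fun i => by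
      rcases c i with _ | _ <;> rcases hs i with h | h <;> simp [h]
    rw [mul_add]
    exact congrArg₂ (· + ·) h₁ h₂
  -- Otherwise two of the columns are the two copies `inl a`, `inr a` of one column of `X`.
  obtain ⟨i, j, a, hi, hj⟩ : ∃ i j a, c i = Sum.inl a ∧ c j = Sum.inr a := by
    simp only [Function.Injective, not_forall] at hd
    obtain ⟨i, j, hij, hne⟩ := hd
    have hcne := hc.ne hne
    rcases hi : c i with a | a <;> rcases hj : c j with b | b <;> simp_all
    exacts [⟨i, j, b, hi, hj⟩, ⟨j, i, b, hj, hi⟩]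
  have hne : i ≠ j := by rintro rfl; simp [hi] at hj
  obtain ⟨k, hki, hkj, hall⟩ :
      ∃ k, k ≠ i ∧ k ≠ j ∧ ∀ P : Fin 3 → Prop, (∀ m, P m) ↔ P i ∧ P j ∧ P k := by
    have : ∀ i j : Fin 3, i ≠ j → ∃ k, k ≠ i ∧ k ≠ j ∧ ∀ m, m = i ∨ m = j ∨ m = k := by decide
    obtain ⟨k, hki, hkj, h⟩ := this i j hne
    refine ⟨k, hki, hkj, fun P => ⟨fun hP => ⟨hP i, hP j, hP k⟩, ?_⟩⟩
    rintro ⟨h₁, h₂, h₃⟩ m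
    rcases h m with rfl | rfl | rfl <;> assumption
  have hak : a ≠ (c k).elim id id := by
    have h₁ := hc.ne hki
    have h₂ := hc.ne hkj
    rw [hi] at h₁
    rw [hj] at h₂
    rcases hk : c k with b | b <;> rintro rfl
    exacts [h₁ hk, h₂ hk]
  have hsk : (c k).elim (fun _ => s k) (fun _ => -s k) = 1 ∨
      (c k).elim (fun _ => s k) (fun _ => -s k) = -1 := by
    rcases c k with _ | _ <;> rcases hs k with h | h <;> simp [h]
  have htop := hOA.four_mul_card_pair (by simpa using hn) hent hak (hs i) (hs k)
  have hbot := hOA.four_mul_card_pair (by simpa using hn) hent hak (hs i) hsk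
  simp only [hall, hi, hj, Sum.elim_inl, Sum.elim_inr, id]
  by_cases hij : s j = s i
  · have hneg : ∀ x : ℝ, ¬ (x = s i ∧ x = -s i) := by
      rintro x ⟨h₁, h₂⟩
      rcases hs i with h | h <;> rw [h] at h₁ h₂ <;> linarith
    simp only [hij, ← and_assoc, and_self, hneg, false_and, Finset.filter_false,
      Finset.card_empty]
    omega
  · have hsj : s j = -s i := by
      rcases hs i with h | h <;> rcases hs j with h' | h' <;> simp_all
    have hneg : ∀ x : ℝ, ¬ (x = s i ∧ x = -s i) := by
      rintro x ⟨h₁, h₂⟩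
      exact hij (by rw [hsj, ← h₂, h₁])
    simp only [hsj, neg_neg, ← and_assoc, and_self, hneg, false_and, Finset.filter_false,
      Finset.card_empty]
    omega
end

section
/- Let X be an N × n matrix with entries in {1, −1}, with N ≥ 1 and n ≥ 2. Then the double D(X) is never an orthogonal array of strength four. (Indeed, for any two columns a, b of X, the four columns (a,a), (b,b), (a,−a), (b,−b) of D(X) have componentwise product identically equal to 1, so a sign pattern of product −1 on these four columns never occurs among the rows of D(X).) -/
/-- The columns `(a, a)`, `(b, b)`, `(a, -a)`, `(b, -b)` of the double of a `±1` matrix have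
componentwise product `1`. -/
theorem double_column_prod {R C : Type*} (X : Matrix R C ℝ)
    (hent : ∀ i j, X i j = 1 ∨ X i j = -1) (a b : C) (r : R ⊕ R) :
    let D := Matrix.fromBlocks X X X (-X)
    D r (Sum.inl a) * D r (Sum.inl b) * D r (Sum.inr a) * D r (Sum.inr b) = 1 := by
  rcases r with i | i <;> rcases hent i a with ha | ha <;> rcases hent i b with hb | hb <;>
    simp [ha, hb]

-- If X is an N × n matrix with entries in {1, -1}, N ≥ 1 and n ≥ 2, then the double
-- D(X) = [[X, X], [X, -X]] is never an orthogonal array of strength four.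
theorem double_not_isOA_four (N n : ℕ) (hN : 1 ≤ N) (hn : 2 ≤ n)
    (X : Matrix (Fin N) (Fin n) ℝ)
    (hent : ∀ i j, X i j = 1 ∨ X i j = -1) :
    ¬ isOA 4 (Matrix.fromBlocks X X X (-X)) := by
  intro h
  let a : Fin n := ⟨0, by omega⟩
  let b : Fin n := ⟨1, by omega⟩
  have hab : a ≠ b := by simp [a, b]
  have hcount := h ![Sum.inl a, Sum.inl b, Sum.inr a, Sum.inr b]
    (by intro i j; fin_cases i <;> fin_cases j <;> simp [hab, hab.symm])
    ![1, 1, 1, -1] (by intro i; fin_cases i <;> simp)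
  rw [Finset.filter_false_of_mem] at hcount
  · simp at hcount
    omega
  · intro r _ hr
    have hprod := double_column_prod X hent a b r
    have h0 := hr 0
    have h1 := hr 1
    have h2 := hr 2
    have h3 := hr 3
    simp only [Matrix.cons_val] at h0 h1 h2 h3
    norm_num [h0, h1, h2, h3] at hprod
end

section
/- Let S be a Finset of nonzero vectors of F₂^d. Then the alias-set counts of its double D(S) ⊆ F₂^(d+1) are determined by those of S as follows: (i) for every nonzero v ∈ F₂^d, m_{D(S)}((v,0)) = 2 · m_S(v) and m_{D(S)}((v,1)) = 2 · m_S(v); (ii) m_{D(S)}((0,1)) = |S|; (iii) m_{D(S)}((0,0)) = 0. -/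
-- A design with N = 2^d runs and n factors is a Finset of nonzero vectors of F₂^d.
-- The double D(S) ⊆ F₂^(d+1) consists of the vectors (v,0) and (v,1) for v ∈ S,
-- where (v,ε) appends the coordinate ε to v.
def double {d : ℕ} (S : Finset (Fin d → ZMod 2)) : Finset (Fin (d + 1) → ZMod 2) :=
  S.image (fun v => Fin.snoc v 0) ∪ S.image (fun v => Fin.snoc v 1)

-- The t-fold iterated double.
def iterDouble {d : ℕ} (S : Finset (Fin d → ZMod 2)) : (t : ℕ) → Finset (Fin (d + t) → ZMod 2)
  | 0 => S
  | t + 1 => double (iterDouble S t)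

-- m_S(v): the number of unordered pairs {a, b} of distinct elements of S with a + b = v
-- (the number of two-factor interactions in the alias set corresponding to v).
def mcount {d : ℕ} (S : Finset (Fin d → ZMod 2)) (v : Fin d → ZMod 2) : ℕ :=
  ((S.powersetCard 2).filter (fun T => T.sum id = v)).card

-- B_j(S): the number of j-element subsets of S summing to zero
-- (the number of defining words of length j).
def wordCount {d : ℕ} (S : Finset (Fin d → ZMod 2)) (j : ℕ) : ℕ :=
  ((S.powersetCard j).filter (fun T => T.sum id = 0)).card

-- S is a cap: a set of nonzero vectors no three distinct elements of which sum to zero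
-- (i.e. the corresponding design has resolution at least IV).
def IsCap {d : ℕ} (S : Finset (Fin d → ZMod 2)) : Prop :=
  (∀ v ∈ S, v ≠ 0) ∧
    ∀ a ∈ S, ∀ b ∈ S, ∀ c ∈ S, a ≠ b → b ≠ c → a ≠ c → a + b + c ≠ 0

-- S is a maximal cap: no nonzero vector outside S can be added keeping it a cap.
def IsMaximalCap {d : ℕ} (S : Finset (Fin d → ZMod 2)) : Prop :=
  IsCap S ∧ ∀ w : Fin d → ZMod 2, w ≠ 0 → w ∉ S → ¬ IsCap (insert w S)

-- The 2^{5-1} design with defining relation I = ABCDE, as a subset of F₂⁴.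

theorem mem_double {d : ℕ} {S : Finset (Fin d → ZMod 2)} {x : Fin (d + 1) → ZMod 2} :
    x ∈ double S ↔ (Fin.init x : Fin d → ZMod 2) ∈ S := by
  simp only [double, Finset.mem_union, Finset.mem_image]
  constructor
  · rintro (⟨v, hv, rfl⟩ | ⟨v, hv, rfl⟩) <;> simpa using hv
  · intro h
    have key : ∀ e : ZMod 2, e = 0 ∨ e = 1 := by decide
    have hx := Fin.snoc_init_self x
    rcases key (x (Fin.last d)) with h0 | h0 <;> rw [h0] at hx
    · exact Or.inl ⟨_, h, hx⟩
    · exact Or.inr ⟨_, h, hx⟩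

theorem card_double {d : ℕ} (S : Finset (Fin d → ZMod 2)) : (double S).card = 2 * S.card := by
  have hinj : ∀ e : ZMod 2, Function.Injective
      (fun v : Fin d → ZMod 2 => (Fin.snoc v e : Fin (d + 1) → ZMod 2)) := fun e v w h => by
    simpa using congrArg (fun x : Fin (d + 1) → ZMod 2 => (Fin.init x : Fin d → ZMod 2)) h
  rw [double, Finset.card_union_of_disjoint, Finset.card_image_of_injective _ (hinj 0),
    Finset.card_image_of_injective _ (hinj 1), two_mul]
  rw [Finset.disjoint_left]
  simp only [Finset.mem_image]
  rintro _ ⟨v, _, rfl⟩ ⟨w, _, h⟩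
  simpa using congrFun h (Fin.last d)

theorem filter_add_snoc_mem_double {d : ℕ} (S : Finset (Fin d → ZMod 2)) (v : Fin d → ZMod 2)
    (e : ZMod 2) :
    (double S).filter (fun x => x + Fin.snoc v e ∈ double S) =
      double (S.filter (fun a => a + v ∈ S)) := by
  ext x
  have h : (Fin.init (x + Fin.snoc v e : Fin (d + 1) → ZMod 2) : Fin d → ZMod 2) =
      Fin.init x + v := by
    ext i
    simp [Fin.init]
  simp only [Finset.mem_filter, mem_double, h]

theorem two_mul_mcount {d : ℕ} (S : Finset (Fin d → ZMod 2)) {v : Fin d → ZMod 2} (hv : v ≠ 0) :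
    2 * mcount S v = (S.filter (fun a => a + v ∈ S)).card := by
  have hadd : ∀ a b : Fin d → ZMod 2, a + (a + b) = b := fun a b => by
    ext i
    simp [← add_assoc, CharTwo.add_self_eq_zero]
  rw [Finset.card_eq_sum_card_fiberwise (f := fun a => ({a, a + v} : Finset (Fin d → ZMod 2)))
    (t := (S.powersetCard 2).filter (fun T => T.sum id = v)), mcount, mul_comm]
  · symm
    apply Finset.sum_const_nat
    intro T hT
    simp only [Finset.mem_filter, Finset.mem_powersetCard] at hT
    obtain ⟨⟨hTS, hc⟩, hsum⟩ := hT
    refine Eq.trans (congrArg Finset.card ?_) hc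
    obtain ⟨x, y, hxy, rfl⟩ := Finset.card_eq_two.1 hc
    rw [Finset.sum_pair hxy] at hsum
    simp only [id] at hsum
    subst hsum
    have hx : x ∈ S := hTS (by simp)
    have hy : y ∈ S := hTS (by simp)
    have hyx : y + (x + y) = x := by rw [add_comm x y, hadd]
    ext a
    simp only [Finset.mem_filter, Finset.mem_insert, Finset.mem_singleton]
    constructor
    · rintro ⟨_, h⟩
      have : a ∈ ({a, a + (x + y)} : Finset (Fin d → ZMod 2)) := by simp
      rw [h] at this
      simpa using this
    · rintro (rfl | rfl)
      · rw [hadd]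
        exact ⟨⟨hx, hy⟩, rfl⟩
      · rw [hyx]
        exact ⟨⟨hy, hx⟩, Finset.pair_comm _ _⟩
  · intro a ha
    simp only [Finset.coe_filter, Set.mem_ofPred_eq] at ha
    have hne : a ≠ a + v := by simpa using hv
    simp only [Finset.coe_filter, Set.mem_ofPred_eq, Finset.mem_powersetCard]
    refine ⟨⟨?_, Finset.card_pair hne⟩, ?_⟩
    · simp [Finset.insert_subset_iff, ha.1, ha.2]
    · rw [Finset.sum_pair hne]
      exact hadd a v

theorem mcount_zero {d : ℕ} (S : Finset (Fin d → ZMod 2)) : mcount S 0 = 0 := by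
  rw [mcount, Finset.card_eq_zero, Finset.filter_eq_empty_iff]
  intro T hT hsum
  obtain ⟨x, y, hxy, rfl⟩ := Finset.card_eq_two.1 (Finset.mem_powersetCard.1 hT).2
  rw [Finset.sum_pair hxy] at hsum
  exact hxy (funext fun i => CharTwo.add_eq_zero.1 (congrFun hsum i))

theorem mcount_double_snoc {d : ℕ} (S : Finset (Fin d → ZMod 2)) {v : Fin d → ZMod 2} {e : ZMod 2}
    (h : (Fin.snoc v e : Fin (d + 1) → ZMod 2) ≠ 0) :
    mcount (double S) (Fin.snoc v e) = (S.filter (fun a => a + v ∈ S)).card := by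
  have := two_mul_mcount (double S) h
  rw [filter_add_snoc_mem_double, card_double] at this
  omega

-- Alias-set counts of the double are determined by those of S.
theorem mcount_double (d : ℕ) (S : Finset (Fin d → ZMod 2)) (hS : ∀ v ∈ S, v ≠ 0) :
    (∀ v : Fin d → ZMod 2, v ≠ 0 →
        mcount (double S) (Fin.snoc v 0) = 2 * mcount S v ∧
        mcount (double S) (Fin.snoc v 1) = 2 * mcount S v) ∧
      mcount (double S) (Fin.snoc (0 : Fin d → ZMod 2) 1) = S.card ∧
      mcount (double S) (Fin.snoc (0 : Fin d → ZMod 2) 0) = 0 := by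
  have hne : ∀ v : Fin d → ZMod 2, v ≠ 0 → ∀ e : ZMod 2,
      (Fin.snoc v e : Fin (d + 1) → ZMod 2) ≠ 0 := fun v hv e h => hv <| by
    ext i
    simpa using congrFun h i.castSucc
  refine ⟨fun v hv => ?_, ?_, ?_⟩
  · rw [two_mul_mcount S hv]
    exact ⟨mcount_double_snoc S (hne v hv 0), mcount_double_snoc S (hne v hv 1)⟩
  · rw [mcount_double_snoc S fun h => by simpa using congrFun h (Fin.last d)]
    simp
  · have h0 : (Fin.snoc (0 : Fin d → ZMod 2) 0 : Fin (d + 1) → ZMod 2) = 0 := by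
      ext i
      refine Fin.lastCases ?_ (fun j => ?_) i <;> simp
    rw [h0, mcount_zero]
end

section
/- Let S be a Finset of nonzero vectors of F₂^d with |S| = n, and let B_j = B_j(S) and B*_j = B_j(D(S)) denote the wordlength patterns of S and of its double D(S). Then for every k ≥ 1: if k is odd, B*_k = Σ_{s=0}^{min((k−1)/2, n)} B_{k−2s} · C(n−k+2s, s) · 2^{k−2s−1}; if k is even and k/2 is even, B*_k = Σ_{s=0}^{min(k/2−1, n)} B_{k−2s} · C(n−k+2s, s) · 2^{k−2s−1} + C(n, k/2); if k is even and k/2 is odd, B*_k = Σ_{s=0}^{min(k/2−1, n)} B_{k−2s} · C(n−k+2s, s) · 2^{k−2s−1}. Here C(a, b) is the binomial coefficient, taken to be 0 whenever a < b (in particular each term with k − 2s > n vanishes since then B_{k−2s} = 0). -/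
-- The 2^{5-1} design with defining relation I = ABCDE, as a subset of F₂⁴.

/-- The subset of `double S` whose parts with last coordinate `0` and `1` are given by `A`, `B`. -/
def snocUnion {d : ℕ} (A B : Finset (Fin d → ZMod 2)) : Finset (Fin (d + 1) → ZMod 2) :=
  A.image (fun v => Fin.snoc v 0) ∪ B.image (fun v => Fin.snoc v 1)

lemma snoc_injective {d : ℕ} (e : ZMod 2) :
    Function.Injective (fun v : Fin d → ZMod 2 => (Fin.snoc v e : Fin (d + 1) → ZMod 2)) :=
  fun _ _ h => (Fin.snoc_injective2 (α := fun _ => ZMod 2) h).1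

lemma snoc_zero_mem_snocUnion {d : ℕ} {A B : Finset (Fin d → ZMod 2)} {v : Fin d → ZMod 2} :
    (Fin.snoc v 0 : Fin (d + 1) → ZMod 2) ∈ snocUnion A B ↔ v ∈ A := by
  simp [snocUnion, Fin.snoc_inj]

lemma snoc_one_mem_snocUnion {d : ℕ} {A B : Finset (Fin d → ZMod 2)} {v : Fin d → ZMod 2} :
    (Fin.snoc v 1 : Fin (d + 1) → ZMod 2) ∈ snocUnion A B ↔ v ∈ B := by
  simp [snocUnion, Fin.snoc_inj]

lemma disjoint_image_snoc {d : ℕ} (A B : Finset (Fin d → ZMod 2)) :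
    Disjoint (A.image (fun v => (Fin.snoc v 0 : Fin (d + 1) → ZMod 2)))
      (B.image (fun v => Fin.snoc v 1)) := by
  simp [Finset.disjoint_left, Fin.snoc_inj]

lemma card_snocUnion {d : ℕ} (A B : Finset (Fin d → ZMod 2)) :
    (snocUnion A B).card = A.card + B.card := by
  rw [snocUnion, Finset.card_union_of_disjoint (disjoint_image_snoc A B),
    Finset.card_image_of_injective _ (snoc_injective 0),
    Finset.card_image_of_injective _ (snoc_injective 1)]

lemma sum_snocUnion_eq_zero_iff {d : ℕ} (A B : Finset (Fin d → ZMod 2)) :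
    (snocUnion A B).sum id = 0 ↔ A.sum id + B.sum id = 0 ∧ Even B.card := by
  rw [snocUnion, Finset.sum_union (disjoint_image_snoc A B),
    Finset.sum_image (snoc_injective 0).injOn, Finset.sum_image (snoc_injective 1).injOn,
    ← ZMod.natCast_eq_zero_iff_even, funext_iff, Fin.forall_fin_succ', funext_iff]
  simp [Finset.sum_apply]

lemma snocUnion_subset_double {d : ℕ} {S A B : Finset (Fin d → ZMod 2)} (hA : A ⊆ S)
    (hB : B ⊆ S) : snocUnion A B ⊆ double S :=
  Finset.union_subset_union (Finset.image_subset_image hA) (Finset.image_subset_image hB)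

lemma snocUnion_filter {d : ℕ} {S : Finset (Fin d → ZMod 2)} {T : Finset (Fin (d + 1) → ZMod 2)}
    (hT : T ⊆ double S) :
    snocUnion (S.filter fun v => Fin.snoc v 0 ∈ T) (S.filter fun v => Fin.snoc v 1 ∈ T) = T := by
  ext x
  constructor
  · simp only [snocUnion, Finset.mem_union, Finset.mem_image, Finset.mem_filter]
    rintro (⟨v, ⟨-, h⟩, rfl⟩ | ⟨v, ⟨-, h⟩, rfl⟩) <;> exact h
  · intro hx
    have := hT hx
    simp only [double, Finset.mem_union, Finset.mem_image] at this
    rcases this with ⟨v, hv, rfl⟩ | ⟨v, hv, rfl⟩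
    · rw [snoc_zero_mem_snocUnion]; simp [hv, hx]
    · rw [snoc_one_mem_snocUnion]; simp [hv, hx]

lemma wordCount_double_eq_card_pairs {d : ℕ} (S : Finset (Fin d → ZMod 2)) (k : ℕ) :
    wordCount (double S) k = ((S.powerset ×ˢ S.powerset).filter fun p =>
      p.1.card + p.2.card = k ∧ p.1.sum id + p.2.sum id = 0 ∧ Even p.2.card).card := by
  refine Finset.card_nbij'
    (fun T => (S.filter fun v => Fin.snoc v 0 ∈ T, S.filter fun v => Fin.snoc v 1 ∈ T))
    (fun p => snocUnion p.1 p.2) ?_ ?_ ?_ ?_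
  · intro T hT
    simp only [Finset.coe_filter, Finset.mem_powersetCard, Set.mem_ofPred_eq] at hT
    obtain ⟨⟨hT, hc⟩, h0⟩ := hT
    rw [← snocUnion_filter hT] at hc h0
    simp only [Finset.coe_filter, Finset.mem_product, Finset.mem_powerset, Set.mem_ofPred_eq]
    exact ⟨⟨Finset.filter_subset _ _, Finset.filter_subset _ _⟩,
      by rw [← hc, card_snocUnion], (sum_snocUnion_eq_zero_iff _ _).1 h0⟩
  · rintro ⟨A, B⟩ h
    simp only [Finset.coe_filter, Finset.mem_product, Finset.mem_powerset,
      Set.mem_ofPred_eq] at h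
    obtain ⟨⟨hA, hB⟩, hc, h0⟩ := h
    simp only [Finset.coe_filter, Finset.mem_powersetCard, Set.mem_ofPred_eq]
    exact ⟨⟨snocUnion_subset_double hA hB, by rw [card_snocUnion, hc]⟩,
      (sum_snocUnion_eq_zero_iff _ _).2 h0⟩
  · intro T hT
    simp only [Finset.coe_filter, Finset.mem_powersetCard, Set.mem_ofPred_eq] at hT
    exact snocUnion_filter hT.1.1
  · rintro ⟨A, B⟩ h
    simp only [Finset.coe_filter, Finset.mem_product, Finset.mem_powerset,
      Set.mem_ofPred_eq] at h
    simp only [snoc_zero_mem_snocUnion, snoc_one_mem_snocUnion, Finset.filter_mem_eq_inter,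
      Finset.inter_eq_right.2 h.1.1, Finset.inter_eq_right.2 h.1.2]

lemma sum_add_sum_union_eq {d : ℕ} {U C W : Finset (Fin d → ZMod 2)} (hC : Disjoint U C)
    (hW : W ⊆ U) : (C ∪ U \ W).sum id + (C ∪ W).sum id = U.sum id := by
  have h1 : Disjoint C (U \ W) := (hC.mono_left Finset.sdiff_subset).symm
  have h2 : Disjoint C W := (hC.mono_left hW).symm
  rw [Finset.sum_union h1, Finset.sum_union h2, ← Finset.sum_sdiff hW]
  have : C.sum id + C.sum id = 0 := funext fun _ => CharTwo.add_self_eq_zero _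
  calc _ = (C.sum id + C.sum id) + ((U \ W).sum id + W.sum id) := by abel
    _ = _ := by rw [this, zero_add]

lemma card_pairs_eq_sum {d : ℕ} (S : Finset (Fin d → ZMod 2)) (k : ℕ) :
    ((S.powerset ×ˢ S.powerset).filter fun p =>
      p.1.card + p.2.card = k ∧ p.1.sum id + p.2.sum id = 0 ∧ Even p.2.card).card =
    ∑ s ∈ Finset.range (k / 2 + 1),
      ∑ U ∈ (S.powersetCard (k - 2 * s)).filter (fun T => T.sum id = 0),
        (S.card - (k - 2 * s)).choose s * (U.powerset.filter fun W => Even (s + W.card)).card := by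
  have key : ((S.powerset ×ˢ S.powerset).filter fun p =>
      p.1.card + p.2.card = k ∧ p.1.sum id + p.2.sum id = 0 ∧ Even p.2.card).card =
      ((Finset.range (k / 2 + 1)).sigma fun s =>
        ((S.powersetCard (k - 2 * s)).filter (fun T => T.sum id = 0)).sigma fun U =>
          (S \ U).powersetCard s ×ˢ U.powerset.filter fun W => Even (s + W.card)).card := by
    symm
    refine Finset.card_nbij' (fun x => (x.2.2.1 ∪ x.2.1 \ x.2.2.2, x.2.2.1 ∪ x.2.2.2))
      (fun p => ⟨(p.1 ∩ p.2).card, (p.1 \ p.2) ∪ (p.2 \ p.1), p.1 ∩ p.2, p.2 \ p.1⟩) ?_ ?_ ?_ ?_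
    · rintro ⟨s, U, C, W⟩ h
      simp only [Finset.coe_sigma, Set.mem_sigma_iff, Finset.mem_coe, Finset.mem_range,
        Finset.mem_filter, Finset.mem_powersetCard, Finset.mem_product, Finset.mem_powerset,
        Finset.subset_sdiff] at h ⊢
      obtain ⟨hs, ⟨⟨hU, hUc⟩, hU0⟩, ⟨⟨hC, hCU⟩, hCc⟩, hW, he⟩ := h
      have h1 : Disjoint C (U \ W) := hCU.mono_right Finset.sdiff_subset
      have h2 : Disjoint C W := hCU.mono_right hW
      have h3 := Finset.card_sdiff_add_card_eq_card hW
      refine ⟨⟨Finset.union_subset hC (Finset.sdiff_subset.trans hU),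
        Finset.union_subset hC (hW.trans hU)⟩, ?_, ?_, ?_⟩
      · rw [Finset.card_union_of_disjoint h1, Finset.card_union_of_disjoint h2]
        omega
      · rw [sum_add_sum_union_eq hCU.symm hW, hU0]
      · rwa [Finset.card_union_of_disjoint h2, hCc]
    · rintro ⟨A, B⟩ h
      simp only [Finset.coe_sigma, Set.mem_sigma_iff, Finset.mem_coe, Finset.mem_range,
        Finset.mem_filter, Finset.mem_powersetCard, Finset.mem_product, Finset.mem_powerset,
        Finset.subset_sdiff] at h ⊢
      obtain ⟨⟨hA, hB⟩, hc, h0, he⟩ := h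
      have hd : Disjoint (A \ B ∪ B \ A) (A ∩ B) := by
        rw [Finset.disjoint_left]; grind
      have h1 := Finset.card_sdiff_add_card_inter A B
      have h2 := Finset.card_sdiff_add_card_inter B A
      rw [Finset.inter_comm] at h2
      have h3 : (A \ B ∪ B \ A).card = (A \ B).card + (B \ A).card :=
        Finset.card_union_of_disjoint disjoint_sdiff_sdiff
      have h4 := sum_add_sum_union_eq hd (Finset.subset_union_right (s₁ := A \ B) (s₂ := B \ A))
      have e1 : A ∩ B ∪ (A \ B ∪ B \ A) \ (B \ A) = A := by ext x; grind
      have e2 : A ∩ B ∪ B \ A = B := by ext x; grind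
      rw [e1, e2, h0] at h4
      refine ⟨by omega, ⟨⟨by grind, by omega⟩, h4.symm⟩, ⟨⟨by grind, hd.symm⟩, trivial⟩, by grind, ?_⟩
      rwa [add_comm, h2]
    · rintro ⟨s, U, C, W⟩ h
      simp only [Finset.coe_sigma, Set.mem_sigma_iff, Finset.mem_coe, Finset.mem_range,
        Finset.mem_filter, Finset.mem_powersetCard, Finset.mem_product, Finset.mem_powerset,
        Finset.subset_sdiff] at h
      obtain ⟨hs, ⟨⟨hU, hUc⟩, hU0⟩, ⟨⟨hC, hCU⟩, hCc⟩, hW, he⟩ := h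
      rw [Finset.disjoint_left] at hCU
      have e1 : (C ∪ U \ W) ∩ (C ∪ W) = C := by ext x; grind
      have e2 : (C ∪ W) \ (C ∪ U \ W) = W := by ext x; grind
      have e3 : (C ∪ U \ W) \ (C ∪ W) ∪ W = U := by ext x; grind
      simp only [e1, e2, e3, hCc]
    · rintro ⟨A, B⟩ h
      simp only [Prod.mk.injEq]
      constructor <;> ext x <;> grind
  rw [key, Finset.card_sigma]
  refine Finset.sum_congr rfl fun s _ => ?_
  rw [Finset.card_sigma]
  refine Finset.sum_congr rfl fun U hU => ?_
  rw [Finset.mem_filter, Finset.mem_powersetCard] at hU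
  rw [Finset.card_product, Finset.card_powersetCard, Finset.card_sdiff_of_subset hU.1.1, hU.1.2]

lemma card_powerset_filter_even_add {α : Type*} [DecidableEq α] (U : Finset α) (hU : U.Nonempty)
    (s : ℕ) : (U.powerset.filter fun W => Even (s + W.card)).card = 2 ^ (U.card - 1) := by
  obtain ⟨a, ha⟩ := hU
  rw [← Finset.card_erase_of_mem ha, ← Finset.card_powerset]
  refine Finset.card_nbij' (fun W => W.erase a)
    (fun W => if Even (s + W.card) then W else insert a W) ?_ ?_ ?_ ?_
  · intro W hW
    simp only [Finset.coe_filter, Finset.mem_powerset, Set.mem_ofPred_eq] at hW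
    exact Finset.mem_coe.2 (Finset.mem_powerset.2 (Finset.erase_subset_erase a hW.1))
  · intro W hW
    simp only [Finset.coe_powerset, Set.mem_preimage, Set.mem_powerset_iff,
      Finset.coe_subset, Finset.subset_erase] at hW
    simp only [Finset.coe_filter, Finset.mem_powerset, Set.mem_ofPred_eq]
    split_ifs with h
    · exact ⟨hW.1, h⟩
    · rw [Finset.card_insert_of_notMem hW.2]
      exact ⟨Finset.insert_subset ha hW.1, by grind⟩
  · intro W hW
    simp only [Finset.coe_filter, Finset.mem_powerset, Set.mem_ofPred_eq] at hW
    by_cases haW : a ∈ W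
    · have := Finset.card_erase_add_one haW
      have h : ¬ Even (s + (W.erase a).card) := by
        have := hW.2; grind
      simp [h, Finset.insert_erase haW]
    · simp [Finset.erase_eq_of_notMem haW, hW.2]
  · intro W hW
    simp only [Finset.coe_powerset, Set.mem_preimage, Set.mem_powerset_iff,
      Finset.coe_subset, Finset.subset_erase] at hW
    dsimp only
    split_ifs with h
    · exact Finset.erase_eq_of_notMem hW.2
    · exact Finset.erase_insert hW.2

lemma sum_words_of_pos {d : ℕ} (S : Finset (Fin d → ZMod 2)) {k s : ℕ} (h : 2 * s < k) :
    ∑ U ∈ (S.powersetCard (k - 2 * s)).filter (fun T => T.sum id = 0),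
        (S.card - (k - 2 * s)).choose s * (U.powerset.filter fun W => Even (s + W.card)).card =
      wordCount S (k - 2 * s) * (S.card + 2 * s - k).choose s * 2 ^ (k - 2 * s - 1) := by
  rw [wordCount, mul_assoc, ← Finset.sum_const_nat fun _ _ => rfl]
  refine Finset.sum_congr rfl fun U hU => ?_
  rw [Finset.mem_filter, Finset.mem_powersetCard] at hU
  rw [card_powerset_filter_even_add U (Finset.card_pos.1 (by omega)), hU.1.2]
  congr 2
  omega

lemma sum_words_of_eq {d : ℕ} (S : Finset (Fin d → ZMod 2)) {k s : ℕ} (h : k = 2 * s) :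
    ∑ U ∈ (S.powersetCard (k - 2 * s)).filter (fun T => T.sum id = 0),
        (S.card - (k - 2 * s)).choose s * (U.powerset.filter fun W => Even (s + W.card)).card =
      if Even s then S.card.choose s else 0 := by
  subst h
  split_ifs with hs <;> simp [Finset.filter_singleton, hs]

lemma sum_range_min_add_one {d : ℕ} (S : Finset (Fin d → ZMod 2)) {k M : ℕ} (h : 2 * M < k) :
    ∑ s ∈ Finset.range (min M S.card + 1),
        wordCount S (k - 2 * s) * (S.card + 2 * s - k).choose s * 2 ^ (k - 2 * s - 1) =
      ∑ s ∈ Finset.range (M + 1),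
        wordCount S (k - 2 * s) * (S.card + 2 * s - k).choose s * 2 ^ (k - 2 * s - 1) := by
  refine Finset.sum_subset (by intro x; simp; omega) fun s hs hs' => ?_
  rw [Finset.mem_range] at hs hs'
  rw [Nat.choose_eq_zero_of_lt (by omega)]
  simp

lemma wordCount_double_of_even {d : ℕ} (S : Finset (Fin d → ZMod 2)) {k : ℕ} (hk : 1 ≤ k)
    (he : Even k) :
    wordCount (double S) k =
      (∑ s ∈ Finset.range (min (k / 2 - 1) S.card + 1),
        wordCount S (k - 2 * s) * (S.card + 2 * s - k).choose s * 2 ^ (k - 2 * s - 1)) +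
        if Even (k / 2) then S.card.choose (k / 2) else 0 := by
  have hk2 : k = 2 * (k / 2) := by obtain ⟨m, rfl⟩ := he; omega
  rw [sum_range_min_add_one S (by omega), wordCount_double_eq_card_pairs, card_pairs_eq_sum,
    Finset.sum_range_succ, sum_words_of_eq S hk2, show k / 2 - 1 + 1 = k / 2 by omega]
  congr 1
  refine Finset.sum_congr rfl fun s hs => sum_words_of_pos S ?_
  rw [Finset.mem_range] at hs
  omega

lemma wordCount_double_of_odd {d : ℕ} (S : Finset (Fin d → ZMod 2)) {k : ℕ} (ho : Odd k) :
    wordCount (double S) k =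
      ∑ s ∈ Finset.range (min ((k - 1) / 2) S.card + 1),
        wordCount S (k - 2 * s) * (S.card + 2 * s - k).choose s * 2 ^ (k - 2 * s - 1) := by
  obtain ⟨m, rfl⟩ := ho
  rw [sum_range_min_add_one S (by omega), wordCount_double_eq_card_pairs, card_pairs_eq_sum,
    show (2 * m + 1) / 2 = m by omega, show (2 * m + 1 - 1) / 2 = m by omega]
  refine Finset.sum_congr rfl fun s hs => sum_words_of_pos S ?_
  rw [Finset.mem_range] at hs
  omega

-- Wordlength pattern of the double in terms of that of S (Theorem 2.3).
-- Binomial coefficients C(a, b) are 0 when a < b; terms with k - 2s > n vanish since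
-- then B_{k-2s} = 0 (and the truncated subtraction n + 2s - k is harmless there).
theorem wordCount_double (d n : ℕ) (S : Finset (Fin d → ZMod 2)) (hS : ∀ v ∈ S, v ≠ 0)
    (hcard : S.card = n) (k : ℕ) (hk : 1 ≤ k) :
    (Odd k →
      wordCount (double S) k =
        ∑ s ∈ Finset.range (min ((k - 1) / 2) n + 1),
          wordCount S (k - 2 * s) * Nat.choose (n + 2 * s - k) s * 2 ^ (k - 2 * s - 1)) ∧
    (Even k → Even (k / 2) →
      wordCount (double S) k =
        (∑ s ∈ Finset.range (min (k / 2 - 1) n + 1),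
          wordCount S (k - 2 * s) * Nat.choose (n + 2 * s - k) s * 2 ^ (k - 2 * s - 1)) +
          Nat.choose n (k / 2)) ∧
    (Even k → Odd (k / 2) →
      wordCount (double S) k =
        ∑ s ∈ Finset.range (min (k / 2 - 1) n + 1),
          wordCount S (k - 2 * s) * Nat.choose (n + 2 * s - k) s * 2 ^ (k - 2 * s - 1)) := by
  subst hcard
  refine ⟨wordCount_double_of_odd S, fun he h => ?_, fun he h => ?_⟩
  · rw [wordCount_double_of_even S hk he, if_pos h]
  · rw [wordCount_double_of_even S hk he, if_neg (Nat.not_even_iff_odd.2 h), add_zero]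
end

section
/- Let S₁ be a Finset of nonzero vectors of F₂^{d₁} and S₂ a Finset of nonzero vectors of F₂^{d₂} with |S₁| = |S₂| = n. Then S₁ has less aberration than S₂ if and only if D(S₁) has less aberration than D(S₂); that is, the sequence (B_1(S₁), B_2(S₁), …, B_n(S₁)) is lexicographically strictly smaller than (B_1(S₂), B_2(S₂), …, B_n(S₂)) if and only if (B_1(D(S₁)), …, B_{2n}(D(S₁))) is lexicographically strictly smaller than (B_1(D(S₂)), …, B_{2n}(D(S₂))). -/
-- The 2^{5-1} design with defining relation I = ABCDE, as a subset of F₂⁴.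

-- S₁ has less aberration than S₂ (both with n factors): the wordlength pattern
-- (B_1, ..., B_n) of S₁ is lexicographically strictly smaller than that of S₂.
def LessAberration {d₁ d₂ : ℕ} (n : ℕ) (S₁ : Finset (Fin d₁ → ZMod 2))
    (S₂ : Finset (Fin d₂ → ZMod 2)) : Prop :=
  ∃ k, 1 ≤ k ∧ k ≤ n ∧ (∀ j, 1 ≤ j → j < k → wordCount S₁ j = wordCount S₂ j) ∧
    wordCount S₁ k < wordCount S₂ k

open Finset in
theorem sum_powerset_union_of_disjoint {α M : Type*} [DecidableEq α] [AddCommMonoid M]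
    {s t : Finset α} (h : Disjoint s t) (f : Finset α → M) :
    ∑ T ∈ (s ∪ t).powerset, f T = ∑ A ∈ s.powerset, ∑ B ∈ t.powerset, f (A ∪ B) := by
  rw [← sum_product']
  refine sum_nbij' (fun T => (T ∩ s, T ∩ t)) (fun p => p.1 ∪ p.2) ?_ ?_ ?_ ?_ ?_
  · intro T _
    simp [inter_subset_right]
  · rintro ⟨A, B⟩ hp
    simp only [mem_product, mem_powerset] at hp ⊢
    exact union_subset_union hp.1 hp.2
  · intro T hT
    simp only [mem_powerset] at hT
    rw [← inter_union_distrib_left, inter_eq_left.2 hT]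
  · rintro ⟨A, B⟩ hp
    simp only [mem_product, mem_powerset] at hp
    have h₁ : B ∩ s = ∅ := disjoint_iff_inter_eq_empty.1 (h.symm.mono_left hp.2)
    have h₂ : A ∩ t = ∅ := disjoint_iff_inter_eq_empty.1 (h.mono_left hp.1)
    simp [union_inter_distrib_right, h₁, h₂, inter_eq_left.2 hp.1, inter_eq_left.2 hp.2]
  · intro T hT
    simp only [mem_powerset] at hT
    simp only [← inter_union_distrib_left, inter_eq_left.2 hT]

open Finset in
theorem sum_powerset_image_of_injective {α β M : Type*} [DecidableEq β] [AddCommMonoid M]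
    {g : α → β} (hg : Function.Injective g) (s : Finset α) (f : Finset β → M) :
    ∑ T ∈ (s.image g).powerset, f T = ∑ A ∈ s.powerset, f (A.image g) := by
  rw [powerset_image, sum_image ((image_injective hg).injOn)]

open Finset in
theorem sum_powerset_symmDiff {α M : Type*} [DecidableEq α] [AddCommMonoid M]
    {s B : Finset α} (hB : B ⊆ s) (f : Finset α → M) :
    ∑ A ∈ s.powerset, f A = ∑ U ∈ s.powerset, f (symmDiff U B) := by
  have h : ∀ A ∈ s.powerset, symmDiff A B ∈ s.powerset := fun A hA =>
    mem_powerset.2 (symmDiff_le_sup.trans (union_subset (mem_powerset.1 hA) hB))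
  exact sum_nbij' (fun A => symmDiff A B) (fun A => symmDiff A B) h h
    (by simp) (by simp) (by simp)

open Finset in
theorem sum_symmDiff_add_sum {α M : Type*} [DecidableEq α] [AddCommGroup M] (f : α → M)
    (hf : ∀ x, f x + f x = 0) (U B : Finset α) :
    ∑ x ∈ symmDiff U B, f x + ∑ x ∈ B, f x = ∑ x ∈ U, f x := by
  have hU := sum_inter_add_sum_sdiff U B f
  have hB := sum_inter_add_sum_sdiff B U f
  have h2 : ∑ x ∈ B \ U, f x + ∑ x ∈ B \ U, f x = 0 := by
    rw [← sum_add_distrib]; simp [hf]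
  have hd : Disjoint (U \ B) (B \ U) := disjoint_sdiff_sdiff
  rw [symmDiff_def, sup_eq_union, sum_union hd, ← hU, ← hB, inter_comm B U]
  calc _ = ∑ x ∈ U ∩ B, f x + ∑ x ∈ U \ B, f x + (∑ x ∈ B \ U, f x + ∑ x ∈ B \ U, f x) := by abel
    _ = _ := by rw [h2, add_zero]

theorem zmod_two_add_self {d : ℕ} (v : Fin d → ZMod 2) : v + v = 0 := by
  funext i
  exact CharTwo.add_self_eq_zero (v i)

theorem wordCount_eq_sum {d : ℕ} (S : Finset (Fin d → ZMod 2)) (j : ℕ) :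
    wordCount S j = ∑ T ∈ S.powerset, if T.card = j ∧ T.sum id = 0 then 1 else 0 := by
  rw [wordCount, ← Finset.card_filter, Finset.powersetCard_eq_filter, Finset.filter_filter]

theorem sum_image_snoc {d : ℕ} (A : Finset (Fin d → ZMod 2)) (e : ZMod 2) :
    (A.image (fun v => (Fin.snoc v e : Fin (d + 1) → ZMod 2))).sum id =
      Fin.snoc (A.sum id) (A.card * e) := by
  rw [Finset.sum_image (fun a _ b _ h => (Fin.snoc_inj.1 h).1)]
  funext i
  refine Fin.lastCases ?_ (fun i => ?_) i <;> simp [Finset.sum_apply]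

/-- For a design on `n` factors, the number of defining words of length `j` of its double lying
over a given defining word of length `i`. -/
def doubleWeight (n i j : ℕ) : ℕ :=
  ∑ x ∈ Finset.range (i + 1), i.choose x * ∑ y ∈ Finset.range (n - i + 1),
    (n - i).choose y * if i + 2 * y = j ∧ Even (x + y) then 1 else 0

theorem doubleWeight_self_pos (n j : ℕ) : 0 < doubleWeight n j j := by
  refine Finset.sum_pos' (fun _ _ => Nat.zero_le _) ⟨0, by simp, ?_⟩
  refine Nat.mul_pos (by simp) (Finset.sum_pos' (fun _ _ => Nat.zero_le _) ⟨0, by simp, by simp⟩)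

theorem doubleWeight_eq_zero {n i j : ℕ} (h : j < i) : doubleWeight n i j = 0 := by
  refine Finset.sum_eq_zero fun x _ => ?_
  rw [Finset.sum_eq_zero, mul_zero]
  intro y _
  rw [if_neg (by omega), mul_zero]

open Finset in
theorem sum_powerset_eq_doubleWeight {α : Type*} [DecidableEq α] {S U : Finset α} (hU : U ⊆ S)
    (j : ℕ) :
    (∑ B ∈ S.powerset, if (symmDiff U B).card + B.card = j ∧ Even B.card then 1 else 0) =
      doubleWeight S.card U.card j := by
  have hd : Disjoint U (S \ U) := disjoint_sdiff
  rw [doubleWeight, ← card_sdiff_of_subset hU]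
  conv_lhs => rw [← union_sdiff_of_subset hU]
  rw [sum_powerset_union_of_disjoint hd]
  simp only [← smul_eq_mul (Nat.choose _ _)]
  rw [← sum_powerset_apply_card]
  refine sum_congr rfl fun X hX => ?_
  rw [← sum_powerset_apply_card
    (fun y => if U.card + 2 * y = j ∧ Even (X.card + y) then 1 else 0)]
  refine sum_congr rfl fun Y hY => ?_
  rw [mem_powerset] at hX hY
  have hXY : Disjoint X Y := hd.mono hX hY
  have hUY : Disjoint U Y := hd.mono_right hY
  have hs : symmDiff U (X ∪ Y) = (U \ X) ∪ Y := by
    ext v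
    have := @hX v
    have : v ∈ U → v ∉ Y := fun h => disjoint_left.1 hUY h
    simp only [mem_symmDiff, mem_union, mem_sdiff]
    tauto
  have hc : (symmDiff U (X ∪ Y)).card + (X ∪ Y).card = U.card + 2 * Y.card := by
    rw [hs, card_union_of_disjoint (hUY.mono_left sdiff_subset), card_union_of_disjoint hXY,
      ← card_sdiff_add_card_eq_card hX]
    ring
  rw [hc, card_union_of_disjoint hXY]

open Finset in
theorem wordCount_double_s6 {d : ℕ} (S : Finset (Fin d → ZMod 2)) (j : ℕ) :
    wordCount (double S) j =
      ∑ i ∈ range (j + 1), wordCount S i * doubleWeight S.card i j := by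
  have hinj : ∀ e : ZMod 2, Function.Injective
      (fun v : Fin d → ZMod 2 => (Fin.snoc v e : Fin (d + 1) → ZMod 2)) :=
    fun e a b h => (Fin.snoc_inj.1 h).1
  have hdisj : ∀ A B : Finset (Fin d → ZMod 2),
      Disjoint (A.image (fun v => (Fin.snoc v 0 : Fin (d + 1) → ZMod 2)))
        (B.image (fun v => Fin.snoc v 1)) := by
    intro A B
    simp only [disjoint_left, mem_image]
    rintro _ ⟨a, _, rfl⟩ ⟨b, _, h⟩
    exact one_ne_zero (Fin.snoc_inj.1 h).2
  have key : ∀ A B : Finset (Fin d → ZMod 2),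
      ((A.image (fun v => (Fin.snoc v 0 : Fin (d + 1) → ZMod 2)) ∪
        B.image (fun v => Fin.snoc v 1)).card = j ∧
      (A.image (fun v => (Fin.snoc v 0 : Fin (d + 1) → ZMod 2)) ∪
        B.image (fun v => Fin.snoc v 1)).sum id = 0) ↔
      (A.card + B.card = j ∧ Even B.card) ∧ A.sum id + B.sum id = 0 := by
    intro A B
    rw [card_union_of_disjoint (hdisj A B), card_image_of_injective _ (hinj 0),
      card_image_of_injective _ (hinj 1), sum_union (hdisj A B), sum_image_snoc, sum_image_snoc,
      ← ZMod.natCast_eq_zero_iff_even, and_assoc]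
    refine and_congr_right fun _ => ?_
    constructor
    · intro h
      constructor
      · simpa using congrFun h (Fin.last d)
      · funext i
        simpa using congrFun h i.castSucc
    · rintro ⟨h₁, h₂⟩
      funext i
      refine Fin.lastCases ?_ (fun i => ?_) i
      · simpa using h₁
      · simpa using congrFun h₂ i
  rw [wordCount_eq_sum, double, sum_powerset_union_of_disjoint (hdisj S S),
    sum_powerset_image_of_injective (hinj 0)]
  simp_rw [sum_powerset_image_of_injective (hinj 1), key]
  rw [sum_comm]
  calc _ = ∑ B ∈ S.powerset, ∑ U ∈ S.powerset,
        (if U.sum id = 0 then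
          if (symmDiff U B).card + B.card = j ∧ Even B.card then 1 else 0 else 0) := by
        refine sum_congr rfl fun B hB => ?_
        rw [sum_powerset_symmDiff (mem_powerset.1 hB)]
        simp_rw [sum_symmDiff_add_sum id zmod_two_add_self, ← ite_and, and_comm]
    _ = ∑ U ∈ S.powerset, if U.sum id = 0 then doubleWeight S.card U.card j else 0 := by
        rw [sum_comm]
        refine sum_congr rfl fun U hU => ?_
        rw [← sum_powerset_eq_doubleWeight (mem_powerset.1 hU)]
        split_ifs <;> simp
    _ = ∑ U ∈ S.powerset, ∑ i ∈ range (j + 1),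
        (if U.card = i ∧ U.sum id = 0 then 1 else 0) * doubleWeight S.card i j := by
        refine sum_congr rfl fun U _ => ?_
        by_cases h0 : U.sum id = 0
        · simp only [h0, and_true, if_true, ite_mul, one_mul, zero_mul, sum_ite_eq, mem_range]
          split_ifs with h
          · rfl
          · exact doubleWeight_eq_zero (by omega)
        · simp only [h0, and_false, if_false, zero_mul, sum_const_zero]
    _ = _ := by
        rw [sum_comm]
        simp_rw [wordCount_eq_sum, sum_mul]

theorem wordCount_zero {d : ℕ} (S : Finset (Fin d → ZMod 2)) : wordCount S 0 = 1 := by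
  rw [wordCount, Finset.powersetCard_zero, Finset.filter_singleton, if_pos Finset.sum_empty,
    Finset.card_singleton]

theorem wordCount_eq_zero {d : ℕ} {S : Finset (Fin d → ZMod 2)} {j : ℕ} (h : S.card < j) :
    wordCount S j = 0 := by
  simp [wordCount, Finset.powersetCard_eq_empty.2 h]

/-- If two designs have equally many defining words of each length below `k`, then their doubles
compare at length `k` as the designs themselves do. -/
theorem wordCount_double_lt_iff {d₁ d₂ : ℕ} {S₁ : Finset (Fin d₁ → ZMod 2)}
    {S₂ : Finset (Fin d₂ → ZMod 2)} (hc : S₁.card = S₂.card) {k : ℕ}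
    (h : ∀ j, 1 ≤ j → j < k → wordCount S₁ j = wordCount S₂ j) :
    (wordCount (double S₁) k < wordCount (double S₂) k ↔ wordCount S₁ k < wordCount S₂ k) ∧
    (wordCount (double S₁) k = wordCount (double S₂) k ↔ wordCount S₁ k = wordCount S₂ k) := by
  have hsum : ∑ i ∈ Finset.range k, wordCount S₁ i * doubleWeight S₂.card i k =
      ∑ i ∈ Finset.range k, wordCount S₂ i * doubleWeight S₂.card i k := by
    refine Finset.sum_congr rfl fun i hi => ?_
    rcases Nat.eq_zero_or_pos i with rfl | hpos
    · rw [wordCount_zero, wordCount_zero]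
    · rw [h i hpos (Finset.mem_range.1 hi)]
  have hw := doubleWeight_self_pos S₂.card k
  rw [wordCount_double_s6, wordCount_double_s6, hc, Finset.sum_range_succ, Finset.sum_range_succ, hsum,
    Nat.add_lt_add_iff_left, Nat.add_left_cancel_iff]
  exact ⟨Nat.mul_lt_mul_right hw, Nat.mul_left_inj hw.ne'⟩

-- S₁ has less aberration than S₂ iff D(S₁) has less aberration than D(S₂) (Corollary 2.4).
theorem lessAberration_double_iff (d₁ d₂ n : ℕ)
    (S₁ : Finset (Fin d₁ → ZMod 2)) (S₂ : Finset (Fin d₂ → ZMod 2))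
    (hS₁ : ∀ v ∈ S₁, v ≠ 0) (hS₂ : ∀ v ∈ S₂, v ≠ 0)
    (hc₁ : S₁.card = n) (hc₂ : S₂.card = n) :
    LessAberration n S₁ S₂ ↔ LessAberration (2 * n) (double S₁) (double S₂) := by
  have hc : S₁.card = S₂.card := hc₁.trans hc₂.symm
  constructor
  · rintro ⟨k, hk, hkn, heq, hlt⟩
    refine ⟨k, hk, by omega, fun j hj hjk => ?_, (wordCount_double_lt_iff hc heq).1.2 hlt⟩
    exact (wordCount_double_lt_iff hc fun i hi hij => heq i hi (hij.trans hjk)).2.2 (heq j hj hjk)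
  · rintro ⟨k, hk, -, heq, hlt⟩
    have heq' : ∀ j, 1 ≤ j → j < k → wordCount S₁ j = wordCount S₂ j := by
      intro j
      induction j using Nat.strong_induction_on with
      | _ j ih =>
        intro hj hjk
        exact (wordCount_double_lt_iff hc
          fun i hi hij => ih i hij hi (hij.trans hjk)).2.1 (heq j hj hjk)
    have hlt' := (wordCount_double_lt_iff hc heq').1.1 hlt
    refine ⟨k, hk, ?_, heq', hlt'⟩
    by_contra! hn
    rw [wordCount_eq_zero (S := S₂) (hc₂.trans_lt hn)] at hlt'
    exact Nat.not_lt_zero _ hlt'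
end

section
/- If S is a cap in F₂^d (a Finset of nonzero vectors no three distinct elements of which sum to zero), then its double D(S) is a cap in F₂^(d+1). (In design language: if a regular design has resolution at least IV, then its double has resolution at least IV.) -/
-- The 2^{5-1} design with defining relation I = ABCDE, as a subset of F₂⁴.

theorem init_mem_of_mem_double {d : ℕ} {S : Finset (Fin d → ZMod 2)}
    {x : Fin (d + 1) → ZMod 2} (hx : x ∈ double S) :
    (fun i : Fin d => x i.castSucc) ∈ S := by
  simp only [double, Finset.mem_union, Finset.mem_image] at hx
  obtain ⟨v, hv, rfl⟩ | ⟨v, hv, rfl⟩ := hx <;> simpa using hv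

theorem IsCap.add_add_ne_zero {d : ℕ} {S : Finset (Fin d → ZMod 2)} (hS : IsCap S)
    {a b c : Fin d → ZMod 2} (ha : a ∈ S) (hb : b ∈ S) (hc : c ∈ S) : a + b + c ≠ 0 := by
  have add_self (v : Fin d → ZMod 2) : v + v = 0 := funext fun i => CharTwo.add_self_eq_zero (v i)
  intro h
  by_cases hab : a = b
  · subst hab
    rw [add_self, zero_add] at h
    exact hS.1 c hc h
  by_cases hbc : b = c
  · subst hbc
    rw [add_assoc, add_self, add_zero] at h
    exact hS.1 a ha h
  by_cases hac : a = c
  · subst hac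
    rw [add_right_comm, add_self, zero_add] at h
    exact hS.1 b hb h
  exact hS.2 a ha b hb c hc hab hbc hac h

-- If S is a cap in F₂^d, then its double D(S) is a cap in F₂^(d+1)
-- (doubling preserves resolution at least IV).
theorem isCap_double (d : ℕ) (S : Finset (Fin d → ZMod 2)) (hS : IsCap S) :
    IsCap (double S) := by
  refine ⟨fun v hv h => ?_, fun a ha b hb c hc _ _ _ h => ?_⟩
  · exact hS.1 _ (init_mem_of_mem_double hv) (funext fun i => congrFun h i.castSucc)
  · exact hS.add_add_ne_zero (init_mem_of_mem_double ha) (init_mem_of_mem_double hb)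
      (init_mem_of_mem_double hc) (funext fun i => congrFun h i.castSucc)
end

section
/- Let d ≥ 4 and let S be a maximal cap in F₂^d with 2^(d−2) + 2 ≤ |S| ≤ 2^(d−1). Then S can be obtained by doubling a maximal cap: there exist a linear automorphism g of F₂^d and a maximal cap T in F₂^(d−1) such that the image of S under g equals D(T). (In design language: every maximal regular design of resolution IV with N/4 + 2 ≤ n ≤ N/2 is, up to isomorphism, the double of a maximal regular design of resolution IV or higher.) -/
section

set_option linter.unusedSectionVars false

variable {V : Type*} [AddCommGroup V] [Module (ZMod 2) V]

theorem add_add_cancel_char_two (x y : V) : x + y + y = x := by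
  rw [add_assoc, ZModModule.add_self, add_zero]

theorem mem_sup_span_singleton_char_two (W : Submodule (ZMod 2) V) (t z : V) :
    z ∈ W ⊔ Submodule.span (ZMod 2) {t} ↔ z ∈ W ∨ z + t ∈ W := by
  rw [Submodule.mem_sup]
  constructor
  · rintro ⟨y, hy, u, hu, rfl⟩
    obtain ⟨a, rfl⟩ := Submodule.mem_span_singleton.1 hu
    have : ∀ a : ZMod 2, a = 0 ∨ a = 1 := by decide
    rcases this a with rfl | rfl
    · left; simpa using hy
    · right; simpa [add_add_cancel_char_two] using hy
  · rintro (h | h)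
    · exact ⟨z, h, 0, zero_mem _, add_zero z⟩
    · exact ⟨z + t, h, t, Submodule.mem_span_singleton_self t, add_add_cancel_char_two z t⟩

/-- `I` lies in one coset of `W` and is independent in the Cayley graph of `W` with connection
set `C`. -/
def Indep (W : Submodule (ZMod 2) V) (C I : Finset V) : Prop :=
  ∀ x ∈ I, ∀ y ∈ I, x + y ∈ W ∧ x + y ∉ C

/-- A set containing no sum of two of its elements. -/
def SumFree (A : Finset V) : Prop := ∀ a ∈ A, ∀ b ∈ A, a + b ∉ A

/-- `C` is a complete sum-free set in `W`, with `q + 1` elements where `W` has `4 * q`, and every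
large independent set for `C` is contained in a translate of `C`. -/
structure Crit (W : Submodule (ZMod 2) V) (C : Finset V) (q : ℕ) : Prop where
  sub : ∀ x ∈ C, x ∈ W
  pos : 0 < q
  even : Even q
  sumFree : SumFree C
  card_eq : C.card = q + 1
  natCard : Nat.card W = 4 * q
  complete : ∀ z ∈ W, z ∉ C → ∃ a ∈ C, ∃ b ∈ C, a + b = z
  large : ∀ I : Finset V, q + 1 ≤ I.card → Indep W C I → ∃ v, ∀ x ∈ I, x + v ∈ C

theorem SumFree.ne {A : Finset V} (h : SumFree A) {a b c : V} (ha : a ∈ A) (hb : b ∈ A)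
    (hc : c ∈ A) : a + b ≠ c := fun e => h a ha b hb (e ▸ hc)

theorem SumFree.zero_notMem {A : Finset V} (h : SumFree A) : (0 : V) ∉ A :=
  fun h0 => h 0 h0 0 h0 (by simpa using h0)

variable [DecidableEq V]

theorem card_image_add (I : Finset V) (v : V) : (I.image (· + v)).card = I.card :=
  Finset.card_image_of_injective _ (add_left_injective v)

theorem even_card_filter_add_mem (C : Finset V) {x : V} (hx : x ≠ 0) :
    Even (C.filter (· + x ∈ C)).card := by
  have h : ∑ _c ∈ C.filter (· + x ∈ C), (1 : ZMod 2) = 0 := by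
    refine Finset.sum_involution (fun c _ => c + x) (fun _ _ => by decide) ?_ ?_ ?_
    · intro c _ _ e
      exact hx (by simpa using e)
    · intro c hc
      rw [Finset.mem_filter] at hc ⊢
      simpa [add_add_cancel_char_two] using hc.symm
    · intro c _
      exact add_add_cancel_char_two c x
  rw [Finset.sum_const, nsmul_one] at h
  exact (ZMod.natCast_eq_zero_iff_even).1 h

theorem Crit.card_filter_add_two_le {W : Submodule (ZMod 2) V} {C : Finset V} {q : ℕ}
    (h : Crit W C q) {x : V} (hx : x ≠ 0) : (C.filter (· + x ∈ C)).card + 2 ≤ q := by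
  have ev := even_card_filter_add_mem C hx
  have hle := Finset.card_filter_le C (· + x ∈ C)
  have hne : (C.filter (· + x ∈ C)).card ≠ q := by
    intro hq
    have h1 : (C.filter (¬ · + x ∈ C)).card = 1 := by
      have := Finset.card_filter_add_card_filter_not (s := C) (· + x ∈ C)
      have := h.card_eq
      omega
    obtain ⟨c, hc⟩ := Finset.card_eq_one.1 h1
    have hcm : c ∈ C ∧ c + x ∉ C := by
      have : c ∈ C.filter (¬ · + x ∈ C) := by simp [hc]
      simpa using this
    have huniq : ∀ a ∈ C, a ≠ c → a + x ∈ C := by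
      intro a ha hac
      by_contra hcon
      have : a ∈ C.filter (¬ · + x ∈ C) := by simp [ha, hcon]
      rw [hc] at this
      exact hac (by simpa using this)
    have : ∃ m ∈ C, m + x ∈ C := by
      have : 0 < (C.filter (· + x ∈ C)).card := hq ▸ h.pos
      obtain ⟨m, hm⟩ := Finset.card_pos.1 this
      exact ⟨m, by simpa using hm⟩
    obtain ⟨m, hm, hmx⟩ := this
    have hxW : x ∈ W := by
      have := W.add_mem (h.sub _ hmx) (h.sub _ hm)
      have e : m + x + m = x := by rw [add_comm m x, add_add_cancel_char_two]
      rwa [e] at this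
    have hxC : x ∉ C := fun hxC => h.sumFree m hm x hxC hmx
    obtain ⟨a, ha, b, hb, e⟩ := h.complete (c + x) (W.add_mem (h.sub _ hcm.1) hxW) hcm.2
    have hac : a = c := by
      by_contra hac
      exact h.sumFree.ne (huniq a ha hac) hb hcm.1 (by
        linear_combination (norm := (match_scalars <;> decide)) (1 : ZMod 2) • e)
    subst hac
    exact hxC (add_left_cancel e ▸ hb)
  rw [h.card_eq] at hle
  have := h.even
  rcases ev with ⟨m, hm⟩
  rcases this with ⟨n, hn⟩
  have : (C.filter (· + x ∈ C)).card ≠ q + 1 := by omega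
  omega

theorem Crit.translate_unique {W : Submodule (ZMod 2) V} {C : Finset V} {q : ℕ}
    (h : Crit W C q) {S : Finset V} {x y : V} (hx : ∀ s ∈ S, s + x ∈ C) (hy : ∀ s ∈ S, s + y ∈ C)
    (hS : q ≤ S.card + 1) : x = y := by
  by_contra hne
  have hxy : x + y ≠ 0 := fun e => hne (by
    linear_combination (norm := (match_scalars <;> decide)) (1 : ZMod 2) • e)
  have h1 := h.card_filter_add_two_le hxy
  have h2 : (S.image (· + x)).card ≤ (C.filter (· + (x + y) ∈ C)).card := by
    apply Finset.card_le_card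
    intro z hz
    obtain ⟨s, hs, rfl⟩ := Finset.mem_image.1 hz
    have e : s + x + (x + y) = s + y := by rw [← add_assoc, add_add_cancel_char_two]
    simp [hx s hs, e, hy s hs]
  rw [card_image_add] at h2
  omega

theorem Crit.card_eq_of_large {W : Submodule (ZMod 2) V} {C : Finset V} {q : ℕ}
    (h : Crit W C q) {I : Finset V} {v : V} (hI : q + 1 ≤ I.card) (hv : ∀ x ∈ I, x + v ∈ C) :
    I.card = q + 1 ∧ ∀ c ∈ C, c + v ∈ I := by
  have hsub : I.image (· + v) ⊆ C := by
    intro z hz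
    obtain ⟨s, hs, rfl⟩ := Finset.mem_image.1 hz
    exact hv s hs
  have heq := Finset.eq_of_subset_of_card_le hsub (by rw [card_image_add, h.card_eq]; exact hI)
  refine ⟨by rw [← card_image_add I v, heq, h.card_eq], fun c hc => ?_⟩
  rw [← heq] at hc
  obtain ⟨s, hs, rfl⟩ := Finset.mem_image.1 hc
  simpa [add_add_cancel_char_two] using hs

theorem Crit.add_mem_of_indep_union {W : Submodule (ZMod 2) V} {C : Finset V} {q : ℕ}
    (h : Crit W C q) {Y Z : Finset V} {x : V} (hY : ∀ y ∈ Y, y + x ∈ C) (hq : q ≤ Y.card)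
    (hi : Indep W C (Y ∪ Z)) : ∀ z ∈ Z, z + x ∈ C := by
  by_cases hc : q + 1 ≤ (Y ∪ Z).card
  · obtain ⟨v, hv⟩ := h.large _ hc hi
    have := h.translate_unique hY (fun s hs => hv s (Finset.mem_union_left _ hs)) (by omega)
    subst this
    exact fun z hz => hv z (Finset.mem_union_right _ hz)
  · have : Y = Y ∪ Z := Finset.eq_of_subset_of_card_le Finset.subset_union_left (by omega)
    intro z hz
    exact hY z (this ▸ Finset.mem_union_right _ hz)

theorem natCard_eq_card_filter [Fintype V] (W : Submodule (ZMod 2) V) [DecidablePred (· ∈ W)] :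
    Nat.card W = (Finset.univ.filter (· ∈ W)).card := by
  rw [Nat.card_eq_fintype_card, Fintype.card_subtype]

theorem natCard_sup_span_singleton [Fintype V] {W : Submodule (ZMod 2) V} {t : V} (ht : t ∉ W) :
    Nat.card ↥(W ⊔ Submodule.span (ZMod 2) {t}) = 2 * Nat.card W := by
  classical
  rw [natCard_eq_card_filter, natCard_eq_card_filter]
  have h1 : (Finset.univ.filter (· ∈ W ⊔ Submodule.span (ZMod 2) {t})) =
      Finset.univ.filter (· ∈ W) ∪ (Finset.univ.filter (· ∈ W)).image (· + t) := by
    ext z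
    simp only [Finset.mem_filter, Finset.mem_univ, true_and, mem_sup_span_singleton_char_two,
      Finset.mem_union, Finset.mem_image]
    refine or_congr Iff.rfl ⟨fun h => ⟨_, h, add_add_cancel_char_two z t⟩, ?_⟩
    rintro ⟨y, hy, rfl⟩
    rwa [add_add_cancel_char_two]
  rw [h1, Finset.card_union_of_disjoint, card_image_add, two_mul]
  rw [Finset.disjoint_left]
  intro z hz hz'
  obtain ⟨y, hy, rfl⟩ := Finset.mem_image.1 hz'
  simp only [Finset.mem_filter, Finset.mem_univ, true_and] at hz hy
  exact ht ((W.add_mem_iff_right hy).1 hz)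

theorem Indep.mono {W : Submodule (ZMod 2) V} {C I I' : Finset V} (h : Indep W C I) (hs : I' ⊆ I) :
    Indep W C I' := fun x hx y hy => h x (hs hx) y (hs hy)

theorem add_mem_of_add_mem {W : Submodule (ZMod 2) V} {x y z : V} (hx : x + z ∈ W)
    (hy : y + z ∈ W) : x + y ∈ W := by
  have e : x + y = (x + z) + (y + z) := by
    grind [ZModModule.add_self z]
  exact e ▸ W.add_mem hx hy

theorem indep_of_add_mem {A C : Finset V} {W : Submodule (ZMod 2) V} (hA : SumFree A)
    (hC : ∀ x, x ∈ C ↔ x ∈ A ∧ x ∈ W) {J : Finset V} {t : V} (hJ : ∀ x ∈ J, x ∈ A ∧ x + t ∈ W) :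
    Indep W C J := fun x hx y hy =>
  ⟨add_mem_of_add_mem (hJ x hx).2 (hJ y hy).2,
    fun h => hA x (hJ x hx).1 y (hJ y hy).1 ((hC _).1 h).1⟩

theorem Indep.union {W : Submodule (ZMod 2) V} {C I J : Finset V} (hI : Indep W C I)
    (hJ : Indep W C J) (h : ∀ x ∈ I, ∀ y ∈ J, x + y ∈ W ∧ x + y ∉ C) : Indep W C (I ∪ J) := by
  intro x hx y hy
  rcases Finset.mem_union.1 hx with hx | hx <;> rcases Finset.mem_union.1 hy with hy | hy
  · exact hI x hx y hy
  · exact h x hx y hy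
  · rw [add_comm]; exact h y hy x hx
  · exact hJ x hx y hy

theorem Indep.singleton {W : Submodule (ZMod 2) V} {C : Finset V} (hC : SumFree C) (z : V) :
    Indep W C {z} := by
  intro x hx y hy
  rw [Finset.mem_singleton.1 hx, Finset.mem_singleton.1 hy, ZModModule.add_self]
  exact ⟨W.zero_mem, hC.zero_notMem⟩

theorem Indep.image_add {W : Submodule (ZMod 2) V} {C I : Finset V} (hI : Indep W C I) (v : V) :
    Indep W C (I.image (· + v)) := by
  intro x hx y hy
  obtain ⟨a, ha, rfl⟩ := Finset.mem_image.1 hx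
  obtain ⟨b, hb, rfl⟩ := Finset.mem_image.1 hy
  have e : a + v + (b + v) = a + b := by grind [ZModModule.add_self v]
  exact e ▸ hI a ha b hb

/-- Restricting to a coset of a smaller submodule. -/
theorem Indep.restrict {W W' : Submodule (ZMod 2) V} {C C' I I' : Finset V} (hI : Indep W' C' I)
    (hC : C ⊆ C') {b : V} (hI' : ∀ x ∈ I', x ∈ I ∧ x + b ∈ W) : Indep W C I' :=
  fun x hx y hy => ⟨add_mem_of_add_mem (hI' x hx).2 (hI' y hy).2,
    fun h => (hI x (hI' x hx).1 y (hI' y hy).1).2 (hC h)⟩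

theorem Crit.sup_span_singleton [Fintype V] {A C C' J : Finset V} {W : Submodule (ZMod 2) V}
    {q : ℕ} {t : V} (hA : SumFree A) (h : Crit W C q) (hC : ∀ x, x ∈ C ↔ x ∈ A ∧ x ∈ W)
    (ht : t ∉ W) (hJ : ∀ x, x ∈ J ↔ x ∈ A ∧ x + t ∈ W) (hJq : J.card = q)
    (hJn : ¬ ∃ v, ∀ x ∈ J, x + v ∈ C)
    (hC' : ∀ x, x ∈ C' ↔ x ∈ A ∧ x ∈ W ⊔ Submodule.span (ZMod 2) {t}) :
    Crit (W ⊔ Submodule.span (ZMod 2) {t}) C' (2 * q) := by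
  classical
  have hCJ : C' = C ∪ J := by
    ext x
    rw [hC', mem_sup_span_singleton_char_two, Finset.mem_union, hC, hJ, and_or_left]
  have hJi : Indep W C J := indep_of_add_mem hA hC fun x hx => (hJ x).1 hx
  have hCC' : C ⊆ C' := hCJ ▸ Finset.subset_union_left
  have hJC' : J ⊆ C' := hCJ ▸ Finset.subset_union_right
  have hdisj : Disjoint C J := by
    rw [Finset.disjoint_left]
    intro x hx hx'
    exact ht ((W.add_mem_iff_right (h.sub x hx)).1 ((hJ x).1 hx').2)
  refine ⟨fun x hx => ((hC' x).1 hx).2, by have := h.pos; omega, even_two_mul q,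
    fun a ha b hb hab => hA a ((hC' _).1 ha).1 b ((hC' _).1 hb).1 ((hC' _).1 hab).1, ?_, ?_, ?_, ?_⟩
  · rw [hCJ, Finset.card_union_of_disjoint hdisj, h.card_eq, hJq]; omega
  · rw [natCard_sup_span_singleton ht, h.natCard]; ring
  · intro z hz hzC
    rcases (mem_sup_span_singleton_char_two W t z).1 hz with hz | hz
    · obtain ⟨a, ha, b, hb, e⟩ := h.complete z hz (fun hh => hzC (hCC' hh))
      exact ⟨a, hCC' ha, b, hCC' hb, e⟩
    · by_contra hcon
      push Not at hcon
      have hzJ : z ∉ J := fun hh => hzC (hJC' hh)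
      have hi : Indep W C (J ∪ {z}) := by
        refine hJi.union (Indep.singleton h.sumFree z) ?_
        intro x hx y hy
        rw [Finset.mem_singleton.1 hy]
        refine ⟨add_mem_of_add_mem ((hJ x).1 hx).2 hz, fun hxz => ?_⟩
        exact hcon x (hJC' hx) _ (hCC' hxz) (by grind [ZModModule.add_self x])
      have hcard : (J ∪ {z}).card = q + 1 := by
        rw [Finset.card_union_of_disjoint (by simpa using hzJ), hJq, Finset.card_singleton]
      obtain ⟨v, hv⟩ := h.large _ hcard.ge hi
      exact hJn ⟨v, fun x hx => hv x (Finset.mem_union_left _ hx)⟩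
  · intro I hI hIi
    have main : ∀ b, (∀ x ∈ I, x + b ∈ W ∨ x + b + t ∈ W) →
        q + 1 ≤ (I.filter (· + b ∈ W)).card → ∃ v, ∀ x ∈ I, x + v ∈ C' := by
      intro b hb hcard
      have hi0 : Indep W C (I.filter (· + b ∈ W)) :=
        hIi.restrict hCC' (b := b) fun x hx => Finset.mem_filter.1 hx
      obtain ⟨v, hv⟩ := h.large _ hcard hi0
      obtain ⟨hcard0, hfull⟩ := h.card_eq_of_large hcard hv
      have hvb : v + b ∈ W := by
        obtain ⟨x, hx⟩ := Finset.card_pos.1 (lt_of_lt_of_le (Nat.succ_pos q) hcard)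
        have h1 := h.sub _ (hv x hx)
        have h2 := (Finset.mem_filter.1 hx).2
        exact add_mem_of_add_mem (by rwa [add_comm] at h1) (by rwa [add_comm] at h2)
      set I1 := I.filter (¬ · + b ∈ W) with hI1
      have hI1m : ∀ x ∈ I1, x ∈ I ∧ x + (b + t) ∈ W := by
        intro x hx
        obtain ⟨hx, hx'⟩ := Finset.mem_filter.1 hx
        exact ⟨hx, by rw [← add_assoc]; exact (hb x hx).resolve_left hx'⟩
      have hcard1 : q ≤ I1.card := by
        have h1 : (I.filter (· + b ∈ W)).card + I1.card = I.card := by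
          rw [hI1]
          exact Finset.card_filter_add_card_filter_not _
        omega
      have hi1 : Indep W C I1 := hIi.restrict hCC' hI1m
      have hu : Indep W C (J ∪ I1.image (· + v)) := by
        refine hJi.union (hi1.image_add v) ?_
        intro j hj y hy
        obtain ⟨x, hx, rfl⟩ := Finset.mem_image.1 hy
        constructor
        · have e : j + (x + v) = (j + t) + (x + (b + t)) + (v + b) := by
            grind [ZModModule.add_self b, ZModModule.add_self t]
          rw [e]
          exact W.add_mem (W.add_mem ((hJ j).1 hj).2 (hI1m x hx).2) hvb
        · intro hc
          have h1 := (hIi x (hI1m x hx).1 _ (Finset.mem_filter.1 (hfull _ hc)).1).2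
          have e : x + (j + (x + v) + v) = j := by
            grind [ZModModule.add_self x, ZModModule.add_self v]
          exact h1 (e.symm ▸ (hJC' hj : j ∈ C'))
      have hle : (J ∪ I1.image (· + v)).card ≤ J.card := by
        by_contra hlt
        obtain ⟨w, hw⟩ := h.large _ (by omega) hu
        exact hJn ⟨w, fun x hx => hw x (Finset.mem_union_left _ hx)⟩
      have hJeq := Finset.eq_of_subset_of_card_le Finset.subset_union_left hle
      refine ⟨v, fun x hx => ?_⟩
      by_cases hxb : x + b ∈ W
      · exact hCC' (hv x (Finset.mem_filter.2 ⟨hx, hxb⟩))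
      · apply hJC'
        rw [hJeq]
        exact Finset.mem_union_right _
          (Finset.mem_image_of_mem _ (Finset.mem_filter.2 ⟨hx, hxb⟩))
    obtain ⟨b, hb⟩ : I.Nonempty := Finset.card_pos.1 (by omega)
    have hsplit : ∀ x ∈ I, x + b ∈ W ∨ x + b + t ∈ W := fun x hx =>
      (mem_sup_span_singleton_char_two W t _).1 (hIi x hx b hb).1
    by_cases hc : q + 1 ≤ (I.filter (· + b ∈ W)).card
    · exact main b hsplit hc
    · refine main (b + t) (fun x hx => ?_) ?_
      · rw [← add_assoc, add_add_cancel_char_two]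
        exact (hsplit x hx).symm
      · have h1 := Finset.card_filter_add_card_filter_not (s := I) (· + b ∈ W)
        have h2 : (I.filter (¬ · + b ∈ W)).card ≤ (I.filter (· + (b + t) ∈ W)).card := by
          apply Finset.card_le_card
          intro x hx
          obtain ⟨hx, hx'⟩ := Finset.mem_filter.1 hx
          exact Finset.mem_filter.2 ⟨hx, by rw [← add_assoc]; exact (hsplit x hx).resolve_left hx'⟩
        omega

theorem Crit.card_le {W : Submodule (ZMod 2) V} {C I : Finset V} {q : ℕ} (h : Crit W C q) {v : V}
    (hI : ∀ x ∈ I, x + v ∈ C) : I.card ≤ q + 1 := by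
  by_contra hlt
  have := (h.card_eq_of_large (by omega) hI).1
  omega

theorem Crit.add_add_eq_zero {W : Submodule (ZMod 2) V} {C X Y : Finset V} {q : ℕ}
    (h : Crit W C q) {v₁ v₂ v₃ : V} (hv : v₁ + v₂ + v₃ ∈ W)
    (hX : Indep W C X) (hY : Indep W C Y) (hXv : ∀ x ∈ X, x + v₂ ∈ C) (hYv : ∀ y ∈ Y, y + v₃ ∈ C)
    (hXq : q ≤ X.card) (hYq : q ≤ Y.card + 1)
    (hXY : ∀ x ∈ X, ∀ y ∈ Y, x + y + v₁ ∉ C) : v₁ + v₂ + v₃ = 0 := by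
  have hu : Indep W C (X.image (· + v₁) ∪ Y) := by
    refine (hX.image_add v₁).union hY ?_
    intro z hz y hy
    obtain ⟨x, hx, rfl⟩ := Finset.mem_image.1 hz
    constructor
    · have e : x + v₁ + y = (x + v₂) + (y + v₃) + (v₁ + v₂ + v₃) := by
        grind [ZModModule.add_self v₂, ZModModule.add_self v₃]
      rw [e]
      exact W.add_mem (W.add_mem (h.sub _ (hXv x hx)) (h.sub _ (hYv y hy))) hv
    · rw [add_right_comm]
      exact hXY x hx y hy
  have h1 : ∀ y ∈ Y, y + (v₁ + v₂) ∈ C := by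
    refine h.add_mem_of_indep_union ?_ (by rwa [card_image_add]) hu
    intro z hz
    obtain ⟨x, hx, rfl⟩ := Finset.mem_image.1 hz
    have e : x + v₁ + (v₁ + v₂) = x + v₂ := by rw [← add_assoc, add_add_cancel_char_two]
    rw [e]
    exact hXv x hx
  rw [h.translate_unique h1 hYv hYq, ZModModule.add_self]

theorem Crit.exists_add_eq {A C J₁ J₂ J₃ : Finset V} {W : Submodule (ZMod 2) V} {q : ℕ}
    (hA : SumFree A) (h : Crit W C q) (hC : ∀ x, x ∈ C ↔ x ∈ A ∧ x ∈ W) {v₁ v₂ v₃ : V}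
    (hv : v₁ + v₂ + v₃ ∈ W) (hv0 : v₁ + v₂ + v₃ ≠ 0)
    (hJ₁ : ∀ x ∈ J₁, x ∈ A ∧ x + v₁ ∈ C) (hJ₂ : ∀ x ∈ J₂, x ∈ A ∧ x + v₂ ∈ C)
    (hJ₃ : ∀ x ∈ J₃, x ∈ A ∧ x + v₃ ∈ C) (hq₁ : J₁.card = q) (hq₂ : J₂.card = q)
    (hq₃ : J₃.card = q) {z : V} (hz : z + v₁ ∈ W) (hzA : z ∉ A) :
    ∃ a ∈ C ∪ J₂, ∃ b ∈ J₁ ∪ J₃, a + b = z := by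
  by_contra hcon
  push Not at hcon
  have ind : ∀ {J : Finset V} {v : V}, (∀ x ∈ J, x ∈ A ∧ x + v ∈ C) → Indep W C J :=
    fun hJ => indep_of_add_mem hA hC fun x hx => ⟨(hJ x hx).1, h.sub _ (hJ x hx).2⟩
  have hi : Indep W C (J₁ ∪ {z}) := by
    refine (ind hJ₁).union (Indep.singleton h.sumFree z) ?_
    intro x hx y hy
    rw [Finset.mem_singleton.1 hy]
    refine ⟨add_mem_of_add_mem (h.sub _ (hJ₁ x hx).2) hz, fun hc => ?_⟩
    exact hcon _ (Finset.mem_union_left _ hc) x (Finset.mem_union_left _ hx)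
      (by grind [ZModModule.add_self x])
  have hzC := h.add_mem_of_indep_union (fun x hx => (hJ₁ x hx).2) hq₁.ge hi z
    (Finset.mem_singleton_self z)
  have hcard : (J₁ ∪ {z}).card = q + 1 := by
    rw [Finset.card_union_of_disjoint (by simpa using fun hh => hzA (hJ₁ z hh).1), hq₁,
      Finset.card_singleton]
  have hfull := (h.card_eq_of_large (v := v₁) hcard.ge (by
    intro x hx
    rcases Finset.mem_union.1 hx with hx | hx
    · exact (hJ₁ x hx).2
    · rwa [Finset.mem_singleton.1 hx])).2
  refine hv0 (h.add_add_eq_zero hv (ind hJ₂) (ind hJ₃) (fun x hx => (hJ₂ x hx).2)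
    (fun x hx => (hJ₃ x hx).2) hq₂.ge (by omega) ?_)
  intro x hx y hy hc
  have h1 := hfull _ hc
  rw [add_add_cancel_char_two] at h1
  rcases Finset.mem_union.1 h1 with h1 | h1
  · exact hA x (hJ₂ x hx).1 y (hJ₃ y hy).1 (hJ₁ _ h1).1
  · exact hcon x (Finset.mem_union_right _ hx) y (Finset.mem_union_right _ hy)
      (Finset.mem_singleton.1 h1)

theorem Crit.card_add_two_le_of_full {C I₁ I₃ J₂ : Finset V} {W : Submodule (ZMod 2) V} {q : ℕ}
    (h : Crit W C q) {v₁ v₂ v₃ : V} (hv : v₁ + v₂ + v₃ ∈ W) (hv0 : v₁ + v₂ + v₃ ≠ 0)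
    (hI₁ : ∀ x ∈ I₁, x + v₁ ∈ C) (hI₃ : ∀ x ∈ I₃, x + v₃ ∈ C) (hJ₂ : ∀ x ∈ J₂, x + v₂ ∈ C)
    (hI₃i : Indep W C I₃) (hJ₂i : Indep W C J₂) (hI₁q : q + 1 ≤ I₁.card) (hJ₂q : J₂.card = q)
    (hsum : ∀ x ∈ I₁, ∀ y ∈ J₂, ∀ z ∈ I₃, y + z ≠ x) : I₃.card + 2 ≤ q := by
  by_contra hlt
  refine hv0 (h.add_add_eq_zero hv hJ₂i hI₃i hJ₂ hI₃ hJ₂q.ge (by omega) fun x hx y hy hc => ?_)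
  have h1 := (h.card_eq_of_large hI₁q hI₁).2 _ hc
  rw [add_add_cancel_char_two] at h1
  exact hsum _ h1 x hx y hy rfl

theorem Crit.eq_of_card_eq {C I₁ I₂ I₃ J₁ J₂ : Finset V} {W : Submodule (ZMod 2) V} {q : ℕ}
    (h : Crit W C q) {v₁ v₂ v₃ : V} (hv : v₁ + v₂ + v₃ ∈ W) (hv0 : v₁ + v₂ + v₃ ≠ 0)
    (hI₁ : ∀ x ∈ I₁, x + v₁ ∈ C) (hI₂ : ∀ x ∈ I₂, x + v₂ ∈ C) (hI₃ : ∀ x ∈ I₃, x + v₃ ∈ C)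
    (hJ₁ : ∀ x ∈ J₁, x + v₁ ∈ C) (hJ₂ : ∀ x ∈ J₂, x + v₂ ∈ C)
    (hI₂i : Indep W C I₂) (hI₃i : Indep W C I₃)
    (hI₁q : I₁.card = q) (hI₂q : I₂.card = q) (hI₃q : I₃.card = q) (hJ₁q : J₁.card = q)
    (hJ₂q : J₂.card = q)
    (hsum : ∀ x ∈ I₁, ∀ y ∈ J₂, ∀ z ∈ I₃, z + y ≠ x)
    (hsum' : ∀ x ∈ J₁, ∀ y ∈ I₂, ∀ z ∈ I₃, z + y ≠ x) : I₁ = J₁ := by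
  by_contra hne
  have hU : q + 1 ≤ (I₁ ∪ J₁).card := by
    by_contra hlt
    have h1 := Finset.eq_of_subset_of_card_le (Finset.subset_union_left (s₁ := I₁) (s₂ := J₁))
      (by omega)
    have h2 := Finset.eq_of_subset_of_card_le (Finset.subset_union_right (s₁ := I₁) (s₂ := J₁))
      (by omega)
    exact hne (h1.trans h2.symm)
  have hfull := (h.card_eq_of_large (I := I₁ ∪ J₁) (v := v₁) hU fun x hx =>
    (Finset.mem_union.1 hx).elim (hI₁ x) (hJ₁ x)).2
  have hY : q ≤ (I₂ ∩ J₂).card + 1 := by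
    have h1 : (I₂ ∪ J₂).card ≤ q + 1 := h.card_le (v := v₂) fun x hx =>
      (Finset.mem_union.1 hx).elim (hI₂ x) (hJ₂ x)
    have h2 := Finset.card_union_add_card_inter I₂ J₂
    omega
  have e : v₁ + v₃ + v₂ = v₁ + v₂ + v₃ := add_right_comm _ _ _
  refine hv0 (e ▸ h.add_add_eq_zero (e ▸ hv) hI₃i (hI₂i.mono Finset.inter_subset_left) hI₃
    (fun y hy => hI₂ y (Finset.inter_subset_left hy)) hI₃q.ge hY fun x hx y hy hc => ?_)
  have h1 := hfull _ hc
  rw [add_add_cancel_char_two] at h1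
  rcases Finset.mem_union.1 h1 with h1 | h1
  · exact hsum _ h1 y (Finset.inter_subset_right hy) x hx rfl
  · exact hsum' _ h1 y (Finset.inter_subset_left hy) x hx rfl

theorem disjoint_of_add_notMem {W : Submodule (ZMod 2) V} {X Y : Finset V} {a b : V}
    (hX : ∀ x ∈ X, x + a ∈ W) (hY : ∀ x ∈ Y, x + b ∈ W) (hab : a + b ∉ W) : Disjoint X Y := by
  rw [Finset.disjoint_left]
  intro x hx hy
  have h1 := hX x hx
  have h2 := hY x hy
  rw [add_comm] at h1 h2
  exact hab (add_mem_of_add_mem h1 h2)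

theorem Crit.sup_span_pair [Fintype V] {A C C' J₁ J₂ J₃ : Finset V} {W : Submodule (ZMod 2) V}
    {q : ℕ} (hA : SumFree A) (h : Crit W C q) (hC : ∀ x, x ∈ C ↔ x ∈ A ∧ x ∈ W) {v₁ v₂ v₃ : V}
    (hv₁ : v₁ ∉ W) (hv₂ : v₂ ∉ W) (hv₁₂ : v₁ + v₂ ∉ W)
    (hv : v₁ + v₂ + v₃ ∈ W) (hv0 : v₁ + v₂ + v₃ ≠ 0)
    (hJ₁ : ∀ x, x ∈ J₁ ↔ x ∈ A ∧ x + v₁ ∈ W) (hJ₂ : ∀ x, x ∈ J₂ ↔ x ∈ A ∧ x + v₂ ∈ W)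
    (hJ₃ : ∀ x, x ∈ J₃ ↔ x ∈ A ∧ x + v₃ ∈ W) (hJC₁ : ∀ x ∈ J₁, x + v₁ ∈ C)
    (hJC₂ : ∀ x ∈ J₂, x + v₂ ∈ C) (hJC₃ : ∀ x ∈ J₃, x + v₃ ∈ C) (hq₁ : J₁.card = q)
    (hq₂ : J₂.card = q) (hq₃ : J₃.card = q)
    (hC' : ∀ x, x ∈ C' ↔ x ∈ A ∧
      x ∈ W ⊔ Submodule.span (ZMod 2) {v₁} ⊔ Submodule.span (ZMod 2) {v₂}) :
    Crit (W ⊔ Submodule.span (ZMod 2) {v₁} ⊔ Submodule.span (ZMod 2) {v₂}) C' (4 * q) := by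
  classical
  set W' := W ⊔ Submodule.span (ZMod 2) {v₁} ⊔ Submodule.span (ZMod 2) {v₂} with hW'
  have hmem : ∀ z, z ∈ W' ↔ z ∈ W ∨ z + v₁ ∈ W ∨ z + v₂ ∈ W ∨ z + v₃ ∈ W := by
    intro z
    rw [hW', mem_sup_span_singleton_char_two, mem_sup_span_singleton_char_two,
      mem_sup_span_singleton_char_two, or_assoc]
    have e : z + v₂ + v₁ = z + v₃ + (v₁ + v₂ + v₃) := by grind [ZModModule.add_self v₃]
    rw [e, W.add_mem_iff_left hv]
  have hv213 : v₂ + v₁ + v₃ ∈ W := by rwa [add_comm v₂]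
  have hv312 : v₃ + v₁ + v₂ ∈ W := by rwa [add_assoc, add_comm v₃]
  have hv213' : v₂ + v₁ + v₃ ≠ 0 := by rwa [add_comm v₂]
  have hv312' : v₃ + v₁ + v₂ ≠ 0 := by rwa [add_assoc, add_comm v₃]
  have hv132 : v₁ + v₃ + v₂ ∈ W := by rwa [add_right_comm]
  have hv132' : v₁ + v₃ + v₂ ≠ 0 := by rwa [add_right_comm]
  have hv₃ : v₃ ∉ W := fun hh => hv₁₂ ((W.add_mem_iff_left hh).1 hv)
  have hv₁₃ : v₁ + v₃ ∉ W := fun hh => hv₂ ((W.add_mem_iff_right hh).1 hv132)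
  have hv₂₃ : v₂ + v₃ ∉ W := fun hh => hv₁ ((W.add_mem_iff_left hh).1 (by rwa [← add_assoc]))
  have hCC' : C ⊆ C' := fun x hx => (hC' x).2 ⟨((hC x).1 hx).1, (hmem x).2 (Or.inl (h.sub x hx))⟩
  have hJC'₁ : J₁ ⊆ C' := fun x hx => (hC' x).2
    ⟨((hJ₁ x).1 hx).1, (hmem x).2 (Or.inr (Or.inl ((hJ₁ x).1 hx).2))⟩
  have hJC'₂ : J₂ ⊆ C' := fun x hx => (hC' x).2
    ⟨((hJ₂ x).1 hx).1, (hmem x).2 (Or.inr (Or.inr (Or.inl ((hJ₂ x).1 hx).2)))⟩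
  have hJC'₃ : J₃ ⊆ C' := fun x hx => (hC' x).2
    ⟨((hJ₃ x).1 hx).1, (hmem x).2 (Or.inr (Or.inr (Or.inr ((hJ₃ x).1 hx).2)))⟩
  have hJi₁ : Indep W C J₁ := indep_of_add_mem hA hC fun x hx => (hJ₁ x).1 hx
  have hJi₂ : Indep W C J₂ := indep_of_add_mem hA hC fun x hx => (hJ₂ x).1 hx
  have hJi₃ : Indep W C J₃ := indep_of_add_mem hA hC fun x hx => (hJ₃ x).1 hx
  have hJA₁ : ∀ x ∈ J₁, x ∈ A ∧ x + v₁ ∈ C := fun x hx => ⟨((hJ₁ x).1 hx).1, hJC₁ x hx⟩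
  have hJA₂ : ∀ x ∈ J₂, x ∈ A ∧ x + v₂ ∈ C := fun x hx => ⟨((hJ₂ x).1 hx).1, hJC₂ x hx⟩
  have hJA₃ : ∀ x ∈ J₃, x ∈ A ∧ x + v₃ ∈ C := fun x hx => ⟨((hJ₃ x).1 hx).1, hJC₃ x hx⟩
  refine ⟨fun x hx => ((hC' x).1 hx).2, by have := h.pos; omega, ?_,
    fun a ha b hb hab => hA a ((hC' _).1 ha).1 b ((hC' _).1 hb).1 ((hC' _).1 hab).1, ?_, ?_, ?_, ?_⟩
  · exact (h.even).mul_left 4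
  · have hCu : C' = C ∪ (J₁ ∪ (J₂ ∪ J₃)) := by
      ext x
      rw [hC', hmem, Finset.mem_union, Finset.mem_union, Finset.mem_union, hC, hJ₁, hJ₂, hJ₃,
        and_or_left, and_or_left, and_or_left]
    have d0 : ∀ {J : Finset V} {v : V}, (∀ x, x ∈ J ↔ x ∈ A ∧ x + v ∈ W) → v ∉ W → Disjoint C J :=
      fun hJ hv => disjoint_of_add_notMem (a := 0) (fun x hx => by simpa using h.sub x hx)
        (fun x hx => ((hJ x).1 hx).2) (by simpa using hv)
    have d1 : ∀ {J J' : Finset V} {v v' : V}, (∀ x, x ∈ J ↔ x ∈ A ∧ x + v ∈ W) →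
        (∀ x, x ∈ J' ↔ x ∈ A ∧ x + v' ∈ W) → v + v' ∉ W → Disjoint J J' :=
      fun hJ hJ' hv => disjoint_of_add_notMem
        (fun x hx => ((hJ x).1 hx).2) (fun x hx => ((hJ' x).1 hx).2) hv
    rw [hCu, Finset.card_union_of_disjoint, Finset.card_union_of_disjoint,
      Finset.card_union_of_disjoint, h.card_eq, hq₁, hq₂, hq₃]
    · omega
    · exact d1 hJ₂ hJ₃ hv₂₃
    · exact Finset.disjoint_union_right.2 ⟨d1 hJ₁ hJ₂ hv₁₂, d1 hJ₁ hJ₃ hv₁₃⟩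
    · exact Finset.disjoint_union_right.2 ⟨d0 hJ₁ hv₁, Finset.disjoint_union_right.2
        ⟨d0 hJ₂ hv₂, d0 hJ₃ hv₃⟩⟩
  · rw [hW', natCard_sup_span_singleton, natCard_sup_span_singleton hv₁, h.natCard]
    · ring
    · rw [mem_sup_span_singleton_char_two]
      rintro (hh | hh)
      · exact hv₂ hh
      · exact hv₁₂ (by rwa [add_comm])
  · intro z hz hzC
    have hzA : z ∉ A := fun hh => hzC ((hC' z).2 ⟨hh, hz⟩)
    rcases (hmem z).1 hz with hz | hz | hz | hz
    · obtain ⟨a, ha, b, hb, e⟩ := h.complete z hz (fun hh => hzC (hCC' hh))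
      exact ⟨a, hCC' ha, b, hCC' hb, e⟩
    · obtain ⟨a, ha, b, hb, e⟩ := h.exists_add_eq hA hC hv hv0 hJA₁ hJA₂ hJA₃ hq₁ hq₂ hq₃ hz hzA
      exact ⟨a, Finset.union_subset hCC' hJC'₂ ha, b, Finset.union_subset hJC'₁ hJC'₃ hb, e⟩
    · obtain ⟨a, ha, b, hb, e⟩ :=
        h.exists_add_eq hA hC hv213 hv213' hJA₂ hJA₁ hJA₃ hq₂ hq₁ hq₃ hz hzA
      exact ⟨a, Finset.union_subset hCC' hJC'₁ ha, b, Finset.union_subset hJC'₂ hJC'₃ hb, e⟩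
    · obtain ⟨a, ha, b, hb, e⟩ :=
        h.exists_add_eq hA hC hv312 hv312' hJA₃ hJA₁ hJA₂ hq₃ hq₁ hq₂ hz hzA
      exact ⟨a, Finset.union_subset hCC' hJC'₁ ha, b, Finset.union_subset hJC'₃ hJC'₂ hb, e⟩
  · intro I hI hIi
    have main : ∀ b, (∀ x ∈ I, x + b ∈ W') → q + 1 ≤ (I.filter (· + b ∈ W)).card →
        ∃ v, ∀ x ∈ I, x + v ∈ C' := by
      intro b hb hcard
      have hi0 : Indep W C (I.filter (· + b ∈ W)) :=
        hIi.restrict hCC' (b := b) fun x hx => Finset.mem_filter.1 hx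
      obtain ⟨v, hv'⟩ := h.large _ hcard hi0
      obtain ⟨hcard0, hfull⟩ := h.card_eq_of_large hcard hv'
      have hvb : v + b ∈ W := by
        obtain ⟨x, hx⟩ := Finset.card_pos.1 (lt_of_lt_of_le (Nat.succ_pos q) hcard)
        have h1 := h.sub _ (hv' x hx)
        have h2 := (Finset.mem_filter.1 hx).2
        exact add_mem_of_add_mem (by rwa [add_comm] at h1) (by rwa [add_comm] at h2)
      set K := I.image (· + v) with hK
      have hKi : Indep W' C' K := hIi.image_add v
      have hKc : K.card = I.card := card_image_add I v
      have hKW : ∀ x ∈ K, x ∈ W' := by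
        intro x hx
        obtain ⟨y, hy, rfl⟩ := Finset.mem_image.1 hx
        exact add_mem_of_add_mem (hb y hy) ((hmem _).2 (Or.inl hvb))
      have hK0 : ∀ x ∈ K, x ∈ W → x ∈ C := by
        intro x hx hxW
        obtain ⟨y, hy, rfl⟩ := Finset.mem_image.1 hx
        refine hv' y (Finset.mem_filter.2 ⟨hy, ?_⟩)
        have e : y + b = y + v + (v + b) := by grind [ZModModule.add_self v]
        exact e ▸ W.add_mem hxW hvb
      have hCK : ∀ c ∈ C, c ∈ K := fun c hc => Finset.mem_image.2
        ⟨c + v, (Finset.mem_filter.1 (hfull c hc)).1, add_add_cancel_char_two c v⟩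
      set I₁ := K.filter (· + v₁ ∈ W) with hI₁
      set I₂ := K.filter (· + v₂ ∈ W) with hI₂
      set I₃ := K.filter (· + v₃ ∈ W) with hI₃
      have hi : ∀ w, Indep W C (K.filter (· + w ∈ W)) := fun w =>
        hKi.restrict hCC' (b := w) fun x hx => Finset.mem_filter.1 hx
      have hIC : ∀ {J : Finset V} {w : V}, (∀ x ∈ J, x + w ∈ C) → J ⊆ C' → Indep W C J →
          q ≤ J.card → ∀ x ∈ K.filter (· + w ∈ W), x + w ∈ C := by
        intro J w hJ hJC' hJi hJq
        refine h.add_mem_of_indep_union hJ hJq (hJi.union (hi w) ?_)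
        intro x hx y hy
        refine ⟨add_mem_of_add_mem (h.sub _ (hJ x hx)) (Finset.mem_filter.1 hy).2, fun hc => ?_⟩
        have h1 := (hKi y (Finset.mem_filter.1 hy).1 _ (hCK _ hc)).2
        have e : y + (x + y) = x := by grind [ZModModule.add_self y]
        exact h1 (e.symm ▸ (hJC' hx : x ∈ C'))
      have hIC₁ : ∀ x ∈ I₁, x + v₁ ∈ C := hIC hJC₁ hJC'₁ hJi₁ hq₁.ge
      have hIC₂ : ∀ x ∈ I₂, x + v₂ ∈ C := hIC hJC₂ hJC'₂ hJi₂ hq₂.ge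
      have hIC₃ : ∀ x ∈ I₃, x + v₃ ∈ C := hIC hJC₃ hJC'₃ hJi₃ hq₃.ge
      have hIi₁ : Indep W C I₁ := hi v₁
      have hIi₂ : Indep W C I₂ := hi v₂
      have hIi₃ : Indep W C I₃ := hi v₃
      have hIK₁ : ∀ x ∈ I₁, x ∈ K := fun x hx => (Finset.mem_filter.1 hx).1
      have hIK₂ : ∀ x ∈ I₂, x ∈ K := fun x hx => (Finset.mem_filter.1 hx).1
      have hIK₃ : ∀ x ∈ I₃, x ∈ K := fun x hx => (Finset.mem_filter.1 hx).1
      have hsum : ∀ x ∈ K, ∀ y ∈ K, ∀ z ∈ C', x + y ≠ z := fun x hx y hy z hz e =>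
        (hKi x hx y hy).2 (e ▸ hz)
      have hsum' : ∀ x ∈ K, ∀ y ∈ K, ∀ z ∈ C', z + y ≠ x := fun x hx y hy z hz e =>
        hsum x hx y hy z hz (by grind [ZModModule.add_self y])
      have hsum'' : ∀ x ∈ K, ∀ y ∈ K, ∀ z ∈ C', y + z ≠ x := fun x hx y hy z hz e =>
        hsum' x hx y hy z hz (by rwa [add_comm])
      have c₁ := h.card_le hIC₁
      have c₂ := h.card_le hIC₂
      have c₃ := h.card_le hIC₃
      have hKsub : K ⊆ C ∪ (I₁ ∪ (I₂ ∪ I₃)) := by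
        intro x hx
        simp only [Finset.mem_union, hI₁, hI₂, hI₃, Finset.mem_filter]
        rcases (hmem x).1 (hKW x hx) with hh | hh | hh | hh
        · exact Or.inl (hK0 x hx hh)
        · exact Or.inr (Or.inl ⟨hx, hh⟩)
        · exact Or.inr (Or.inr (Or.inl ⟨hx, hh⟩))
        · exact Or.inr (Or.inr (Or.inr ⟨hx, hh⟩))
      have hKcard : 3 * q ≤ I₁.card + I₂.card + I₃.card := by
        have h1 := Finset.card_le_card hKsub
        have h2 := Finset.card_union_le C (I₁ ∪ (I₂ ∪ I₃))
        have h3 := Finset.card_union_le I₁ (I₂ ∪ I₃)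
        have h4 := Finset.card_union_le I₂ I₃
        have h5 := h.card_eq
        omega
      have f₁ : I₁.card ≤ q := by
        by_contra hlt
        have a₁ := h.card_add_two_le_of_full hv hv0 hIC₁ hIC₃ hJC₂ hIi₃ hJi₂ (by omega) hq₂
          fun x hx y hy z hz => hsum' x (hIK₁ x hx) z (hIK₃ z hz) y (hJC'₂ hy)
        have a₂ := h.card_add_two_le_of_full hv132 hv132' hIC₁ hIC₂ hJC₃ hIi₂ hJi₃ (by omega) hq₃
          fun x hx y hy z hz => hsum' x (hIK₁ x hx) z (hIK₂ z hz) y (hJC'₃ hy)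
        omega
      have f₂ : I₂.card ≤ q := by
        by_contra hlt
        have a₁ := h.card_add_two_le_of_full hv213 hv213' hIC₂ hIC₃ hJC₁ hIi₃ hJi₁ (by omega) hq₁
          fun x hx y hy z hz => hsum' x (hIK₂ x hx) z (hIK₃ z hz) y (hJC'₁ hy)
        omega
      have g₁ : I₁.card = q := by
        by_contra hlt
        have a₁ := h.card_add_two_le_of_full hv312 hv312' hIC₃ hIC₂ hJC₁ hIi₂ hJi₁ (by omega) hq₁
          fun x hx y hy z hz => hsum' x (hIK₃ x hx) z (hIK₂ z hz) y (hJC'₁ hy)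
        omega
      have f₃ : I₃.card ≤ q := by
        by_contra hlt
        have a₁ := h.card_add_two_le_of_full hv312 hv312' hIC₃ hIC₂ hJC₁ hIi₂ hJi₁ (by omega) hq₁
          fun x hx y hy z hz => hsum' x (hIK₃ x hx) z (hIK₂ z hz) y (hJC'₁ hy)
        omega
      have g₂ : I₂.card = q := by omega
      have g₃ : I₃.card = q := by omega
      have e₁ : I₁ = J₁ := h.eq_of_card_eq hv hv0 hIC₁ hIC₂ hIC₃ hJC₁ hJC₂ hIi₂ hIi₃ g₁ g₂ g₃ hq₁ hq₂
        (fun x hx y hy z hz => hsum'' x (hIK₁ x hx) z (hIK₃ z hz) y (hJC'₂ hy))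
        (fun x hx y hy z hz => hsum z (hIK₃ z hz) y (hIK₂ y hy) x (hJC'₁ hx))
      have e₂ : I₂ = J₂ := h.eq_of_card_eq hv213 hv213' hIC₂ hIC₁ hIC₃ hJC₂ hJC₁ hIi₁ hIi₃ g₂ g₁ g₃
        hq₂ hq₁
        (fun x hx y hy z hz => hsum'' x (hIK₂ x hx) z (hIK₃ z hz) y (hJC'₁ hy))
        (fun x hx y hy z hz => hsum z (hIK₃ z hz) y (hIK₁ y hy) x (hJC'₂ hx))
      have e₃ : I₃ = J₃ := h.eq_of_card_eq hv312 hv312' hIC₃ hIC₁ hIC₂ hJC₃ hJC₁ hIi₁ hIi₂ g₃ g₁ g₂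
        hq₃ hq₁
        (fun x hx y hy z hz => hsum'' x (hIK₃ x hx) z (hIK₂ z hz) y (hJC'₁ hy))
        (fun x hx y hy z hz => hsum z (hIK₂ z hz) y (hIK₁ y hy) x (hJC'₃ hx))
      refine ⟨v, fun x hx => ?_⟩
      have hx' := hKsub (Finset.mem_image_of_mem _ hx)
      rw [e₁, e₂, e₃] at hx'
      exact Finset.union_subset hCC' (Finset.union_subset hJC'₁
        (Finset.union_subset hJC'₂ hJC'₃)) hx'
    obtain ⟨b, hb⟩ : I.Nonempty := Finset.card_pos.1 (by omega)
    have hbW : ∀ x ∈ I, x + b ∈ W' := fun x hx => (hIi x hx b hb).1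
    have hvW : ∀ v, v = 0 ∨ v = v₁ ∨ v = v₂ ∨ v = v₃ → v ∈ W' := by
      intro v hv'
      rw [hmem]
      rcases hv' with rfl | rfl | rfl | rfl
      · exact Or.inl W.zero_mem
      all_goals simp [ZModModule.add_self]
    have hbW' : ∀ v, v = 0 ∨ v = v₁ ∨ v = v₂ ∨ v = v₃ → ∀ x ∈ I, x + (b + v) ∈ W' :=
      fun v hv' x hx => by rw [← add_assoc]; exact W'.add_mem (hbW x hx) (hvW v hv')
    by_contra hcon
    have hlt : ∀ v, v = 0 ∨ v = v₁ ∨ v = v₂ ∨ v = v₃ →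
        (I.filter (· + (b + v) ∈ W)).card ≤ q := by
      intro v hv'
      by_contra hlt
      exact hcon (main _ (hbW' v hv') (by omega))
    have hsub : I ⊆ I.filter (· + (b + 0) ∈ W) ∪ (I.filter (· + (b + v₁) ∈ W) ∪
        (I.filter (· + (b + v₂) ∈ W) ∪ I.filter (· + (b + v₃) ∈ W))) := by
      intro x hx
      simp only [Finset.mem_union, Finset.mem_filter, ← add_assoc, add_zero, hx, true_and]
      exact (hmem _).1 (hbW x hx)
    have h1 := Finset.card_le_card hsub
    have h2 := Finset.card_union_le (I.filter (· + (b + 0) ∈ W)) (I.filter (· + (b + v₁) ∈ W) ∪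
        (I.filter (· + (b + v₂) ∈ W) ∪ I.filter (· + (b + v₃) ∈ W)))
    have h3 := Finset.card_union_le (I.filter (· + (b + v₁) ∈ W))
        (I.filter (· + (b + v₂) ∈ W) ∪ I.filter (· + (b + v₃) ∈ W))
    have h4 := Finset.card_union_le (I.filter (· + (b + v₂) ∈ W)) (I.filter (· + (b + v₃) ∈ W))
    have l0 := hlt 0 (by simp)
    have l1 := hlt v₁ (by simp)
    have l2 := hlt v₂ (by simp)
    have l3 := hlt v₃ (by simp)
    omega

theorem card_filter_le_of_add_mem {T : Finset V} (hT : ∀ x ∈ T, ∀ y ∈ T, x + y ∈ T) {b : V}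
    (hb : b ∈ T) {P Q : V → Prop} [DecidablePred P] [DecidablePred Q]
    (h : ∀ x ∈ T, P x → Q (x + b)) : (T.filter P).card ≤ (T.filter Q).card := by
  rw [← card_image_add (T.filter P) b]
  apply Finset.card_le_card
  intro y hy
  obtain ⟨x, hx, rfl⟩ := Finset.mem_image.1 hy
  obtain ⟨hx, hP⟩ := Finset.mem_filter.1 hx
  exact Finset.mem_filter.2 ⟨hT x hx b hb, h x hx hP⟩

theorem card_filter_le_add {T : Finset V} {P Q R : V → Prop} [DecidablePred P] [DecidablePred Q]
    [DecidablePred R] (h : ∀ x ∈ T, P x → Q x ∨ R x) :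
    (T.filter P).card ≤ (T.filter Q).card + (T.filter R).card := by
  refine le_trans (Finset.card_le_card ?_) (Finset.card_union_le _ _)
  intro x hx
  obtain ⟨hx, hP⟩ := Finset.mem_filter.1 hx
  rw [Finset.mem_union, Finset.mem_filter, Finset.mem_filter]
  exact (h x hx hP).imp (fun hh => ⟨hx, hh⟩) (fun hh => ⟨hx, hh⟩)

theorem good_add_of_sums {T : Finset V} (hT : ∀ x ∈ T, ∀ y ∈ T, x + y ∈ T)
    {W : Submodule (ZMod 2) V} {Good : V → Prop} {cnt : V → ℕ} {q : ℕ} {k : V}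
    (hle : ∀ v, cnt v ≤ q + 1) (hcoset : ∀ v w, v + w ∈ W → cnt v = cnt w)
    (hadd : ∀ v w, Good v → q + 1 ≤ cnt v → Good w → q ≤ cnt w → Good (v + w))
    (huniq : ∀ v w, v + w ∈ W → Good v → Good w → q ≤ cnt v + 1 → v = w)
    (hex : ∀ v, q ≤ cnt v → ∃ w, v + w ∈ W ∧ Good w) (hTg : ∀ x ∈ T, Good x) (hk : Good k)
    (hkc : q + 1 ≤ cnt k) (hf : q * T.card + 1 ≤ ∑ x ∈ T, cnt x)
    (hfg : 2 * (q * T.card) + 1 ≤ ∑ x ∈ T, cnt x + ∑ x ∈ T, cnt (x + k)) :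
    ∀ x ∈ T, Good (x + k) := by
  classical
  by_contra hcon
  push Not at hcon
  obtain ⟨b, hbT, hb⟩ := hcon
  have hbad : ∀ x ∈ T, ¬ Good (x + k) ∧ q ≤ cnt (x + k) → cnt x + 2 ≤ q := by
    rintro x hx ⟨hxk, hq⟩
    obtain ⟨w, hw, hwg⟩ := hex _ hq
    by_contra hlt
    have h1 : Good (k + w) := hadd k w hk hkc hwg (hcoset _ _ hw ▸ hq)
    have h2 : x = k + w := huniq x (k + w) (by rwa [← add_assoc]) (hTg x hx) h1 (by omega)
    apply hxk
    have e : x + k = w := by grind [ZModModule.add_self k]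
    rwa [e]
  by_cases hcase : ∀ x ∈ T, cnt (x + k) = q + 1 → Good (x + k)
  · have hO₁ : (T.filter (cnt · = q + 1)).card ≤
        (T.filter (fun x => (¬ Good (x + k) ∧ q ≤ cnt (x + k)) ∨ cnt (x + k) + 1 ≤ q)).card := by
      refine card_filter_le_of_add_mem hT hbT fun x hx hxc => ?_
      by_contra hcon
      push Not at hcon
      have h1 : Good (x + b + k) := by
        by_contra hh
        have := hcon.1 hh
        omega
      refine hb ?_
      have e : b + k = x + (x + b + k) := by grind [ZModModule.add_self x]
      rw [e]
      exact hadd _ _ (hTg x hx) hxc.ge h1 (by omega)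
    have hO₂ : (T.filter (fun x => cnt (x + k) = q + 1)).card ≤
        (T.filter (fun x => cnt x + 1 ≤ q)).card := by
      refine card_filter_le_of_add_mem hT hbT fun x hx hxc => ?_
      by_contra hlt
      refine hb ?_
      have e : b + k = x + k + (x + b) := by grind [ZModModule.add_self x]
      rw [e]
      exact hadd _ _ (hcase x hx hxc) hxc.ge (hTg _ (hT x hx b hbT)) (by omega)
    have hO₁' := card_filter_le_add (T := T)
      (P := fun x => (¬ Good (x + k) ∧ q ≤ cnt (x + k)) ∨ cnt (x + k) + 1 ≤ q)
      (Q := fun x => cnt x + 2 ≤ q) (R := fun x => cnt (x + k) + 1 ≤ q)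
      (fun x hx hh => hh.imp_left (hbad x hx))
    have s : ∑ x ∈ T, (cnt x + cnt (x + k) + (if cnt x + 1 ≤ q then 1 else 0) +
        (if cnt x + 2 ≤ q then 1 else 0) + (if cnt (x + k) + 1 ≤ q then 1 else 0)) ≤
        ∑ x ∈ T, (2 * q + (if cnt x = q + 1 then 1 else 0) +
          (if cnt (x + k) = q + 1 then 1 else 0)) := by
      refine Finset.sum_le_sum fun x _ => ?_
      have h1 := hle x
      have h2 := hle (x + k)
      split_ifs <;> omega
    simp only [Finset.sum_add_distrib, ← Finset.card_filter, Finset.sum_const, smul_eq_mul] at s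
    have e : T.card * (2 * q) = 2 * (q * T.card) := by ring
    omega
  · push Not at hcase
    obtain ⟨o, hoT, hoq, hog⟩ := hcase
    obtain ⟨v, hv, hvg⟩ := hex (o + k) (by omega)
    have hvq : q + 1 ≤ cnt v := (hcoset _ _ hv ▸ hoq).ge
    set y := o + k + v with hy
    have hvy : v = o + k + y := by rw [hy]; grind [ZModModule.add_self (o + k)]
    have hy0 : y ≠ 0 := by
      intro h0
      rw [h0, add_zero] at hvy
      exact hog (hvy ▸ hvg)
    have huniq' : ∀ z, Good z → Good (z + y) → cnt z + 2 ≤ q := by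
      intro z hz hzy
      by_contra hlt
      have h1 := huniq z (z + y) (by
        rw [← add_assoc, ZModModule.add_self, zero_add]; exact hv) hz hzy (by omega)
      exact hy0 (by simpa using h1)
    have a₁ := card_filter_le_add (T := T) (P := fun x => cnt x = q + 1)
      (Q := fun x => q ≤ cnt (x + k) ∧ Good (x + k))
      (R := fun x => cnt (x + k) + 1 ≤ q ∧ Good (x + k)) (by
        intro x hx hxc
        have h1 : Good (x + k) := hadd _ _ (hTg x hx) hxc.ge hk (by omega)
        by_cases h2 : q ≤ cnt (x + k)
        · exact Or.inl ⟨h2, h1⟩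
        · exact Or.inr ⟨by omega, h1⟩)
    have a₂ : (T.filter (fun x => cnt x = q + 1)).card ≤
        (T.filter (fun x => (q ≤ cnt (x + k) ∧ ¬ Good (x + k)) ∨
          (cnt (x + k) + 1 ≤ q ∧ Good (x + k + y)))).card := by
      refine card_filter_le_of_add_mem hT hoT fun x hx hxc => ?_
      have h1 : Good (x + v) := hadd _ _ (hTg x hx) hxc.ge hvg (by omega)
      have e : x + v = x + o + k + y := by rw [hvy]; simp only [add_assoc]
      rw [e] at h1
      by_cases h2 : q ≤ cnt (x + o + k)
      · refine Or.inl ⟨h2, fun h3 => ?_⟩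
        have := huniq' _ h3 h1
        omega
      · exact Or.inr ⟨by omega, h1⟩
    have a₃ := card_filter_le_add (T := T)
      (P := fun x => (q ≤ cnt (x + k) ∧ ¬ Good (x + k)) ∨
          (cnt (x + k) + 1 ≤ q ∧ Good (x + k + y)))
      (Q := fun x => q ≤ cnt (x + k) ∧ ¬ Good (x + k))
      (R := fun x => cnt (x + k) + 1 ≤ q ∧ Good (x + k + y)) (fun _ _ hh => hh)
    have a₄ : (T.filter (fun x => q ≤ cnt (x + k) ∧ Good (x + k))).card ≤
        (T.filter (fun x => cnt x + 2 ≤ q)).card := by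
      refine card_filter_le_of_add_mem hT hoT fun x hx hxc => ?_
      have h1 := hadd _ _ hvg hvq hxc.2 hxc.1
      have e : v + (x + k) = x + o + y := by
        rw [hvy]; grind [ZModModule.add_self k]
      exact huniq' _ (hTg _ (hT x hx o hoT)) (e ▸ h1)
    have a₅ : (T.filter (fun x => q ≤ cnt (x + k) ∧ ¬ Good (x + k))).card ≤
        (T.filter (fun x => cnt x + 2 ≤ q)).card := by
      refine Finset.card_le_card fun x hx => ?_
      obtain ⟨hx, hx'⟩ := Finset.mem_filter.1 hx
      exact Finset.mem_filter.2 ⟨hx, hbad x hx hx'.symm⟩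
    have a₆ := card_filter_le_add (T := T) (P := fun x => cnt (x + k) = q + 1)
      (Q := fun x => q ≤ cnt (x + k) ∧ Good (x + k))
      (R := fun x => q ≤ cnt (x + k) ∧ ¬ Good (x + k)) (by
        intro x hx hxc
        by_cases h1 : Good (x + k)
        · exact Or.inl ⟨by omega, h1⟩
        · exact Or.inr ⟨by omega, h1⟩)
    have s₁ : ∑ x ∈ T, (cnt x + 2 * (if cnt x + 2 ≤ q then 1 else 0)) ≤
        ∑ x ∈ T, (q + (if cnt x = q + 1 then 1 else 0)) := by
      refine Finset.sum_le_sum fun x _ => ?_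
      have h1 := hle x
      split_ifs <;> omega
    have s₂ : ∑ x ∈ T, (cnt (x + k) + (if cnt (x + k) + 1 ≤ q ∧ Good (x + k) then 1 else 0) +
          (if cnt (x + k) + 1 ≤ q ∧ Good (x + k + y) then 1 else 0)) ≤
        ∑ x ∈ T, (q + (if cnt (x + k) = q + 1 then 1 else 0)) := by
      refine Finset.sum_le_sum fun x _ => ?_
      have h1 := hle (x + k)
      by_cases h2 : Good (x + k) ∧ Good (x + k + y)
      · have := huniq' _ h2.1 h2.2
        simp only [h2.1, h2.2, and_true]
        split_ifs <;> omega
      · split_ifs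
        all_goals first | omega | (exfalso; tauto)
    simp only [Finset.sum_add_distrib, ← Finset.mul_sum, ← Finset.card_filter, Finset.sum_const,
      smul_eq_mul] at s₁ s₂
    rw [mul_comm T.card q] at s₁ s₂
    omega

open Classical in
/-- The elements of `A` in the coset of `v` modulo `W`. -/
noncomputable def cosetPart (A : Finset V) (W : Submodule (ZMod 2) V) (v : V) : Finset V :=
  A.filter (· + v ∈ W)

theorem mem_cosetPart {A : Finset V} {W : Submodule (ZMod 2) V} {v x : V} :
    x ∈ cosetPart A W v ↔ x ∈ A ∧ x + v ∈ W := by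
  simp [cosetPart]

theorem cosetPart_eq {A : Finset V} {W : Submodule (ZMod 2) V} {v w : V} (h : v + w ∈ W) :
    cosetPart A W v = cosetPart A W w := by
  ext x
  rw [mem_cosetPart, mem_cosetPart]
  have e : x + v = (x + w) + (v + w) := by grind [ZModModule.add_self w]
  rw [e, W.add_mem_iff_left h]

theorem indep_cosetPart {A C : Finset V} {W : Submodule (ZMod 2) V} (hA : SumFree A)
    (hC : ∀ x, x ∈ C ↔ x ∈ A ∧ x ∈ W) (v : V) : Indep W C (cosetPart A W v) :=
  indep_of_add_mem hA hC fun _ hx => mem_cosetPart.1 hx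

/-- `v` is good if translation by `v` carries the coset part of `A` at `v` into `C`. -/
def Good (A C : Finset V) (W : Submodule (ZMod 2) V) (v : V) : Prop :=
  ∀ x ∈ cosetPart A W v, x + v ∈ C

theorem Crit.card_cosetPart_le {A C : Finset V} {W : Submodule (ZMod 2) V} {q : ℕ}
    (hA : SumFree A) (h : Crit W C q) (hC : ∀ x, x ∈ C ↔ x ∈ A ∧ x ∈ W) (v : V) :
    (cosetPart A W v).card ≤ q + 1 := by
  by_contra hlt
  obtain ⟨w, hw⟩ := h.large _ (by omega) (indep_cosetPart hA hC v)
  exact hlt (h.card_le hw)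

theorem Crit.good_add {A C : Finset V} {W : Submodule (ZMod 2) V} {q : ℕ} (hA : SumFree A)
    (h : Crit W C q) (hC : ∀ x, x ∈ C ↔ x ∈ A ∧ x ∈ W) {p y : V} (hp : Good A C W p)
    (hpq : q + 1 ≤ (cosetPart A W p).card) (hy : Good A C W y)
    (hyq : q ≤ (cosetPart A W y).card) : Good A C W (p + y) := by
  refine h.add_mem_of_indep_union (Y := (cosetPart A W y).image (· + p)) ?_
    (by rwa [card_image_add]) ?_
  · intro z hz
    obtain ⟨x, hx, rfl⟩ := Finset.mem_image.1 hz
    rw [← add_assoc, add_add_cancel_char_two]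
    exact hy x hx
  · refine ((indep_cosetPart hA hC y).image_add p).union (indep_cosetPart hA hC _) ?_
    intro z hz r hr
    obtain ⟨x, hx, rfl⟩ := Finset.mem_image.1 hz
    obtain ⟨hxA, hxW⟩ := mem_cosetPart.1 hx
    obtain ⟨hrA, hrW⟩ := mem_cosetPart.1 hr
    constructor
    · have e : x + p + r = (x + y) + (r + (p + y)) := by grind [ZModModule.add_self y]
      exact e ▸ W.add_mem hxW hrW
    · intro hc
      have h1 := (mem_cosetPart.1 ((h.card_eq_of_large hpq hp).2 _ hc)).1
      have e : x + p + r + p = x + r := by grind [ZModModule.add_self p]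
      exact hA x hxA r hrA (e ▸ h1)

theorem Crit.exists_good [Fintype V] {A C : Finset V} {W : Submodule (ZMod 2) V} {q : ℕ}
    (hA : SumFree A) (h : Crit W C q) (hC : ∀ x, x ∈ C ↔ x ∈ A ∧ x ∈ W)
    (hmax : ∀ (W' : Submodule (ZMod 2) V) (C' : Finset V) (q' : ℕ), W < W' →
      (∀ x, x ∈ C' ↔ x ∈ A ∧ x ∈ W') → ¬ Crit W' C' q') {v : V}
    (hv : q ≤ (cosetPart A W v).card) : ∃ w, v + w ∈ W ∧ Good A C W w := by
  obtain ⟨w, hw⟩ : ∃ w, ∀ x ∈ cosetPart A W v, x + w ∈ C := by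
    by_cases hq : q + 1 ≤ (cosetPart A W v).card
    · exact h.large _ hq (indep_cosetPart hA hC v)
    by_cases hvW : v ∈ W
    · refine ⟨0, fun x hx => ?_⟩
      rw [mem_cosetPart, W.add_mem_iff_left hvW] at hx
      rw [add_zero]
      exact (hC x).2 hx
    · by_contra hcon
      classical
      have hmem : ∀ x, x ∈ A.filter (· ∈ W ⊔ Submodule.span (ZMod 2) {v}) ↔
          x ∈ A ∧ x ∈ W ⊔ Submodule.span (ZMod 2) {v} := fun x => by simp
      refine hmax _ _ (2 * q) ?_ hmem
        (h.sup_span_singleton hA hC hvW (fun x => mem_cosetPart) (by omega) hcon hmem)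
      refine lt_of_le_of_ne le_sup_left fun e => hvW ?_
      rw [e]
      exact Submodule.mem_sup_right (Submodule.mem_span_singleton_self v)
  obtain ⟨x, hx⟩ := Finset.card_pos.1 (lt_of_lt_of_le h.pos hv)
  have hvw : v + w ∈ W := by
    have h1 := h.sub _ (hw x hx)
    have h2 := (mem_cosetPart.1 hx).2
    rw [add_comm] at h1 h2
    exact add_mem_of_add_mem h2 h1
  exact ⟨w, hvw, fun y hy => hw y (cosetPart_eq hvw ▸ hy)⟩

theorem Crit.good_unique {A C : Finset V} {W : Submodule (ZMod 2) V} {q : ℕ} (h : Crit W C q)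
    {v w : V} (hvw : v + w ∈ W) (hv : Good A C W v) (hw : Good A C W w)
    (hq : q ≤ (cosetPart A W v).card + 1) : v = w :=
  h.translate_unique hv (fun x hx => hw x (cosetPart_eq hvw ▸ hx)) hq

/-- `K` is a complement of `W` inside `U`. -/
structure IsComplIn (W K U : Submodule (ZMod 2) V) : Prop where
  le_left : W ≤ U
  le : K ≤ U
  exists_add : ∀ x ∈ U, ∃ k ∈ K, x + k ∈ W
  eq_zero : ∀ x ∈ W, x ∈ K → x = 0

theorem exists_isComplIn {W U : Submodule (ZMod 2) V} (h : W ≤ U) : ∃ K, IsComplIn W K U := by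
  obtain ⟨K, hK⟩ := Submodule.exists_isCompl W
  refine ⟨K ⊓ U, h, inf_le_right, fun x hx => ?_, fun x hx hx' => ?_⟩
  · have h1 : x ∈ W ⊔ K := by rw [hK.sup_eq_top]; exact Submodule.mem_top
    obtain ⟨w, hw, k, hk, rfl⟩ := Submodule.mem_sup.1 h1
    refine ⟨k, ⟨hk, (U.add_mem_iff_right (h hw)).1 hx⟩, ?_⟩
    rwa [add_add_cancel_char_two]
  · have h1 : x ∈ W ⊓ K := ⟨hx, hx'.1⟩
    rw [hK.inf_eq_bot] at h1
    exact (Submodule.mem_bot _).1 h1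

theorem IsComplIn.sum_card_cosetPart {W K U : Submodule (ZMod 2) V} (h : IsComplIn W K U)
    {T : Finset V} (hT : ∀ x, x ∈ T ↔ x ∈ K) (A : Finset V) (v : V) :
    ∑ x ∈ T, (cosetPart A W (x + v)).card = (cosetPart A U v).card := by
  have h1 : cosetPart A U v = T.biUnion fun x => cosetPart A W (x + v) := by
    ext a
    simp only [Finset.mem_biUnion, mem_cosetPart]
    constructor
    · rintro ⟨ha, hav⟩
      obtain ⟨k, hk, hak⟩ := h.exists_add _ hav
      refine ⟨k, (hT k).2 hk, ha, ?_⟩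
      rwa [add_comm k, ← add_assoc]
    · rintro ⟨k, hk, ha, hak⟩
      refine ⟨ha, (U.add_mem_iff_left (h.le ((hT k).1 hk))).1 ?_⟩
      rw [add_assoc, add_comm v]
      exact h.le_left hak
  rw [h1, Finset.card_biUnion]
  intro x hx y hy hxy
  refine disjoint_of_add_notMem (fun a ha => (mem_cosetPart.1 ha).2)
    (fun a ha => (mem_cosetPart.1 ha).2) fun hW => hxy ?_
  have e : x + v + (y + v) = x + y := by grind [ZModModule.add_self v]
  have h2 := h.eq_zero _ (e ▸ hW) (K.add_mem ((hT x).1 hx) ((hT y).1 hy))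
  grind [ZModModule.add_self y]

theorem card_cosetPart_univ [Fintype V] (W : Submodule (ZMod 2) V) (v : V) :
    (cosetPart Finset.univ W v).card = Nat.card W := by
  classical
  rw [natCard_eq_card_filter, ← card_image_add (Finset.univ.filter (· ∈ W)) v]
  congr 1
  ext x
  simp only [mem_cosetPart, Finset.mem_univ, true_and, Finset.mem_image, Finset.mem_filter]
  constructor
  · intro hx
    exact ⟨x + v, hx, add_add_cancel_char_two x v⟩
  · rintro ⟨y, hy, rfl⟩
    rwa [add_add_cancel_char_two]

theorem IsComplIn.natCard [Fintype V] {W K U : Submodule (ZMod 2) V} (h : IsComplIn W K U)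
    {T : Finset V} (hT : ∀ x, x ∈ T ↔ x ∈ K) : Nat.card U = T.card * Nat.card W := by
  have h1 := h.sum_card_cosetPart hT Finset.univ 0
  simp only [card_cosetPart_univ, Finset.sum_const, smul_eq_mul] at h1
  exact h1.symm

theorem card_cosetPart_sup {L : Submodule (ZMod 2) V} {t : V} (ht : t ∉ L) (A : Finset V) (v : V) :
    (cosetPart A (L ⊔ Submodule.span (ZMod 2) {t}) v).card =
      (cosetPart A L v).card + (cosetPart A L (v + t)).card := by
  rw [← Finset.card_union_of_disjoint]
  · congr 1
    ext x
    rw [Finset.mem_union, mem_cosetPart, mem_cosetPart, mem_cosetPart,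
      mem_sup_span_singleton_char_two, and_or_left, add_assoc]
  · refine disjoint_of_add_notMem (fun a ha => (mem_cosetPart.1 ha).2)
      (fun a ha => (mem_cosetPart.1 ha).2) fun hW => ht ?_
    rwa [← add_assoc, ZModModule.add_self, zero_add] at hW

theorem lt_sup_span_singleton {L : Submodule (ZMod 2) V} {t : V} (ht : t ∉ L) :
    L < L ⊔ Submodule.span (ZMod 2) {t} :=
  lt_of_le_of_ne le_sup_left fun e => ht (by
    rw [e]; exact Submodule.mem_sup_right (Submodule.mem_span_singleton_self t))

/-- A hyperplane of `U` avoiding `k` which contains at least half of `A ∩ U`. -/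
theorem exists_hyperplane [Finite V] {A : Finset V} {W U : Submodule (ZMod 2) V} {k : V}
    (hWU : W ≤ U) (hkU : k ∈ U) (hkW : k ∉ W)
    (hWk : (cosetPart A W k).card ≤ (cosetPart A W 0).card) :
    ∃ L : Submodule (ZMod 2) V, W ≤ L ∧ k ∉ L ∧ U = L ⊔ Submodule.span (ZMod 2) {k} ∧
      (cosetPart A L k).card ≤ (cosetPart A L 0).card := by
  obtain ⟨L, hWL, hL⟩ := (Set.toFinite {L : Submodule (ZMod 2) V | L ≤ U ∧ k ∉ L ∧
    (cosetPart A L k).card ≤ (cosetPart A L 0).card}).exists_le_maximal ⟨hWU, hkW, hWk⟩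
  obtain ⟨hLU, hkL, hLc⟩ := hL.prop
  refine ⟨L, hWL, hkL, ?_, hLc⟩
  refine le_antisymm (fun u hu => ?_) (sup_le hLU (by simpa using hkU))
  by_contra huk
  rw [mem_sup_span_singleton_char_two, not_or] at huk
  have key : ∀ t ∈ U, t ∉ L → t + k ∉ L →
      ¬ (cosetPart A L (t + k)).card ≤ (cosetPart A L t).card := by
    intro t ht htL htk hle
    have hlt := lt_sup_span_singleton htL
    refine hlt.not_ge (hL.le_of_ge ⟨sup_le hLU (by simpa using ht), ?_, ?_⟩ hlt.le)
    · rw [mem_sup_span_singleton_char_two, not_or, add_comm]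
      exact ⟨hkL, htk⟩
    · rw [card_cosetPart_sup htL, card_cosetPart_sup htL, zero_add, add_comm k]
      omega
  rcases le_total (cosetPart A L (u + k)).card (cosetPart A L u).card with hle | hle
  · exact key u hu huk.1 huk.2 hle
  · exact key (u + k) (U.add_mem hu hkU) huk.2
      (by rw [add_add_cancel_char_two]; exact huk.1)
      (by rwa [add_add_cancel_char_two])

theorem cosetPart_eq_of_mem {A C : Finset V} {W : Submodule (ZMod 2) V}
    (hC : ∀ x, x ∈ C ↔ x ∈ A ∧ x ∈ W) {v : V} (hv : v ∈ W) : cosetPart A W v = C := by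
  ext x
  rw [mem_cosetPart, W.add_mem_iff_left hv, hC]

theorem good_zero {A C : Finset V} {W : Submodule (ZMod 2) V}
    (hC : ∀ x, x ∈ C ↔ x ∈ A ∧ x ∈ W) : Good A C W 0 := by
  intro x hx
  rw [cosetPart_eq_of_mem hC W.zero_mem] at hx
  rwa [add_zero]

theorem Crit.card_cosetPart_eq [Fintype V] {A C : Finset V} {W U : Submodule (ZMod 2) V} {q : ℕ}
    (h : Crit W C q) (hC : ∀ x, x ∈ C ↔ x ∈ A ∧ x ∈ W) (hWU : W ≤ U)
    (hU : Nat.card U + 4 ≤ 4 * (cosetPart A U 0).card)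
    (hle : ∀ t ∈ U, t ∉ W → (cosetPart A W t).card ≤ q) :
    ∀ t ∈ U, t ∉ W → (cosetPart A W t).card = q := by
  classical
  intro t htU htW
  refine le_antisymm (hle t htU htW) ?_
  by_contra hlt
  obtain ⟨K, hK⟩ := exists_isComplIn hWU
  set T : Finset V := Finset.univ.filter (· ∈ K)
  have hT : ∀ x, x ∈ T ↔ x ∈ K := fun x => by simp [T]
  have h1 := hK.sum_card_cosetPart hT A 0
  have h2 := hK.natCard hT
  rw [h.natCard] at h2
  obtain ⟨k, hk, htk⟩ := hK.exists_add t htU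
  have h3 : ∑ x ∈ T, (cosetPart A W (x + 0)).card < ∑ x ∈ T, (q + if x = 0 then 1 else 0) := by
    refine Finset.sum_lt_sum (fun x hx => ?_) ⟨k, (hT k).2 hk, ?_⟩
    · rw [add_zero]
      split_ifs with hx0
      · rw [hx0, cosetPart_eq_of_mem hC W.zero_mem, h.card_eq]
      · exact hle x (hK.le ((hT x).1 hx)) fun hxW => hx0 (hK.eq_zero x hxW ((hT x).1 hx))
    · rw [add_zero, ← cosetPart_eq htk]
      exact lt_of_lt_of_le (not_le.1 hlt) (Nat.le_add_right _ _)
  rw [h1, Finset.sum_add_distrib, Finset.sum_ite_eq' T 0, if_pos ((hT 0).2 K.zero_mem),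
    Finset.sum_const, smul_eq_mul] at h3
  have e : T.card * (4 * q) = 4 * (T.card * q) := by ring
  omega

theorem Crit.exists_good_compl_of_le [Fintype V] {A C : Finset V} {W U : Submodule (ZMod 2) V}
    {q : ℕ} (hA : SumFree A) (h : Crit W C q) (hC : ∀ x, x ∈ C ↔ x ∈ A ∧ x ∈ W)
    (hmax : ∀ (W' : Submodule (ZMod 2) V) (C' : Finset V) (q' : ℕ), W < W' →
      (∀ x, x ∈ C' ↔ x ∈ A ∧ x ∈ W') → ¬ Crit W' C' q') (hWU : W ≤ U)
    (hU : Nat.card U + 4 ≤ 4 * (cosetPart A U 0).card)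
    (hle : ∀ t ∈ U, t ∉ W → (cosetPart A W t).card ≤ q) :
    ∃ K, IsComplIn W K U ∧ ∀ x ∈ K, Good A C W x := by
  classical
  have hq := h.card_cosetPart_eq hC hWU hU hle
  have hq' : ∀ t ∈ U, q ≤ (cosetPart A W t).card := by
    intro t ht
    by_cases htW : t ∈ W
    · rw [cosetPart_eq_of_mem hC htW, h.card_eq]; omega
    · exact (hq t ht htW).ge
  have h0 : ∀ x ∈ W, Good A C W x → x = 0 := fun x hx hxg =>
    h.good_unique (by rwa [add_zero]) hxg (good_zero hC)
      (by rw [cosetPart_eq_of_mem hC hx, h.card_eq]; omega)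
  have hadd : ∀ x ∈ U, Good A C W x → ∀ y ∈ U, Good A C W y → Good A C W (x + y) := by
    intro x hx hxg y hy hyg
    by_cases hxy : x + y ∈ W
    · rw [h.good_unique hxy hxg hyg (by have := hq' x hx; omega), ZModModule.add_self]
      exact good_zero hC
    by_cases hxW : x ∈ W
    · rwa [h0 x hxW hxg, zero_add]
    by_cases hyW : y ∈ W
    · rwa [h0 y hyW hyg, add_zero]
    obtain ⟨z, hz, hzg⟩ := h.exists_good hA hC hmax (hq' _ (U.add_mem hx hy))
    by_cases hz0 : x + y + z = 0
    · have e : x + y = z := by grind [ZModModule.add_self z]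
      rwa [e]
    exfalso
    have hzU : z ∈ U := (U.add_mem_iff_right (U.add_mem hx hy)).1 (hWU hz)
    have hzW : z ∉ W := fun hh => hxy ((W.add_mem_iff_left hh).1 hz)
    have hmem : ∀ v, v ∈ A.filter
        (· ∈ W ⊔ Submodule.span (ZMod 2) {x} ⊔ Submodule.span (ZMod 2) {y}) ↔ v ∈ A ∧
        v ∈ W ⊔ Submodule.span (ZMod 2) {x} ⊔ Submodule.span (ZMod 2) {y} := fun v => by simp
    exact hmax _ _ (4 * q) ((lt_sup_span_singleton hxW).trans_le le_sup_left) hmem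
      (h.sup_span_pair hA hC hxW hyW hxy hz hz0 (fun _ => mem_cosetPart) (fun _ => mem_cosetPart)
        (fun _ => mem_cosetPart) hxg hyg hzg (hq x hx hxW) (hq y hy hyW) (hq z hzU hzW) hmem)
  let K : Submodule (ZMod 2) V :=
    { carrier := {x | x ∈ U ∧ Good A C W x}
      add_mem' := fun {x y} hx hy => ⟨U.add_mem hx.1 hy.1, hadd x hx.1 hx.2 y hy.1 hy.2⟩
      zero_mem' := ⟨U.zero_mem, good_zero hC⟩
      smul_mem' := by
        intro a x hx
        have : ∀ a : ZMod 2, a = 0 ∨ a = 1 := by decide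
        rcases this a with rfl | rfl
        · rw [zero_smul]; exact ⟨U.zero_mem, good_zero hC⟩
        · rwa [one_smul] }
  refine ⟨K, ⟨hWU, fun x hx => hx.1, fun x hx => ?_, fun x hx hxK => h0 x hx hxK.2⟩,
    fun x hx => hx.2⟩
  obtain ⟨w, hw, hwg⟩ := h.exists_good hA hC hmax (hq' x hx)
  exact ⟨w, ⟨(U.add_mem_iff_right hx).1 (hWU hw), hwg⟩, hw⟩

theorem Crit.exists_good_compl [Fintype V] {A C : Finset V} {W : Submodule (ZMod 2) V}
    {q : ℕ} (hA : SumFree A) (h : Crit W C q) (hC : ∀ x, x ∈ C ↔ x ∈ A ∧ x ∈ W)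
    (hmax : ∀ (W' : Submodule (ZMod 2) V) (C' : Finset V) (q' : ℕ), W < W' →
      (∀ x, x ∈ C' ↔ x ∈ A ∧ x ∈ W') → ¬ Crit W' C' q') (n : ℕ) :
    ∀ U : Submodule (ZMod 2) V, Nat.card U ≤ n → W ≤ U →
      Nat.card U + 4 ≤ 4 * (cosetPart A U 0).card →
      ∃ K, IsComplIn W K U ∧ ∀ x ∈ K, Good A C W x := by
  classical
  induction n with
  | zero =>
    intro U hUn
    have := Nat.card_pos (α := U)
    omega
  | succ n ih =>
    intro U hUn hWU hU
    by_cases hle : ∀ t ∈ U, t ∉ W → (cosetPart A W t).card ≤ q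
    · exact h.exists_good_compl_of_le hA hC hmax hWU hU hle
    push Not at hle
    obtain ⟨t, htU, htW, htq⟩ := hle
    obtain ⟨k, htk, hkg⟩ := h.exists_good hA hC hmax htq.le
    have hkU : k ∈ U := (U.add_mem_iff_right htU).1 (hWU htk)
    have hkW : k ∉ W := fun hh => htW ((W.add_mem_iff_left hh).1 htk)
    have hkq : q + 1 ≤ (cosetPart A W k).card := cosetPart_eq htk ▸ htq
    have hCW : (cosetPart A W 0).card = q + 1 := by
      rw [cosetPart_eq_of_mem hC W.zero_mem, h.card_eq]
    obtain ⟨L, hWL, hkL, rfl, hLc⟩ := exists_hyperplane hWU hkU hkW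
      ((h.card_cosetPart_le hA hC k).trans hCW.ge)
    obtain ⟨K₀, hK₀⟩ := exists_isComplIn hWL
    have hL₀ := hK₀.natCard (T := Finset.univ.filter (· ∈ K₀)) (fun x => by simp)
    rw [h.natCard, Nat.mul_left_comm] at hL₀
    rw [natCard_sup_span_singleton hkL, card_cosetPart_sup hkL, zero_add] at hU
    have hLpos := Nat.card_pos (α := L)
    rw [natCard_sup_span_singleton hkL] at hUn
    obtain ⟨K, hK, hKg⟩ := ih L (by omega) hWL (by omega)
    set T : Finset V := Finset.univ.filter (· ∈ K)
    have hT : ∀ x, x ∈ T ↔ x ∈ K := fun x => by simp [T]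
    have hLT := hK.natCard hT
    have e : T.card * (4 * q) = 4 * (q * T.card) := by ring
    rw [h.natCard, e] at hLT
    have s₁ := hK.sum_card_cosetPart hT A 0
    have s₂ := hK.sum_card_cosetPart hT A k
    simp only [add_zero] at s₁
    have key := good_add_of_sums (T := T) (W := W) (Good := Good A C W)
      (cnt := fun v => (cosetPart A W v).card) (q := q) (k := k)
      (fun x hx y hy => (hT _).2 (K.add_mem ((hT x).1 hx) ((hT y).1 hy)))
      (h.card_cosetPart_le hA hC) (fun v w hvw => congrArg _ (cosetPart_eq hvw))
      (fun v w hv hvq hw hwq => h.good_add hA hC hv hvq hw hwq)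
      (fun v w hvw hv hw hq => h.good_unique hvw hv hw hq)
      (fun v hv => h.exists_good hA hC hmax hv) (fun x hx => hKg x ((hT x).1 hx)) hkg hkq
      (by rw [s₁]; omega) (by rw [s₁, s₂]; omega)
    refine ⟨K ⊔ Submodule.span (ZMod 2) {k}, ⟨hWU, sup_le_sup_right hK.le _, ?_, ?_⟩, ?_⟩
    · intro x hx
      rcases (mem_sup_span_singleton_char_two L k x).1 hx with hx | hx
      · obtain ⟨y, hy, hxy⟩ := hK.exists_add x hx
        exact ⟨y, Submodule.mem_sup_left hy, hxy⟩
      · obtain ⟨y, hy, hxy⟩ := hK.exists_add _ hx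
        refine ⟨y + k, ?_, ?_⟩
        · rw [mem_sup_span_singleton_char_two, add_add_cancel_char_two]
          exact Or.inr hy
        · rwa [add_comm y, ← add_assoc]
    · intro x hx hxK
      rcases (mem_sup_span_singleton_char_two K k x).1 hxK with hxK | hxK
      · exact hK.eq_zero x hx hxK
      · exact absurd ((L.add_mem_iff_right (hWL hx)).1 (hK.le hxK)) hkL
    · intro x hx
      rcases (mem_sup_span_singleton_char_two K k x).1 hx with hx | hx
      · exact hKg x hx
      · have h1 := key _ ((hT _).2 hx)
        rwa [add_add_cancel_char_two] at h1

theorem sum_fin_five_of_distinct (c : Fin 5 → V) {i j k l m : Fin 5} (hij : i ≠ j) (hik : i ≠ k)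
    (hil : i ≠ l) (him : i ≠ m) (hjk : j ≠ k) (hjl : j ≠ l) (hjm : j ≠ m) (hkl : k ≠ l)
    (hkm : k ≠ m) (hlm : l ≠ m) : ∑ x, c x = c i + (c j + (c k + (c l + c m))) := by
  have h : ({i, j, k, l, m} : Finset (Fin 5)) = Finset.univ := by
    apply Finset.eq_univ_of_card
    simp [hij, hik, hil, him, hjk, hjl, hjm, hkl, hkm, hlm]
  rw [← h]
  simp [hij, hik, hil, him, hjk, hjl, hjm, hkl, hkm, hlm]

theorem SumFree.injective_of_sum_eq_zero {A : Finset V} (hA : SumFree A) {c : Fin 5 → V}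
    (hc : ∀ i, c i ∈ A) (hs : ∑ i, c i = 0) : Function.Injective c := by
  intro i j hij
  by_contra hne
  obtain ⟨k, hik, hjk⟩ : ∃ k, i ≠ k ∧ j ≠ k := by
    clear * - i; decide +revert
  obtain ⟨l, hil, hjl, hkl⟩ : ∃ l, i ≠ l ∧ j ≠ l ∧ k ≠ l := by
    clear * - i; decide +revert
  obtain ⟨m, him, hjm, hkm, hlm⟩ : ∃ m, i ≠ m ∧ j ≠ m ∧ k ≠ m ∧ l ≠ m := by
    clear * - i; decide +revert
  rw [sum_fin_five_of_distinct c hne hik hil him hjk hjl hjm hkl hkm hlm, hij] at hs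
  exact hA.ne (hc k) (hc l) (hc m) (by
    grind [ZModModule.add_self (c j), ZModModule.add_self (c m)])

/-- Two pairs whose sums add up to an element outside a zero-sum `5`-set intersect. -/
theorem inter_of_add_ne {c : Fin 5 → V} (hs : ∑ i, c i = 0) {a b i j : Fin 5} (hab : a ≠ b)
    (hij : i ≠ j) (h : ∀ m, c a + c b + (c i + c j) ≠ c m) : a = i ∨ a = j ∨ b = i ∨ b = j := by
  by_contra! hcon
  obtain ⟨h1, h2, h3, h4⟩ := hcon
  obtain ⟨m, ham, hbm, him, hjm⟩ : ∃ m, a ≠ m ∧ b ≠ m ∧ i ≠ m ∧ j ≠ m := by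
    clear * - i; decide +revert
  rw [sum_fin_five_of_distinct c hab h1 h2 ham h3 h4 hbm hij him hjm] at hs
  exact h m (by grind [ZModModule.add_self (c m)])

theorem exists_crit_of_sum_eq_zero [Fintype V] {A : Finset V} (hA : SumFree A) {c : Fin 5 → V}
    (hc : ∀ i, c i ∈ A) (hs : ∑ i, c i = 0) :
    ∃ (W : Submodule (ZMod 2) V) (C : Finset V), (∀ x, x ∈ C ↔ x ∈ A ∧ x ∈ W) ∧ Crit W C 4 := by
  have hinj := hA.injective_of_sum_eq_zero hc hs
  have hs5 : c 0 + c 1 + c 2 + c 3 + c 4 = 0 := by rwa [Fin.sum_univ_five] at hs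
  have h0 : ∀ i, c i ≠ 0 := fun i hi => hA.zero_notMem (hi ▸ hc i)
  have h2 : ∀ i j, i ≠ j → c i + c j ≠ 0 := fun i j hij hh => hij (hinj (by
    grind [ZModModule.add_self (c j)]))
  have h3 : ∀ i j k, c i + c j + c k ≠ 0 := fun i j k hh =>
    hA.ne (hc i) (hc j) (hc k) (by grind [ZModModule.add_self (c k)])
  have h4 : c 3 + c 2 + c 1 + c 0 ≠ 0 := fun hh => h0 4 (by grind)
  set W : Submodule (ZMod 2) V := ⊥ ⊔ Submodule.span (ZMod 2) {c 0} ⊔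
    Submodule.span (ZMod 2) {c 1} ⊔ Submodule.span (ZMod 2) {c 2} ⊔
    Submodule.span (ZMod 2) {c 3} with hW
  have hcard : Nat.card W = 4 * 4 := by
    rw [hW, natCard_sup_span_singleton, natCard_sup_span_singleton, natCard_sup_span_singleton,
      natCard_sup_span_singleton, Nat.card_unique]
    all_goals simp only [mem_sup_span_singleton_char_two, Submodule.mem_bot, not_or]
    · exact h0 0
    · exact ⟨h0 1, h2 _ _ (by decide)⟩
    · exact ⟨⟨h0 2, h2 _ _ (by decide)⟩, h2 _ _ (by decide), h3 _ _ _⟩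
    · exact ⟨⟨⟨h0 3, h2 _ _ (by decide)⟩, h2 _ _ (by decide), h3 _ _ _⟩,
        ⟨h2 _ _ (by decide), h3 _ _ _⟩, h3 _ _ _, h4⟩
  have hform : ∀ z ∈ W, (∃ i, c i = z) ∨ z = 0 ∨ ∃ i j, i ≠ j ∧ c i + c j = z := by
    intro z hz
    simp only [hW, mem_sup_span_singleton_char_two, Submodule.mem_bot] at hz
    rcases hz with (((hz | hz) | (hz | hz)) | ((hz | hz) | (hz | hz))) |
      (((hz | hz) | (hz | hz)) | ((hz | hz) | (hz | hz)))
    · exact Or.inr (Or.inl hz)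
    · exact Or.inl ⟨0, by grind [ZModModule.add_self z]⟩
    · exact Or.inl ⟨1, by grind [ZModModule.add_self z]⟩
    · exact Or.inr (Or.inr ⟨1, 0, by decide, by grind [ZModModule.add_self z]⟩)
    · exact Or.inl ⟨2, by grind [ZModModule.add_self z]⟩
    · exact Or.inr (Or.inr ⟨2, 0, by decide, by grind [ZModModule.add_self z]⟩)
    · exact Or.inr (Or.inr ⟨2, 1, by decide, by grind [ZModModule.add_self z]⟩)
    · exact Or.inr (Or.inr ⟨3, 4, by decide, by grind [ZModModule.add_self z]⟩)
    · exact Or.inl ⟨3, by grind [ZModModule.add_self z]⟩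
    · exact Or.inr (Or.inr ⟨3, 0, by decide, by grind [ZModModule.add_self z]⟩)
    · exact Or.inr (Or.inr ⟨3, 1, by decide, by grind [ZModModule.add_self z]⟩)
    · exact Or.inr (Or.inr ⟨2, 4, by decide, by grind [ZModModule.add_self z]⟩)
    · exact Or.inr (Or.inr ⟨3, 2, by decide, by grind [ZModModule.add_self z]⟩)
    · exact Or.inr (Or.inr ⟨1, 4, by decide, by grind [ZModModule.add_self z]⟩)
    · exact Or.inr (Or.inr ⟨0, 4, by decide, by grind [ZModModule.add_self z]⟩)
    · exact Or.inl ⟨4, by grind [ZModModule.add_self z]⟩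
  have hcW : ∀ i, c i ∈ W := by
    have hlt : ∀ i, i ≠ 4 → c i ∈ W := by
      intro i hi
      fin_cases i
      · simp [hW, mem_sup_span_singleton_char_two]
      · simp [hW, mem_sup_span_singleton_char_two, ZModModule.add_self]
      · simp [hW, mem_sup_span_singleton_char_two, ZModModule.add_self]
      · simp [hW, mem_sup_span_singleton_char_two, ZModModule.add_self]
      · exact absurd rfl hi
    intro i
    by_cases hi : i = 4
    · have e : c i = c 0 + c 1 + c 2 + c 3 := by
        rw [hi]; grind [ZModModule.add_self (c 4)]
      rw [e]
      exact W.add_mem (W.add_mem (W.add_mem (hlt 0 (by decide)) (hlt 1 (by decide)))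
        (hlt 2 (by decide))) (hlt 3 (by decide))
    · exact hlt i hi
  set C : Finset V := Finset.univ.image c with hCdef
  have hCm : ∀ x, x ∈ C ↔ ∃ i, c i = x := fun x => by simp [hCdef]
  have hcC : ∀ i, c i ∈ C := fun i => (hCm _).2 ⟨i, rfl⟩
  have hC : ∀ x, x ∈ C ↔ x ∈ A ∧ x ∈ W := by
    intro x
    rw [hCm]
    constructor
    · rintro ⟨i, rfl⟩
      exact ⟨hc i, hcW i⟩
    · rintro ⟨hxA, hxW⟩
      rcases hform x hxW with h | rfl | ⟨i, j, -, rfl⟩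
      · exact h
      · exact absurd hxA hA.zero_notMem
      · exact absurd hxA (hA _ (hc i) _ (hc j))
  refine ⟨W, C, hC, fun x hx => ((hC x).1 hx).2, by norm_num, by decide,
    fun a ha b hb hab => hA a ((hC _).1 ha).1 b ((hC _).1 hb).1 ((hC _).1 hab).1, ?_, hcard, ?_, ?_⟩
  · rw [hCdef, Finset.card_image_of_injective _ hinj, Finset.card_univ, Fintype.card_fin]
  · intro z hz hzC
    rcases hform z hz with h | rfl | ⟨i, j, -, rfl⟩
    · exact absurd ((hCm z).2 h) hzC
    · exact ⟨c 0, hcC 0, c 0, hcC 0, ZModModule.add_self _⟩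
    · exact ⟨c i, hcC i, c j, hcC j, rfl⟩
  · intro I hI hIi
    obtain ⟨o, ho⟩ : I.Nonempty := Finset.card_pos.1 (by omega)
    have hpair : ∀ x ∈ I, x ≠ o → ∃ i j, i ≠ j ∧ x = c i + c j + o := by
      intro x hx hxo
      obtain ⟨h1, h2⟩ := hIi x hx o ho
      rcases hform _ h1 with h | h | ⟨i, j, hij, h⟩
      · exact absurd ((hCm _).2 h) h2
      · exact absurd (by grind [ZModModule.add_self o]) hxo
      · exact ⟨i, j, hij, by rw [h, add_add_cancel_char_two]⟩
    have hmeet : ∀ a b i j, a ≠ b → i ≠ j → c a + c b + o ∈ I → c i + c j + o ∈ I →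
        a = i ∨ a = j ∨ b = i ∨ b = j := by
      intro a b i j hab hij h1 h2
      refine inter_of_add_ne hs hab hij fun m hm => (hIi _ h1 _ h2).2 ?_
      have e : c a + c b + o + (c i + c j + o) = c m := by grind [ZModModule.add_self o]
      rw [e]
      exact hcC m
    obtain ⟨x, hx, hxo⟩ := Finset.exists_mem_notMem_of_card_lt_card
      (s := {o}) (t := I) (by simp; omega)
    obtain ⟨y, hy, hyo⟩ := Finset.exists_mem_notMem_of_card_lt_card
      (s := {o, x}) (t := I) (lt_of_le_of_lt (Finset.card_le_two) (by omega))
    simp only [Finset.mem_insert, Finset.mem_singleton, not_or] at hxo hyo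
    obtain ⟨i, j, k, hij, hik, hjk, rfl, rfl⟩ : ∃ i j k, i ≠ j ∧ i ≠ k ∧ j ≠ k ∧
        x = c i + c j + o ∧ y = c i + c k + o := by
      obtain ⟨a, b, hab, hxe⟩ := hpair x hx hxo
      obtain ⟨a', b', hab', hye⟩ := hpair y hy hyo.1
      have hne : ¬ (a = a' ∧ b = b') ∧ ¬ (a = b' ∧ b = a') := by
        constructor <;> rintro ⟨rfl, rfl⟩
        · exact hyo.2 (hye.trans hxe.symm)
        · exact hyo.2 (by rw [hye, hxe, add_comm (c b)])
      rcases hmeet a b a' b' hab hab' (hxe ▸ hx) (hye ▸ hy) with h | h | h | h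
      · subst h; exact ⟨a, b, b', hab, hab', by tauto, hxe, hye⟩
      · subst h; exact ⟨a, b, a', hab, hab'.symm, by tauto, hxe, by rw [hye, add_comm (c a')]⟩
      · subst h; exact ⟨b, a, b', hab.symm, hab', by tauto, by rw [hxe, add_comm (c a)], hye⟩
      · subst h; exact ⟨b, a, a', hab.symm, hab'.symm, by tauto, by rw [hxe, add_comm (c a)],
          by rw [hye, add_comm (c a')]⟩
    have htri : c j + c k + o ∉ I := by
      intro hz
      obtain ⟨w, hw, hwn⟩ := Finset.exists_mem_notMem_of_card_lt_card
        (s := {o, c i + c j + o, c i + c k + o, c j + c k + o}) (t := I)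
        (lt_of_le_of_lt (Finset.card_le_four) (by omega))
      simp only [Finset.mem_insert, Finset.mem_singleton, not_or] at hwn
      obtain ⟨a, b, hab, rfl⟩ := hpair w hw hwn.1
      have m1 := hmeet a b i j hab hij hw hx
      have m2 := hmeet a b i k hab hik hw hy
      have m3 := hmeet a b j k hab hjk hw hz
      have := add_comm (c a) (c b)
      grind
    refine ⟨c i + o, fun w hw => ?_⟩
    by_cases hwo : w = o
    · have e : w + (c i + o) = c i := by rw [hwo]; grind [ZModModule.add_self o]
      rw [e]
      exact hcC i
    obtain ⟨a, b, hab, rfl⟩ := hpair w hw hwo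
    have m1 := hmeet a b i j hab hij hw hx
    have m2 := hmeet a b i k hab hik hw hy
    by_cases hai : a = i
    · have e : c a + c b + o + (c i + o) = c b := by
        rw [hai]; grind [ZModModule.add_self o, ZModModule.add_self (c i)]
      rw [e]
      exact hcC b
    by_cases hbi : b = i
    · have e : c a + c b + o + (c i + o) = c a := by
        rw [hbi]; grind [ZModModule.add_self o, ZModModule.add_self (c i)]
      rw [e]
      exact hcC a
    · exfalso
      have := add_comm (c a) (c b)
      grind

theorem exists_add_mem_add_mem [Fintype V] {D : Finset V} (hD : Fintype.card V < 2 * D.card)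
    (u v : V) : ∃ x ∈ D, x + u ∈ D ∧ x + v ∈ D := by
  by_contra! hcon
  have hsum : ∀ w : V, ∑ x : V, (if x + w ∈ D then 1 else 0) = D.card := by
    intro w
    rw [← Finset.card_filter, ← card_image_add D w]
    congr 1
    ext x
    simp only [Finset.mem_filter, Finset.mem_univ, true_and, Finset.mem_image]
    constructor
    · intro hx
      exact ⟨x + w, hx, add_add_cancel_char_two x w⟩
    · rintro ⟨y, hy, rfl⟩
      rwa [add_add_cancel_char_two]
  have h : ∑ x : V, ((if x + 0 ∈ D then 1 else 0) + (if x + u ∈ D then 1 else 0) +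
      (if x + v ∈ D then 1 else 0) + (if x + (u + v) ∈ D then 1 else 0)) ≤ ∑ _x : V, 2 := by
    refine Finset.sum_le_sum fun x _ => ?_
    have h1 := hcon (x + 0)
    have h2 := hcon (x + u)
    have h3 := hcon (x + v)
    have h4 := hcon (x + (u + v))
    have e1 : x + (u + v) + u = x + v := by grind [ZModModule.add_self u]
    have e2 : x + (u + v) + v = x + u := by grind [ZModModule.add_self v]
    rw [e1, e2] at h4
    rw [add_add_cancel_char_two, add_assoc] at h2
    rw [add_add_cancel_char_two, add_assoc, add_comm v] at h3
    rw [add_zero] at h1 ⊢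
    split_ifs <;> first | omega | (exfalso; tauto)
  simp only [Finset.sum_add_distrib, hsum, Finset.sum_const, Finset.card_univ, smul_eq_mul] at h
  omega

theorem exists_period_of_sum_ne_zero [Fintype V] {A : Finset V} (hA : SumFree A)
    (hmax : ∀ z, z ∉ A → ∃ a ∈ A, ∃ b ∈ A, a + b = z) (hcard : Fintype.card V < 4 * A.card)
    (hA1 : 1 < A.card) (h5 : ∀ c : Fin 5 → V, (∀ i, c i ∈ A) → ∑ i, c i ≠ 0) :
    ∃ k ≠ 0, ∀ a ∈ A, a + k ∈ A := by
  obtain ⟨p, hp, r, hr, hpr⟩ := Finset.one_lt_card.1 hA1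
  have h5' : ∀ a ∈ A, ∀ b ∈ A, ∀ c ∈ A, ∀ d ∈ A, ∀ e ∈ A, a + b + c + d + e ≠ 0 := by
    intro a ha b hb c hc d hd e he h
    refine h5 ![a, b, c, d, e] (fun i => ?_) (by simpa [Fin.sum_univ_five] using h)
    fin_cases i <;> assumption
  have hdisj : Disjoint A (A.image (· + p)) := by
    rw [Finset.disjoint_left]
    intro x hx hx'
    obtain ⟨y, hy, rfl⟩ := Finset.mem_image.1 hx'
    exact hA y hy p hp hx
  have hDcard : Fintype.card V < 2 * (A ∪ A.image (· + p)).card := by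
    rw [Finset.card_union_of_disjoint hdisj, card_image_add]
    omega
  have hclass : ∀ x ∈ A ∪ A.image (· + p), ∀ a ∈ A, ∀ b ∈ A,
      x + (a + b) ∈ A ∪ A.image (· + p) → (x ∈ A ↔ x + (a + b) ∈ A) := by
    intro x hx a ha b hb hx'
    rcases Finset.mem_union.1 hx with hx | hx <;> rcases Finset.mem_union.1 hx' with hx' | hx'
    · exact iff_of_true hx hx'
    · obtain ⟨y, hy, e⟩ := Finset.mem_image.1 hx'
      exact absurd (by grind [ZModModule.add_self x, ZModModule.add_self a, ZModModule.add_self b])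
        (h5' x hx a ha b hb y hy p hp)
    · obtain ⟨y, hy, e⟩ := Finset.mem_image.1 hx
      exact absurd (by grind [ZModModule.add_self x, ZModModule.add_self a, ZModModule.add_self b])
        (h5' _ hx' a ha b hb y hy p hp)
    · exact iff_of_false (fun h => Finset.disjoint_left.1 hdisj h hx)
        (fun h => Finset.disjoint_left.1 hdisj h hx')
  have hsum : ∀ a ∈ A, ∀ b ∈ A, ∀ c ∈ A, ∀ d ∈ A, ∃ e ∈ A, ∃ f ∈ A, a + b + (c + d) = e + f := by
    intro a ha b hb c hc d hd
    obtain ⟨x, hx, hxu, hxv⟩ := exists_add_mem_add_mem hDcard (a + b) (c + d)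
    have h1 := hclass x hx a ha b hb hxu
    have h2 := hclass x hx c hc d hd hxv
    by_cases hxA : x ∈ A
    · exact ⟨_, h1.1 hxA, _, h2.1 hxA, by grind [ZModModule.add_self x]⟩
    · have h3 := (Finset.mem_union.1 hxu).resolve_left fun h => hxA (h1.2 h)
      have h4 := (Finset.mem_union.1 hxv).resolve_left fun h => hxA (h2.2 h)
      obtain ⟨y, hy, ey⟩ := Finset.mem_image.1 h3
      obtain ⟨z, hz, ez⟩ := Finset.mem_image.1 h4
      exact ⟨y, hy, z, hz, by grind [ZModModule.add_self x, ZModModule.add_self p]⟩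
  refine ⟨p + r, fun h => hpr (by grind [ZModModule.add_self r]), fun a ha => ?_⟩
  by_contra hcon
  obtain ⟨b, hb, c, hc, e⟩ := hmax _ hcon
  obtain ⟨f, hf, g, hg, e'⟩ := hsum b hb c hc p hp r hr
  exact hA f hf g hg (by
    rw [← e', e, add_add_cancel_char_two]
    exact ha)

theorem IsComplIn.add_mem_of_good [Fintype V] {A C : Finset V} {W K : Submodule (ZMod 2) V}
    (hC : SumFree C) (hCW : ∀ x ∈ C, x ∈ W) (hK : IsComplIn W K ⊤)
    (hmax : ∀ z, z ∉ A → ∃ a ∈ A, ∃ b ∈ A, a + b = z) (hg : ∀ x ∈ K, Good A C W x) {k : V}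
    (hk : k ∈ K) : ∀ a ∈ A, a + k ∈ A := by
  have hdec : ∀ a ∈ A, ∃ x ∈ K, a + x ∈ C := fun a ha => by
    obtain ⟨x, hx, hax⟩ := hK.exists_add a Submodule.mem_top
    exact ⟨x, hx, hg x hx a (mem_cosetPart.2 ⟨ha, hax⟩)⟩
  intro a ha
  by_contra hcon
  obtain ⟨b, hb, c, hc, e⟩ := hmax _ hcon
  obtain ⟨x, hx, hax⟩ := hdec a ha
  obtain ⟨y, hy, hby⟩ := hdec b hb
  obtain ⟨z, hz, hcz⟩ := hdec c hc
  have e₁ : (b + y) + (c + z) + (a + x) = k + (x + (y + z)) := by grind [ZModModule.add_self a]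
  have h0 : (b + y) + (c + z) + (a + x) = 0 := hK.eq_zero _
    (W.add_mem (W.add_mem (hCW _ hby) (hCW _ hcz)) (hCW _ hax))
    (e₁ ▸ K.add_mem hk (K.add_mem hx (K.add_mem hy hz)))
  exact hC.ne hby hcz hax (by grind [ZModModule.add_self (a + x)])

/-- A maximal sum-free set of more than a quarter of the elements is periodic. -/
theorem SumFree.exists_period [Fintype V] {A : Finset V} (hA : SumFree A)
    (hmax : ∀ z, z ∉ A → ∃ a ∈ A, ∃ b ∈ A, a + b = z) (hcard : Fintype.card V + 8 ≤ 4 * A.card) :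
    ∃ k ≠ 0, ∀ a ∈ A, a + k ∈ A := by
  by_cases h5 : ∀ c : Fin 5 → V, (∀ i, c i ∈ A) → ∑ i, c i ≠ 0
  · exact exists_period_of_sum_ne_zero hA hmax (by omega) (by omega) h5
  push Not at h5
  obtain ⟨c, hc, hs⟩ := h5
  obtain ⟨W₀, C₀, hC₀, h₀⟩ := exists_crit_of_sum_eq_zero hA hc hs
  obtain ⟨W, -, hW⟩ := (Set.toFinite {W : Submodule (ZMod 2) V | ∃ (C : Finset V) (q : ℕ),
    (∀ x, x ∈ C ↔ x ∈ A ∧ x ∈ W) ∧ Crit W C q}).exists_le_maximal ⟨C₀, 4, hC₀, h₀⟩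
  obtain ⟨C, q, hC, h⟩ := hW.prop
  have hAtop : cosetPart A ⊤ 0 = A := by
    ext x
    simp [mem_cosetPart]
  have hVtop : Nat.card (⊤ : Submodule (ZMod 2) V) = Fintype.card V := by
    rw [← Nat.card_eq_fintype_card]
    exact Nat.card_congr Submodule.topEquiv.toEquiv
  obtain ⟨K, hK, hKg⟩ := h.exists_good_compl hA hC
    (fun W' C' q' hlt hC' h' => hlt.not_ge (hW.le_of_ge ⟨C', q', hC', h'⟩ hlt.le)) _ ⊤ le_rfl le_top
    (by rw [hAtop, hVtop]; omega)
  by_cases hK0 : ∃ k ∈ K, k ≠ 0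
  · obtain ⟨k, hk, hk0⟩ := hK0
    exact ⟨k, hk0, hK.add_mem_of_good h.sumFree h.sub hmax hKg hk⟩
  · exfalso
    push Not at hK0
    have hWtop : W = ⊤ := by
      refine (Submodule.eq_top_iff').2 fun x => ?_
      obtain ⟨k, hk, hxk⟩ := hK.exists_add x Submodule.mem_top
      rwa [hK0 k hk, add_zero] at hxk
    have hCA : C = A := by
      ext x
      rw [hC, hWtop]
      simp
    have h1 := h.natCard
    have h2 := h.card_eq
    rw [hWtop, hVtop] at h1
    rw [hCA] at h2
    omega

theorem SumFree.image {A : Finset V} (hA : SumFree A) (g : V ≃ₗ[ZMod 2] V) :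
    SumFree (A.image g) := by
  intro x hx y hy hxy
  obtain ⟨a, ha, rfl⟩ := Finset.mem_image.1 hx
  obtain ⟨b, hb, rfl⟩ := Finset.mem_image.1 hy
  obtain ⟨c, hc, e⟩ := Finset.mem_image.1 hxy
  rw [← map_add] at e
  exact hA.ne ha hb hc (g.injective e.symm)

end

theorem exists_linearEquiv_apply_eq_single {n : ℕ} {k : Fin n → ZMod 2} (hk : k ≠ 0) (l : Fin n) :
    ∃ g : (Fin n → ZMod 2) ≃ₗ[ZMod 2] (Fin n → ZMod 2), g k = Pi.single l 1 := by
  have hZ : ∀ a : ZMod 2, a ≠ 0 → a = 1 := by decide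
  obtain ⟨f, hfk, hfl⟩ : ∃ f : Module.Dual (ZMod 2) (Fin n → ZMod 2),
      f k = 1 ∧ f (Pi.single l 1) = 1 := by
    by_cases hl : k l = 0
    · obtain ⟨i, hi⟩ := Function.ne_iff.1 hk
      have hil : i ≠ l := by rintro rfl; exact hi hl
      refine ⟨LinearMap.proj (R := ZMod 2) (φ := fun _ => ZMod 2) i + LinearMap.proj l, ?_, ?_⟩
      · simp [hl, hZ _ hi]
      · simp [hil]
    · exact ⟨LinearMap.proj l, hZ _ hl, by simp⟩
  have hf : f (k + Pi.single l 1) = 0 := by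
    rw [map_add, hfk, hfl]; decide
  refine ⟨LinearEquiv.transvection hf, ?_⟩
  rw [LinearEquiv.transvection.apply, hfk, one_smul, ← add_assoc, ZModModule.add_self, zero_add]

theorem IsCap.sumFree {d : ℕ} {S : Finset (Fin d → ZMod 2)} (h : IsCap S) : SumFree S := by
  intro a ha b hb hab
  have ha0 := h.1 a ha
  have hb0 := h.1 b hb
  refine h.2 a ha b hb _ hab ?_ ?_ ?_ (ZModModule.add_self _)
  · rintro rfl
    exact h.1 _ hab (ZModModule.add_self a)
  · intro e
    exact ha0 (by simpa using e)
  · intro e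
    exact hb0 (by simpa using e)

theorem IsMaximalCap.exists_add_eq {d : ℕ} {S : Finset (Fin d → ZMod 2)} (h : IsMaximalCap S)
    (hS : S.Nonempty) {z : Fin d → ZMod 2} (hz : z ∉ S) : ∃ a ∈ S, ∃ b ∈ S, a + b = z := by
  by_cases hz0 : z = 0
  · obtain ⟨a, ha⟩ := hS
    exact ⟨a, ha, a, ha, by rw [hz0, ZModModule.add_self]⟩
  by_contra! hcon
  refine h.2 z hz0 hz ⟨?_, ?_⟩
  · intro v hv
    rcases Finset.mem_insert.1 hv with rfl | hv
    exacts [hz0, h.1.1 v hv]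
  · intro a ha b hb c hc hab hbc hac hs
    rcases Finset.mem_insert.1 ha with rfl | haS
    · exact hcon b (Finset.mem_of_mem_insert_of_ne hb hab.symm) c
        (Finset.mem_of_mem_insert_of_ne hc hac.symm)
        (by grind [ZModModule.add_self a])
    rcases Finset.mem_insert.1 hb with rfl | hbS
    · exact hcon a haS c (Finset.mem_of_mem_insert_of_ne hc hbc.symm)
        (by grind [ZModModule.add_self b])
    rcases Finset.mem_insert.1 hc with rfl | hcS
    · exact hcon a haS b hbS (by grind [ZModModule.add_self c])
    · exact h.1.2 a haS b hbS c hcS hab hbc hac hs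

theorem isMaximalCap_of_sumFree {d : ℕ} {S : Finset (Fin d → ZMod 2)} (h : SumFree S)
    (hmax : ∀ z, z ∉ S → ∃ a ∈ S, ∃ b ∈ S, a + b = z) : IsMaximalCap S := by
  refine ⟨⟨fun v hv h0 => h.zero_notMem (h0 ▸ hv), fun a ha b hb c hc _ _ _ hs => ?_⟩, ?_⟩
  · exact h.ne ha hb hc (by grind [ZModModule.add_self c])
  · intro w hw0 hwS hcap
    obtain ⟨a, ha, b, hb, rfl⟩ := hmax w hwS
    exact hcap.sumFree a (Finset.mem_insert_of_mem ha) b (Finset.mem_insert_of_mem hb)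
      (Finset.mem_insert_self _ _)

theorem snoc_add_snoc {d : ℕ} (v w : Fin d → ZMod 2) (a b : ZMod 2) :
    (Fin.snoc v a + Fin.snoc w b : Fin (d + 1) → ZMod 2) = Fin.snoc (v + w) (a + b) := by
  ext i
  refine Fin.lastCases ?_ (fun j => ?_) i <;> simp

theorem mem_double_s11 {d : ℕ} {T : Finset (Fin d → ZMod 2)} {v : Fin d → ZMod 2} {a : ZMod 2} :
    (Fin.snoc v a : Fin (d + 1) → ZMod 2) ∈ double T ↔ v ∈ T := by
  have ha : ∀ a : ZMod 2, a = 0 ∨ a = 1 := by decide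
  simp only [double, Finset.mem_union, Finset.mem_image, Fin.snoc_inj]
  constructor
  · rintro (⟨w, hw, rfl, -⟩ | ⟨w, hw, rfl, -⟩) <;> exact hw
  · intro hv
    exact (ha a).imp (fun h => ⟨v, hv, rfl, h.symm⟩) (fun h => ⟨v, hv, rfl, h.symm⟩)

theorem exists_eq_double {d : ℕ} {S : Finset (Fin (d + 1) → ZMod 2)}
    (hS : ∀ x ∈ S, x + Pi.single (Fin.last d) 1 ∈ S) :
    ∃ T : Finset (Fin d → ZMod 2), S = double T := by
  have he : (Pi.single (Fin.last d) 1 : Fin (d + 1) → ZMod 2) = Fin.snoc 0 1 := by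
    ext i
    refine Fin.lastCases ?_ (fun j => ?_) i <;> simp
  have ha : ∀ a : ZMod 2, a = 0 ∨ a = 1 := by decide
  have h1 : ∀ (v : Fin d → ZMod 2) (a : ZMod 2), (Fin.snoc v a : Fin (d + 1) → ZMod 2) ∈ S →
      (Fin.snoc v (a + 1) : Fin (d + 1) → ZMod 2) ∈ S := by
    intro v a hv
    have := hS _ hv
    rwa [he, snoc_add_snoc, add_zero] at this
  refine ⟨Finset.univ.filter fun v => (Fin.snoc v 0 : Fin (d + 1) → ZMod 2) ∈ S, ?_⟩
  ext x
  induction x using Fin.snocCases with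
  | _ v a =>
    rw [mem_double_s11, Finset.mem_filter]
    rcases ha a with rfl | rfl
    · simp
    · exact ⟨fun h => ⟨Finset.mem_univ _, h1 v 1 h⟩, fun h => by simpa using h1 v 0 h.2⟩

-- The 2^{5-1} design with defining relation I = ABCDE, as a subset of F₂⁴.

-- Theorem 3.4 (with the run-size exponent written as d + 1, d ≥ 3, i.e. N = 2^(d+1) ≥ 16):
-- every maximal cap S in F₂^(d+1) with N/4 + 2 = 2^(d-1) + 2 ≤ |S| ≤ 2^d = N/2 is,
-- up to a linear automorphism, the double of a maximal cap in F₂^d.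
theorem maximalCap_is_double (d : ℕ) (hd : 3 ≤ d) (S : Finset (Fin (d + 1) → ZMod 2))
    (hmax : IsMaximalCap S) (h1 : 2 ^ (d - 1) + 2 ≤ S.card) (h2 : S.card ≤ 2 ^ d) :
    ∃ (g : (Fin (d + 1) → ZMod 2) ≃ₗ[ZMod 2] (Fin (d + 1) → ZMod 2))
      (T : Finset (Fin d → ZMod 2)), IsMaximalCap T ∧ S.image g = double T := by
  have hS := hmax.1.sumFree
  have hcard : Fintype.card (Fin (d + 1) → ZMod 2) + 8 ≤ 4 * S.card := by
    have e : 2 ^ (d + 1) = 4 * 2 ^ (d - 1) := by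
      rw [show d + 1 = 2 + (d - 1) by omega, pow_add]; norm_num
    simp only [Fintype.card_fun, ZMod.card, Fintype.card_fin]
    omega
  have hcompl : ∀ z, z ∉ S → ∃ a ∈ S, ∃ b ∈ S, a + b = z := fun z hz =>
    hmax.exists_add_eq (Finset.card_pos.1 (by omega)) hz
  obtain ⟨k, hk0, hk⟩ := hS.exists_period hcompl hcard
  obtain ⟨g, hg⟩ := exists_linearEquiv_apply_eq_single hk0 (Fin.last d)
  obtain ⟨T, hT⟩ := exists_eq_double (S := S.image g) (by
    intro x hx
    obtain ⟨y, hy, rfl⟩ := Finset.mem_image.1 hx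
    rw [← hg, ← map_add]
    exact Finset.mem_image_of_mem g (hk y hy))
  have hgS := hS.image g
  rw [hT] at hgS
  refine ⟨g, T, isMaximalCap_of_sumFree (fun a ha b hb hab => ?_) (fun z hz => ?_), hT⟩
  · refine hgS (Fin.snoc a 0) (mem_double_s11.2 ha) (Fin.snoc b 0) (mem_double_s11.2 hb) ?_
    rw [snoc_add_snoc]
    exact mem_double_s11.2 hab
  · have hz' : (Fin.snoc z 0 : Fin (d + 1) → ZMod 2) ∉ double T := fun h => hz (mem_double_s11.1 h)
    obtain ⟨a, ha, b, hb, e⟩ := hcompl (g.symm (Fin.snoc z 0)) fun h => hz' (by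
      rw [← hT, ← g.apply_symm_apply (Fin.snoc z 0)]
      exact Finset.mem_image_of_mem g h)
    have ha' := Finset.mem_image_of_mem g ha
    have hb' := Finset.mem_image_of_mem g hb
    rw [hT, ← Fin.snoc_init_self (g a), mem_double_s11] at ha'
    rw [hT, ← Fin.snoc_init_self (g b), mem_double_s11] at hb'
    refine ⟨_, ha', _, hb', ?_⟩
    have e' := congrArg g e
    rw [map_add, g.apply_symm_apply, ← Fin.snoc_init_self (g a), ← Fin.snoc_init_self (g b),
      snoc_add_snoc, Fin.snoc_inj] at e'
    exact e'.1
end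

section
/- For every d ≥ 4 there exists a maximal cap in F₂^d with exactly 2^(d−2) + 1 elements. (In design language: for each N = 2^d with d ≥ 4 there exists at least one maximal regular design of resolution IV or higher with n = N/4 + 1 factors.) -/
-- The 2^{5-1} design with defining relation I = ABCDE, as a subset of F₂⁴.

-- The graph of a Boolean function `g`, lifted to the affine hyperplane where the first coordinate
-- is `1`, together with the direction `(0, 1, 0)` of the values of `g`.
def graphCap {m : ℕ} (g : (Fin m → ZMod 2) → ZMod 2) : Finset (Fin (m + 2) → ZMod 2) :=
  insert (Matrix.vecCons 0 (Matrix.vecCons 1 0))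
    (Finset.univ.image fun x => Matrix.vecCons 1 (Matrix.vecCons (g x) x))

theorem mem_graphCap {m : ℕ} {g : (Fin m → ZMod 2) → ZMod 2} {a b : ZMod 2} {x : Fin m → ZMod 2} :
    Matrix.vecCons a (Matrix.vecCons b x) ∈ graphCap g ↔
      (a = 0 ∧ b = 1 ∧ x = 0) ∨ (a = 1 ∧ b = g x) := by
  simp only [graphCap, Finset.mem_insert, Finset.mem_image, Finset.mem_univ, true_and,
    Matrix.vecCons_inj]
  grind

theorem card_graphCap {m : ℕ} (g : (Fin m → ZMod 2) → ZMod 2) :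
    (graphCap g).card = 2 ^ m + 1 := by
  rw [graphCap, Finset.card_insert_of_notMem, Finset.card_image_of_injective]
  · simp [ZMod.card]
  · intro x y h
    exact (Matrix.vecCons_inj.1 (Matrix.vecCons_inj.1 h).2).2
  · simp [Matrix.vecCons_inj]

theorem exists_eq_vecCons_vecCons {m : ℕ} (v : Fin (m + 2) → ZMod 2) :
    ∃ a b x, v = Matrix.vecCons a (Matrix.vecCons b x) :=
  ⟨v 0, v 1, Matrix.vecTail (Matrix.vecTail v), by
    conv_lhs => rw [← Matrix.cons_head_tail v, ← Matrix.cons_head_tail (Matrix.vecTail v)]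
    rfl⟩

theorem add_eq_zero_iff_eq_of_zmod_two {ι : Type*} {x y : ι → ZMod 2} : x + y = 0 ↔ x = y := by
  simp [funext_iff, CharTwo.add_eq_zero]

theorem isCap_graphCap {m : ℕ} (g : (Fin m → ZMod 2) → ZMod 2) : IsCap (graphCap g) := by
  have h11 : (1 : ZMod 2) + 1 = 0 := by decide
  refine ⟨fun v hv => ?_, fun u hu v hv w hw huv hvw huw => ?_⟩
  · obtain ⟨a, b, x, rfl⟩ := exists_eq_vecCons_vecCons v
    rw [mem_graphCap] at hv
    rw [Ne, Matrix.cons_eq_zero_iff, Matrix.cons_eq_zero_iff]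
    rintro ⟨rfl, rfl, rfl⟩
    simp at hv
  · obtain ⟨a, b, x, rfl⟩ := exists_eq_vecCons_vecCons u
    obtain ⟨a₂, b₂, x₂, rfl⟩ := exists_eq_vecCons_vecCons v
    obtain ⟨a₃, b₃, x₃, rfl⟩ := exists_eq_vecCons_vecCons w
    rw [mem_graphCap] at hu hv hw
    simp only [Matrix.cons_add_cons, Ne, Matrix.cons_eq_zero_iff]
    rintro ⟨h1, -, h3⟩
    rcases hu with ⟨rfl, rfl, rfl⟩ | ⟨rfl, rfl⟩ <;>
    rcases hv with ⟨rfl, rfl, rfl⟩ | ⟨rfl, rfl⟩ <;>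
    rcases hw with ⟨rfl, rfl, rfl⟩ | ⟨rfl, rfl⟩ <;>
    simp_all [add_eq_zero_iff_eq_of_zmod_two]

-- `hg` says that `g` has no nonzero linear structure: none of its derivatives is constant.
theorem isMaximalCap_graphCap {m : ℕ} {g : (Fin m → ZMod 2) → ZMod 2}
    (hg : ∀ w ≠ 0, ∀ b, ∃ x, g x + g (x + w) = b) : IsMaximalCap (graphCap g) := by
  refine ⟨isCap_graphCap g, fun u hu huS hcap => ?_⟩
  have key (p q : Fin (m + 2) → ZMod 2) (hp : p ∈ graphCap g) (hq : q ∈ graphCap g)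
      (hpq : p ≠ q) : u + p + q ≠ 0 :=
    hcap.2 u (Finset.mem_insert_self _ _) p (Finset.mem_insert_of_mem hp) q
      (Finset.mem_insert_of_mem hq) (fun h => huS (h ▸ hp)) hpq (fun h => huS (h ▸ hq))
  obtain ⟨a, b, w, rfl⟩ := exists_eq_vecCons_vecCons u
  rw [mem_graphCap] at huS
  rw [Ne, Matrix.cons_eq_zero_iff, Matrix.cons_eq_zero_iff] at hu
  have two (c : ZMod 2) : c = 0 ∨ c = 1 := by decide +revert
  rcases two a with rfl | rfl
  · have hw : w ≠ 0 := by
      rintro rfl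
      rcases two b with rfl | rfl <;> simp_all
    obtain ⟨x, hx⟩ := hg w hw b
    refine key (Matrix.vecCons 1 (Matrix.vecCons (g x) x))
      (Matrix.vecCons 1 (Matrix.vecCons (g (x + w)) (x + w)))
      (mem_graphCap.2 (.inr ⟨rfl, rfl⟩)) (mem_graphCap.2 (.inr ⟨rfl, rfl⟩)) ?_ ?_
    · simpa [Matrix.vecCons_inj] using fun _ => hw
    · simp only [Matrix.cons_add_cons, Matrix.cons_eq_zero_iff]
      refine ⟨by decide, ?_, ?_⟩
      · rw [← hx, add_assoc, CharTwo.add_self_eq_zero]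
      · rw [add_comm w x, add_eq_zero_iff_eq_of_zmod_two]
  · refine key (Matrix.vecCons 1 (Matrix.vecCons (g w) w)) (Matrix.vecCons 0 (Matrix.vecCons 1 0))
      (mem_graphCap.2 (.inr ⟨rfl, rfl⟩)) (mem_graphCap.2 (.inl ⟨rfl, rfl, rfl⟩)) ?_ ?_
    · simp [Matrix.vecCons_inj]
    · simp only [Matrix.cons_add_cons, Matrix.cons_eq_zero_iff]
      have hb (b c : ZMod 2) (h : b ≠ c) : b + c + 1 = 0 := by decide +revert
      refine ⟨by decide, hb _ _ fun h => huS (.inr ⟨rfl, h⟩), ?_⟩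
      rw [add_zero, add_eq_zero_iff_eq_of_zmod_two]

theorem exists_derivative_indicator_zero {m : ℕ} (hm : 2 ≤ m) (w : Fin m → ZMod 2) (hw : w ≠ 0)
    (b : ZMod 2) :
    ∃ x : Fin m → ZMod 2, (if x = 0 then 1 else 0) + (if x + w = 0 then 1 else 0) = b := by
  have two (c : ZMod 2) : c = 0 ∨ c = 1 := by decide +revert
  rcases two b with rfl | rfl
  · have hcard : ({0, w} : Finset (Fin m → ZMod 2)).card < Fintype.card (Fin m → ZMod 2) := by
      have h4 : 2 ^ 2 ≤ 2 ^ m := Nat.pow_le_pow_right (by norm_num) hm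
      have h2 := Finset.card_le_two (a := (0 : Fin m → ZMod 2)) (b := w)
      simp only [Fintype.card_fun, ZMod.card, Fintype.card_fin]
      lia
    obtain ⟨x, hx⟩ : ∃ x, x ∉ ({0, w} : Finset (Fin m → ZMod 2)) := by
      by_contra! h
      exact hcard.ne (congrArg Finset.card (Finset.eq_univ_of_forall h))
    simp only [Finset.mem_insert, Finset.mem_singleton, not_or] at hx
    exact ⟨x, by simp [hx, add_eq_zero_iff_eq_of_zmod_two]⟩
  · exact ⟨0, by simp [hw]⟩

-- Theorem 3.5: for every d ≥ 4 there is a maximal cap in F₂^d with 2^(d-2) + 1 elements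
-- (a maximal regular resolution ≥ IV design with n = N/4 + 1 factors).
theorem exists_maximalCap_quarter_plus_one (d : ℕ) (hd : 4 ≤ d) :
    ∃ S : Finset (Fin d → ZMod 2), IsMaximalCap S ∧ S.card = 2 ^ (d - 2) + 1 := by
  obtain ⟨m, rfl⟩ : ∃ m, d = m + 2 := ⟨d - 2, by lia⟩
  exact ⟨graphCap fun x => if x = 0 then 1 else 0,
    isMaximalCap_graphCap (exists_derivative_indicator_zero (by lia)), card_graphCap _⟩
end

section
/- Let d ≥ 4 and let S be a cap in F₂^d with |S| > 5 · 2^(d−4). Then there exists a nonzero linear functional f : F₂^d → F₂ with f(v) = 1 for every v ∈ S. (In design language: for 5N/16 < n ≤ N/2, every regular design of resolution IV is obtained by deleting columns from the saturated design of resolution IV; all such designs are even designs.) -/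
-- The 2^{5-1} design with defining relation I = ABCDE, as a subset of F₂⁴.

/-- Translates of `S` by the points `p i` cover each vector at most `m` times only if
`S` has density at most `m / |ι|`. -/
theorem card_mul_card_le_of_translates {V ι : Type*} [AddCommGroup V] [Fintype V] [DecidableEq V]
    [Fintype ι] (S : Finset V) (p : ι → V) (m : ℕ)
    (h : ∀ v, (Finset.univ.filter fun i => v + p i ∈ S).card ≤ m) :
    Fintype.card ι * S.card ≤ m * Fintype.card V := by
  have key : ∑ v : V, (Finset.univ.filter fun i => v + p i ∈ S).card
      = Fintype.card ι * S.card := by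
    simp only [Finset.card_filter]
    rw [Finset.sum_comm]
    have (i : ι) : ∑ v : V, (if v + p i ∈ S then 1 else 0) = S.card := by
      exact (Equiv.sum_comp (Equiv.addRight (p i)) fun v => if v ∈ S then 1 else 0).trans
        (by simp)
    simp [this]
  rw [← key, mul_comm, ← smul_eq_mul, ← Finset.card_univ]
  exact Finset.sum_le_card_nsmul _ _ _ fun v _ => h v

/-- If no odd number of elements of `S`, with repetition, sums to zero, then some linear
functional is constantly `1` on `S`. -/
theorem exists_dual_eq_one {V : Type*} [AddCommGroup V] [Module (ZMod 2) V] (S : Set V)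
    (h : ∀ l : List V, (∀ x ∈ l, x ∈ S) → l.sum = 0 → ¬ Odd l.length) :
    ∃ f : V →ₗ[ZMod 2] ZMod 2, ∀ v ∈ S, f v = 1 := by
  let U : Submodule (ZMod 2) (V × ZMod 2) := Submodule.span _ ((fun v => (v, 1)) '' S)
  have hU : ∀ x ∈ U, ∃ l : List V, (∀ y ∈ l, y ∈ S) ∧ l.sum = x.1 ∧ (l.length : ZMod 2) = x.2 := by
    intro x hx
    induction hx using Submodule.span_induction with
    | mem x hx =>
      obtain ⟨v, hv, rfl⟩ := hx
      exact ⟨[v], by simpa using hv, by simp, by simp⟩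
    | zero => exact ⟨[], by simp, by simp, by simp⟩
    | add x y _ _ hx hy =>
      obtain ⟨l, hl, hl₁, hl₂⟩ := hx
      obtain ⟨m, hm, hm₁, hm₂⟩ := hy
      refine ⟨l ++ m, ?_, by simp [hl₁, hm₁], by simp [hl₂, hm₂]⟩
      intro z hz
      rcases List.mem_append.1 hz with hz | hz
      exacts [hl z hz, hm z hz]
    | smul a x _ hx =>
      have ha : a = 0 ∨ a = 1 := by revert a; decide
      rcases ha with rfl | rfl
      · exact ⟨[], by simp, by simp, by simp⟩
      · simpa using hx
  have hmem : ((0, 1) : V × ZMod 2) ∉ U := by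
    intro hx
    obtain ⟨l, hl, hl₁, hl₂⟩ := hU _ hx
    exact h l hl hl₁ (ZMod.natCast_eq_one_iff_odd.1 hl₂)
  obtain ⟨g, hg, hgU⟩ := Submodule.exists_le_ker_of_notMem hmem
  refine ⟨g ∘ₗ LinearMap.inl (ZMod 2) V (ZMod 2), fun v hv => ?_⟩
  have h₁ : g (v, 1) = 0 := hgU (Submodule.subset_span ⟨v, hv, rfl⟩)
  have h₂ : g (v, 1) = g (v, 0) + g (0, 1) := by rw [← map_add]; simp
  have h₃ : ∀ a b : ZMod 2, a + b = 0 → b ≠ 0 → a = 1 := by decide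
  exact h₃ _ _ (h₂ ▸ h₁) hg

/-- The connection set of the Clebsch graph, as a Cayley graph on `F₂⁴`. -/
def clebschSet : Finset (Fin 4 → ZMod 2) :=
  {![1, 0, 0, 0], ![0, 1, 0, 0], ![0, 0, 1, 0], ![0, 0, 0, 1], ![1, 1, 1, 1]}

/-- The two disjoint pentagons covering the non-neighbours of `0` in the Clebsch graph. -/
def pentagon : Fin 2 → Finset (Fin 4 → ZMod 2)
  | 0 => {![1, 1, 0, 0], ![0, 0, 1, 1], ![0, 1, 1, 1], ![0, 1, 1, 0], ![1, 1, 1, 0]}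
  | 1 => {![1, 0, 1, 0], ![0, 1, 0, 1], ![1, 0, 0, 1], ![1, 0, 1, 1], ![1, 1, 0, 1]}

theorem card_le_two_of_subset_pentagon : ∀ i, ∀ U ∈ (pentagon i).powerset,
    (∀ a ∈ U, ∀ b ∈ U, a + b ∉ clebschSet) → U.card ≤ 2 := by
  decide

theorem mem_clebsch_cover : ∀ c : Fin 4 → ZMod 2,
    c ∈ clebschSet ∨ c ∈ insert 0 (pentagon 0 ∪ pentagon 1) := by
  decide

/-- The independence number of the Clebsch graph is at most `5`. -/
theorem card_le_five_of_clebsch_indep (T : Finset (Fin 4 → ZMod 2))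
    (h : ∀ a ∈ T, ∀ b ∈ T, a + b ∉ clebschSet) : T.card ≤ 5 := by
  rcases T.eq_empty_or_nonempty with rfl | ⟨c, hc⟩
  · simp
  let T' := T.map (Equiv.addRight c).toEmbedding
  have hT' : ∀ a ∈ T', ∀ b ∈ T', a + b ∉ clebschSet := by
    intro a ha b hb
    obtain ⟨a, ha₀, rfl⟩ := Finset.mem_map.1 ha
    obtain ⟨b, hb₀, rfl⟩ := Finset.mem_map.1 hb
    have : a + c + (b + c) = a + b := by
      rw [add_add_add_comm, ZModModule.add_self, add_zero]
    simpa [this] using h a ha₀ b hb₀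
  have hzero : (0 : Fin 4 → ZMod 2) ∈ T' :=
    Finset.mem_map.2 ⟨c, hc, by simp [ZModModule.add_self]⟩
  have hpent (i : Fin 2) : (T' ∩ pentagon i).card ≤ 2 :=
    card_le_two_of_subset_pentagon i _ (Finset.mem_powerset.2 Finset.inter_subset_right)
      fun a ha b hb => hT' a (Finset.mem_inter.1 ha).1 b (Finset.mem_inter.1 hb).1
  have hsub : T' ⊆ insert 0 ((T' ∩ pentagon 0) ∪ (T' ∩ pentagon 1)) := by
    intro a ha
    have hnot : a ∉ clebschSet := by simpa using hT' a ha 0 hzero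
    have := (mem_clebsch_cover a).resolve_left hnot
    simp only [Finset.mem_insert, Finset.mem_union, Finset.mem_inter] at this ⊢
    tauto
  have h₁ := Finset.card_le_card hsub
  have h₂ := Finset.card_insert_le (0 : Fin 4 → ZMod 2) ((T' ∩ pentagon 0) ∪ (T' ∩ pentagon 1))
  have h₃ := Finset.card_union_le (T' ∩ pentagon 0) (T' ∩ pentagon 1)
  have h₄ : T'.card = T.card := Finset.card_map _
  have h₅ := hpent 0
  have h₆ := hpent 1
  omega

theorem add_add_add_self_eq_add {V : Type*} [AddCommGroup V] [Module (ZMod 2) V] (v p q : V) :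
    (v + p) + (v + q) = p + q := by
  rw [add_add_add_comm, ZModModule.add_self, zero_add]

section OddRelations

variable {V : Type*} [AddCommGroup V] [Module (ZMod 2) V] [Fintype V] [DecidableEq V]

/-- A set satisfying a relation of length five but none of length three has density at most
`5 / 16`. -/
theorem card_le_of_five_relation (S : Finset V)
    (hsum : ∀ a ∈ S, ∀ b ∈ S, a + b ∉ S) (l : List V) (hl : ∀ x ∈ l, x ∈ S)
    (hlen : l.length = 5) (hzero : l.sum = 0) : 16 * S.card ≤ 5 * Fintype.card V := by
  obtain ⟨s, t, u, v, w, rfl⟩ : ∃ s t u v w, l = [s, t, u, v, w] := by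
    match l, hlen with
    | [s, t, u, v, w], _ => exact ⟨s, t, u, v, w, rfl⟩
  let φ := Fintype.linearCombination (ZMod 2) ![s, t, u, v]
  have hw : s + t + u + v = w := by
    rw [← sub_eq_zero, ZModModule.sub_eq_add, ← hzero]
    simp [add_assoc]
  have hφ : ∀ c ∈ clebschSet, φ c ∈ S := by
    intro c hc
    simp only [List.mem_cons, List.not_mem_nil, or_false, forall_eq_or_imp, forall_eq] at hl
    obtain ⟨hs, ht, hu, hv, hw'⟩ := hl
    simp only [clebschSet, Finset.mem_insert, Finset.mem_singleton] at hc
    rcases hc with rfl | rfl | rfl | rfl | rfl <;>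
      simpa [φ, Fintype.linearCombination_apply, Fin.sum_univ_four, hw]
  have := card_mul_card_le_of_translates S φ 5 fun x => by
    refine card_le_five_of_clebsch_indep _ fun a ha b hb hab => ?_
    refine hsum _ (Finset.mem_filter.1 ha).2 _ (Finset.mem_filter.1 hb).2 ?_
    rw [add_add_add_self_eq_add, ← map_add]
    exact hφ _ hab
  simpa using this

/-- A set whose shortest odd relation has length at least seven has density at most `2 / 7`. -/
theorem card_le_of_shortest_odd_relation (S : Finset V) (l : List V) (hl : ∀ x ∈ l, x ∈ S)
    (hodd : Odd l.length) (hzero : l.sum = 0) (hlen : 7 ≤ l.length)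
    (hmin : ∀ m : List V, (∀ x ∈ m, x ∈ S) → m.sum = 0 → Odd m.length → l.length ≤ m.length) :
    7 * S.card ≤ 2 * Fintype.card V := by
  let p : Fin 7 → V := fun i => (l.take i).sum
  have hdiff (v : V) (i j : Fin 7) (hij : i < j) (hi : v + p i ∈ S) (hj : v + p j ∈ S) :
      (j : ℕ) = i + 2 ∨ (j : ℕ) = i + 5 := by
    have hij' : (i : ℕ) < j := hij
    have hj7 : (j : ℕ) < 7 := j.2
    have hsplit : l.take j = l.take i ++ (l.take j).drop i := by
      conv_lhs => rw [← List.take_append_drop i (l.take j)]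
      rw [List.take_take, min_eq_left hij'.le]
    have hpj : p j = p i + ((l.take j).drop i).sum := by
      rw [← List.sum_append, ← hsplit]
    have hlast : p j = (l.drop j).sum := by
      rw [← sub_eq_zero, ZModModule.sub_eq_add, ← List.sum_append, List.take_append_drop, hzero]
    have hinner := hmin ((v + p i) :: (v + p j) :: (l.take j).drop i)
      (by
        simp only [List.forall_mem_cons]
        exact ⟨hi, hj, fun x hx => hl x (List.mem_of_mem_take (List.mem_of_mem_drop hx))⟩)
      (by
        rw [List.sum_cons, List.sum_cons, ← add_assoc, add_add_add_self_eq_add, hpj,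
          ← add_assoc, ZModModule.add_self, zero_add, ZModModule.add_self])
    have houter := hmin ((v + p i) :: (v + p j) :: (l.take i ++ l.drop j))
      (by
        simp only [List.forall_mem_cons, List.forall_mem_append]
        exact ⟨hi, hj, fun x hx => hl x (List.mem_of_mem_take hx),
          fun x hx => hl x (List.mem_of_mem_drop hx)⟩)
      (by
        rw [List.sum_cons, List.sum_cons, ← add_assoc, add_add_add_self_eq_add, List.sum_append,
          ← hlast, ZModModule.add_self])
    simp only [List.length_cons, List.length_append, List.length_drop, List.length_take,
      Nat.odd_iff] at hinner houter hodd
    omega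
  have := card_mul_card_le_of_translates S p 2 fun v => by
    by_contra! hcard
    obtain ⟨a, b, c, ha, hb, hc, hab, hac, hbc⟩ := Finset.two_lt_card_iff.1 hcard
    have hne (i j : Fin 7) (hi : v + p i ∈ S) (hj : v + p j ∈ S) (hij : i ≠ j) :
        (j : ℕ) = i + 2 ∨ (j : ℕ) = i + 5 ∨ (i : ℕ) = j + 2 ∨ (i : ℕ) = j + 5 := by
      rcases lt_or_gt_of_ne hij with h | h
      · have := hdiff v i j h hi hj
        omega
      · have := hdiff v j i h hj hi
        omega
    simp only [Finset.mem_filter, Finset.mem_univ, true_and] at ha hb hc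
    have h₁ := hne a b ha hb hab
    have h₂ := hne a c ha hc hac
    have h₃ := hne b c hb hc hbc
    omega
  simpa using this

/-- A sum-free set of density more than `5 / 16` satisfies no odd relation. -/
theorem not_odd_relation_of_card_lt (S : Finset V) (hsum : ∀ a ∈ S, ∀ b ∈ S, a + b ∉ S)
    (hsize : 5 * Fintype.card V < 16 * S.card) (l : List V) (hl : ∀ x ∈ l, x ∈ S)
    (hzero : l.sum = 0) : ¬ Odd l.length := by
  intro hodd
  have hex : ∃ n, ∃ m : List V, (∀ x ∈ m, x ∈ S) ∧ m.sum = 0 ∧ Odd m.length ∧ m.length = n :=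
    ⟨_, l, hl, hzero, hodd, rfl⟩
  classical
  obtain ⟨m, hm, hm₀, hmodd, hmlen⟩ := Nat.find_spec hex
  have hmin : ∀ m' : List V, (∀ x ∈ m', x ∈ S) → m'.sum = 0 → Odd m'.length →
      m.length ≤ m'.length := fun m' h₁ h₂ h₃ =>
    hmlen ▸ Nat.find_min' hex ⟨m', h₁, h₂, h₃, rfl⟩
  have hone : m.length ≠ 1 := by
    intro h
    obtain ⟨a, rfl⟩ := List.length_eq_one_iff.1 h
    simp only [List.mem_singleton, forall_eq, List.sum_singleton] at hm hm₀
    subst hm₀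
    exact hsum 0 hm 0 hm (by simpa using hm)
  have hthree : m.length ≠ 3 := by
    intro h
    obtain ⟨a, b, c, rfl⟩ := List.length_eq_three.1 h
    simp only [List.mem_cons, List.not_mem_nil, or_false, forall_eq_or_imp, forall_eq,
      List.sum_cons, List.sum_nil, add_zero, ← add_assoc] at hm hm₀
    refine hsum a hm.1 b hm.2.1 ?_
    rw [← ZModModule.sub_eq_add, sub_eq_zero] at hm₀
    exact hm₀ ▸ hm.2.2
  have hfive : m.length ≠ 5 := fun h =>
    absurd (card_le_of_five_relation S hsum m hm h hm₀) (by omega)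
  have hseven : 7 ≤ m.length := by
    rw [Nat.odd_iff] at hmodd
    omega
  have := card_le_of_shortest_odd_relation S m hm hmodd hm₀ hseven hmin
  omega

end OddRelations

theorem IsCap.add_notMem {d : ℕ} {S : Finset (Fin d → ZMod 2)} (hS : IsCap S) :
    ∀ a ∈ S, ∀ b ∈ S, a + b ∉ S := by
  intro a ha b hb hab
  by_cases h : a = b
  · subst h
    exact hS.1 _ hab (ZModModule.add_self a)
  · refine hS.2 a ha b hb _ hab h ?_ ?_ (ZModModule.add_self _)
    · exact fun hb' => hS.1 a ha (by simpa using hb'.symm)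
    · exact fun ha' => hS.1 b hb (by simpa using ha'.symm)

-- Corollary 3.6: a cap in F₂^d (d ≥ 4) with more than 5N/16 = 5·2^(d-4) elements is
-- contained in {v : f v = 1} for some nonzero linear functional f, i.e. the design is
-- obtained by deleting columns from the saturated resolution IV design (an even design).
theorem cap_large_is_even (d : ℕ) (hd : 4 ≤ d) (S : Finset (Fin d → ZMod 2))
    (hcap : IsCap S) (hsize : 5 * 2 ^ (d - 4) < S.card) :
    ∃ f : (Fin d → ZMod 2) →ₗ[ZMod 2] ZMod 2, f ≠ 0 ∧ ∀ v ∈ S, f v = 1 := by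
  have hpow : 2 ^ d = 16 * 2 ^ (d - 4) := by
    rw [show (16 : ℕ) = 2 ^ 4 by rfl, ← pow_add, Nat.add_sub_cancel' hd]
  obtain ⟨f, hf⟩ := exists_dual_eq_one (S : Set (Fin d → ZMod 2)) fun l hl hzero =>
    not_odd_relation_of_card_lt S hcap.add_notMem
      (by simp only [Fintype.card_pi_const, ZMod.card]; omega) l hl hzero
  obtain ⟨v, hv⟩ := Finset.card_pos.1 (by omega : 0 < S.card)
  refine ⟨f, ?_, hf⟩
  rintro rfl
  simpa using hf v hv
end
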